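/- Let p ∈ [1,∞] and q⃗ = (q₁,q₂,q₃) with q_j > 1 for each j and 2/p + 1/q̄ = 2, where 1/q̄ := 1/q₁+1/q₂+1/q₃. There exists a constant C, depending only on p and q⃗ and independent of μ and ρ, such that for every suitable weak solution (u,Π) of the 3D Navier-Stokes equations on Q(ρ) and all 0 < 4√6 μ ≤ ρ: D_{3/2}(μ) ≤ C (ρ/μ)² E_{p,q⃗}(ρ) · E_*(ρ)^{1 − 1/p} · E(ρ)^{1/p} + C (μ/ρ)^{5/2} D_{3/2}(ρ). -/

import Mathlib

open MeasureTheory ENNReal Set Metric Filter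

noncomputable section

/-- Euclidean 3-space. -/
abbrev E3 : Type := EuclideanSpace ℝ (Fin 3)

/-- The point (x₁,x₂,x₃) of ℝ³. -/
def pt3 (x1 x2 x3 : ℝ) : E3 := (WithLp.equiv 2 (Fin 3 → ℝ)).symm ![x1, x2, x3]

/-- Anisotropic Lebesgue (quasi-)norm `‖f‖_{L^{q⃗}(Ω)}` with finite exponents:
iterated L^{q₁}, L^{q₂}, L^{q₃} norms in x₁, x₂, x₃ of f extended by 0 outside Ω. -/
def anisoNorm (q1 q2 q3 : ℝ) (Ω : Set E3) (f : E3 → ℝ) : ℝ≥0∞ :=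
  (∫⁻ x3 : ℝ, (∫⁻ x2 : ℝ, (∫⁻ x1 : ℝ,
      (ENNReal.ofReal |Ω.indicator f (pt3 x1 x2 x3)|) ^ q1) ^ (q2 / q1)) ^ (q3 / q2)) ^ (1 / q3)

/-- Mixed norm `‖f‖_{L^p_t L^{q⃗}_x(Q(r))}`, time exponent `p ∈ [1,∞]`,
where `Q(r) = B(r) × (−r²,0)`. -/
def mixedNorm (p : ℝ≥0∞) (q1 q2 q3 r : ℝ) (f : E3 → ℝ → ℝ) : ℝ≥0∞ :=
  if p = ∞ then
    essSup (fun t => anisoNorm q1 q2 q3 (ball (0 : E3) r) (fun x => f x t))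
      (volume.restrict (Ioo (-(r^2)) 0))
  else
    (∫⁻ t in Ioo (-(r^2)) 0,
        (anisoNorm q1 q2 q3 (ball (0 : E3) r) (fun x => f x t)) ^ p.toReal) ^ (1 / p.toReal)

/-- Partial derivative in the i-th coordinate direction. -/
def pd (i : Fin 3) (f : E3 → ℝ) (x : E3) : ℝ := fderiv ℝ f x (EuclideanSpace.single i 1)

/-- Laplacian. -/
def lap (f : E3 → ℝ) (x : E3) : ℝ := ∑ i : Fin 3, pd i (fun y => pd i f y) x

/-- Scalar test functions compactly supported in `Q(R) = B(R) × (−R²,0)`. -/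
def IsTest (R : ℝ) (φ : E3 → ℝ → ℝ) : Prop :=
  ContDiff ℝ (⊤ : ℕ∞) (fun z : E3 × ℝ => φ z.1 z.2) ∧
  HasCompactSupport (fun z : E3 × ℝ => φ z.1 z.2) ∧
  tsupport (fun z : E3 × ℝ => φ z.1 z.2) ⊆ (ball (0 : E3) R) ×ˢ (Ioo (-(R^2)) 0)

/-- Vector test functions compactly supported in `Q(R) = B(R) × (−R²,0)`. -/
def IsTestV (R : ℝ) (w : E3 → ℝ → E3) : Prop :=
  ContDiff ℝ (⊤ : ℕ∞) (fun z : E3 × ℝ => w z.1 z.2) ∧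
  HasCompactSupport (fun z : E3 × ℝ => w z.1 z.2) ∧
  tsupport (fun z : E3 × ℝ => w z.1 z.2) ⊆ (ball (0 : E3) R) ×ˢ (Ioo (-(R^2)) 0)

/-- A suitable weak solution `(u, P)` of the 3D Navier–Stokes equations on
`Q(R) = B(R) × (−R²,0)`: `u ∈ L^∞_t L²_x` with a distributional spatial gradient
`gu ∈ L²(Q(R))`, pressure `P ∈ L^{3/2}(Q(R))`, the equations hold in the sense of
distributions, and the local energy inequality holds. -/
structure SuitableWeakSolution (R : ℝ) (u : E3 → ℝ → E3) (P : E3 → ℝ → ℝ) where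
  /-- the distributional spatial gradient: `gu x t i j = ∂ⱼuᵢ(x,t)` -/
  gu : E3 → ℝ → Fin 3 → Fin 3 → ℝ
  meas_u : Measurable (Function.uncurry u)
  meas_gu : Measurable (Function.uncurry gu)
  meas_press : Measurable (Function.uncurry P)
  /-- `u ∈ L^∞(−R²,0; L²(B(R)))` -/
  bdd_L2 : essSup (fun t => ∫⁻ x in ball (0 : E3) R, ((‖u x t‖₊ : ℝ≥0∞)) ^ 2)
      (volume.restrict (Ioo (-(R^2)) 0)) < ∞
  /-- `∇u ∈ L²(Q(R))` -/
  grad_L2 : (∫⁻ t in Ioo (-(R^2)) 0, ∫⁻ x in ball (0 : E3) R,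
      ENNReal.ofReal (∑ i : Fin 3, ∑ j : Fin 3, (gu x t i j) ^ 2)) < ∞
  /-- `P ∈ L^{3/2}(Q(R))` -/
  press_L32 : (∫⁻ t in Ioo (-(R^2)) 0, ∫⁻ x in ball (0 : E3) R,
      (ENNReal.ofReal |P x t|) ^ (3/2 : ℝ)) < ∞
  /-- `gu` is the distributional spatial gradient of `u` on `Q(R)` -/
  is_grad : ∀ φ : E3 → ℝ → ℝ, IsTest R φ → ∀ i j : Fin 3,
      (∫ t in Ioo (-(R^2)) 0, ∫ x in ball (0 : E3) R, u x t i * pd j (fun y => φ y t) x)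
        = - ∫ t in Ioo (-(R^2)) 0, ∫ x in ball (0 : E3) R, gu x t i j * φ x t
  /-- `∂ₜu − Δu + (u·∇)u + ∇P = 0` in the sense of distributions on `Q(R)` -/
  weak_NS : ∀ w : E3 → ℝ → E3, IsTestV R w →
      (∫ t in Ioo (-(R^2)) 0, ∫ x in ball (0 : E3) R,
        (-(∑ i : Fin 3, u x t i * deriv (fun s => w x s i) t)
          - (∑ i : Fin 3, u x t i * lap (fun y => w y t i) x)
          - (∑ i : Fin 3, ∑ j : Fin 3, u x t i * u x t j * pd i (fun y => w y t j) x)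
          - P x t * (∑ j : Fin 3, pd j (fun y => w y t j) x))) = 0
  /-- `div u = 0` in the sense of distributions on `Q(R)` -/
  weak_div : ∀ ψ : E3 → ℝ → ℝ, IsTest R ψ →
      (∫ t in Ioo (-(R^2)) 0, ∫ x in ball (0 : E3) R,
        ∑ i : Fin 3, u x t i * pd i (fun y => ψ y t) x) = 0
  /-- the local energy inequality -/
  local_energy : ∀ φ : E3 → ℝ → ℝ, IsTest R φ → (∀ x t, 0 ≤ φ x t) →
      ∀ᵐ t ∂(volume.restrict (Ioo (-(R^2)) 0)),
        (∫ x in ball (0 : E3) R, ‖u x t‖ ^ 2 * φ x t)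
          + 2 * ∫ s in Ioo (-(R^2)) t, ∫ x in ball (0 : E3) R,
              (∑ i : Fin 3, ∑ j : Fin 3, (gu x s i j) ^ 2) * φ x s
        ≤ (∫ s in Ioo (-(R^2)) t, ∫ x in ball (0 : E3) R,
              ‖u x s‖ ^ 2 * (deriv (fun τ => φ x τ) s + lap (fun y => φ y s) x))
          + ∫ s in Ioo (-(R^2)) t, ∫ x in ball (0 : E3) R,
              (∑ i : Fin 3, u x s i * pd i (fun y => φ y s) x) * (‖u x s‖ ^ 2 + 2 * P x s)

/-- `(0,0)` is a regular point of `u`: `u` is essentially bounded on some `Q(r)`, `r > 0`. -/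
def RegularPoint (u : E3 → ℝ → E3) : Prop :=
  ∃ r > (0 : ℝ), ∃ M : ℝ,
    ∀ᵐ z : E3 × ℝ ∂(volume.restrict ((ball (0 : E3) r) ×ˢ (Ioo (-(r^2)) 0))),
      ‖u z.1 z.2‖ ≤ M

/-- `E(r) = sup_{−r²≤t<0} r⁻¹ ∫_{B(r)} |u|² dx` (essential supremum in time). -/
def energyE (r : ℝ) (u : E3 → ℝ → E3) : ℝ≥0∞ :=
  essSup (fun t => (ENNReal.ofReal r)⁻¹ *
      ∫⁻ x in ball (0 : E3) r, ((‖u x t‖₊ : ℝ≥0∞)) ^ 2)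
    (volume.restrict (Ioo (-(r^2)) 0))

/-- `E_*(r) = r⁻¹ ∬_{Q(r)} |∇u|² dx dt`. -/
def energyEstar (r : ℝ) (gu : E3 → ℝ → Fin 3 → Fin 3 → ℝ) : ℝ≥0∞ :=
  (ENNReal.ofReal r)⁻¹ * ∫⁻ t in Ioo (-(r^2)) 0, ∫⁻ x in ball (0 : E3) r,
      ENNReal.ofReal (∑ i : Fin 3, ∑ j : Fin 3, (gu x t i j) ^ 2)

/-- `E₃(r) = r⁻² ∬_{Q(r)} |u|³ dx dt`. -/
def energyE3 (r : ℝ) (u : E3 → ℝ → E3) : ℝ≥0∞ :=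
  ((ENNReal.ofReal r) ^ 2)⁻¹ * ∫⁻ t in Ioo (-(r^2)) 0, ∫⁻ x in ball (0 : E3) r,
      ((‖u x t‖₊ : ℝ≥0∞)) ^ 3

/-- `E_{p,q⃗}(r) = r⁻¹ ‖u − ū_r‖_{L^p_t L^{q⃗}_x(Q(r))}`. -/
def energyEpq (p : ℝ≥0∞) (q1 q2 q3 r : ℝ) (u : E3 → ℝ → E3) : ℝ≥0∞ :=
  (ENNReal.ofReal r)⁻¹ *
    mixedNorm p q1 q2 q3 r (fun x t => ‖u x t - ⨍ y in ball (0 : E3) r, u y t‖)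

/-- `D_{3/2}(r) = r⁻² ∬_{Q(r)} |Π − Π̄_r|^{3/2} dx dt`. -/
def energyD32 (r : ℝ) (P : E3 → ℝ → ℝ) : ℝ≥0∞ :=
  ((ENNReal.ofReal r) ^ 2)⁻¹ * ∫⁻ t in Ioo (-(r^2)) 0, ∫⁻ x in ball (0 : E3) r,
      (ENNReal.ofReal |P x t - ⨍ y in ball (0 : E3) r, P y t|) ^ (3/2 : ℝ)

open scoped Topology

section

namespace NSD

lemma lint_rpow_Ioc {s a : ℝ} (hs : 0 < s) (ha : 0 ≤ a) :
    ∫⁻ τ in Ioc 0 a, ENNReal.ofReal (τ ^ (s - 1)) = ENNReal.ofReal (a ^ s / s) := by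
  have hi : IntervalIntegrable (fun τ : ℝ => τ ^ (s - 1)) volume 0 a :=
    intervalIntegral.intervalIntegrable_rpow' (by linarith)
  have h1 : IntegrableOn (fun τ : ℝ => τ ^ (s - 1)) (Ioc 0 a) :=
    (intervalIntegrable_iff_integrableOn_Ioc_of_le ha).1 hi
  rw [← ofReal_integral_eq_lintegral_ofReal h1]
  · rw [← intervalIntegral.integral_of_le ha, integral_rpow (Or.inl (by linarith))]
    simp [Real.zero_rpow hs.ne']
  · refine (ae_restrict_iff' measurableSet_Ioc).2 (ae_of_all _ fun x hx => ?_)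
    exact Real.rpow_nonneg hx.1.le _

lemma lint_rpow_Ioi {κ a : ℝ} (hκ : 1 < κ) (ha : 0 < a) :
    ∫⁻ τ in Ioi a, ENNReal.ofReal (τ ^ (-κ)) = ENNReal.ofReal (a ^ (1 - κ) / (κ - 1)) := by
  have h1 : IntegrableOn (fun τ : ℝ => τ ^ (-κ)) (Ioi a) :=
    integrableOn_Ioi_rpow_of_lt (by linarith) ha
  rw [← ofReal_integral_eq_lintegral_ofReal h1]
  · rw [integral_Ioi_rpow_of_lt (by linarith) ha]
    congr 1
    rw [show -κ + 1 = 1 - κ by ring, show κ - 1 = -(1 - κ) by ring, div_neg, neg_div]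
  · refine (ae_restrict_iff' measurableSet_Ioi).2 (ae_of_all _ fun x hx => ?_)
    exact Real.rpow_nonneg (ha.trans hx).le _

lemma rpow_le_lint (F : ℝ≥0∞) {s : ℝ} (hs : 0 < s) :
    F ^ s ≤ ENNReal.ofReal s * ∫⁻ τ in Ioi (0:ℝ),
      (if ENNReal.ofReal τ < F then ENNReal.ofReal (τ ^ (s - 1)) else 0) := by
  have key : ∀ a : ℝ, 0 ≤ a → ENNReal.ofReal a ≤ F → ENNReal.ofReal (a ^ s) ≤
      ENNReal.ofReal s * ∫⁻ τ in Ioi (0:ℝ),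
      (if ENNReal.ofReal τ < F then ENNReal.ofReal (τ ^ (s - 1)) else 0) := by
    intro a ha haF
    have h1 : ∫⁻ τ in Ioo 0 a, ENNReal.ofReal (τ ^ (s - 1)) ≤ ∫⁻ τ in Ioi (0:ℝ),
      (if ENNReal.ofReal τ < F then ENNReal.ofReal (τ ^ (s - 1)) else 0) := by
      calc _ = ∫⁻ τ in Ioo 0 a,
          (if ENNReal.ofReal τ < F then ENNReal.ofReal (τ ^ (s - 1)) else 0) := by
            refine setLIntegral_congr_fun measurableSet_Ioo fun τ hτ => ?_
            have : ENNReal.ofReal τ < F :=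
              lt_of_lt_of_le ((ENNReal.ofReal_lt_ofReal_iff (hτ.1.trans hτ.2)).2 hτ.2) haF
            simp [this]
        _ ≤ _ := lintegral_mono_set (fun x hx => hx.1)
    rw [setLIntegral_congr Ioo_ae_eq_Ioc, lint_rpow_Ioc hs ha] at h1
    calc ENNReal.ofReal (a ^ s) = ENNReal.ofReal s * ENNReal.ofReal (a ^ s / s) := by
          rw [← ENNReal.ofReal_mul hs.le]; congr 1; field_simp
      _ ≤ _ := by gcongr
  by_cases hF : F = ∞
  · rw [show F ^ s = ∞ by rw [hF, ENNReal.top_rpow_of_pos hs], top_le_iff]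
    refine ENNReal.eq_top_of_forall_nnreal_le fun r => ?_
    have := key ((r:ℝ) ^ (1/s)) (by positivity) (by simp [hF])
    rw [← Real.rpow_mul r.coe_nonneg, one_div_mul_cancel hs.ne', Real.rpow_one] at this
    simpa using this
  · have := key F.toReal ENNReal.toReal_nonneg (by rw [ENNReal.ofReal_toReal hF])
    rwa [← ENNReal.ofReal_rpow_of_nonneg ENNReal.toReal_nonneg hs.le, ENNReal.ofReal_toReal hF] at this

lemma lint_le_rpow (f : ℝ≥0∞) {s : ℝ} (hs : 0 < s) :
    ∫⁻ τ in Ioi (0:ℝ), (if ENNReal.ofReal (τ ^ s) < f then ENNReal.ofReal (τ ^ (s - 1)) else 0)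
      ≤ ENNReal.ofReal (1 / s) * f := by
  by_cases hf : f = ∞
  · rw [hf, ENNReal.mul_top (by simp [hs])]; exact le_top
  set a : ℝ := f.toReal ^ (1 / s) with ha
  have ha0 : 0 ≤ a := by positivity
  calc _ ≤ ∫⁻ τ in Ioi (0:ℝ), (Ioc 0 a).indicator (fun τ => ENNReal.ofReal (τ ^ (s - 1))) τ := by
        refine setLIntegral_mono' measurableSet_Ioi fun τ hτ => ?_
        split_ifs with h
        · have h2 : τ ^ s < f.toReal := by
            rw [← ENNReal.ofReal_toReal hf] at h
            exact lt_of_not_ge fun h' => absurd h (not_lt.2 (ENNReal.ofReal_le_ofReal h'))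
          have h3 : τ ≤ a := by
            have := Real.rpow_le_rpow (Real.rpow_nonneg hτ.le s) h2.le (by positivity : 0 ≤ 1 / s)
            rwa [← Real.rpow_mul (le_of_lt hτ), mul_one_div_cancel hs.ne', Real.rpow_one] at this
          rw [indicator_of_mem (show τ ∈ Ioc 0 a from ⟨hτ, h3⟩)]
        · exact zero_le
    _ ≤ ∫⁻ τ, (Ioc 0 a).indicator (fun τ => ENNReal.ofReal (τ ^ (s - 1))) τ :=
        setLIntegral_le_lintegral _ _
    _ = ENNReal.ofReal (a ^ s / s) := by
        rw [lintegral_indicator measurableSet_Ioc, lint_rpow_Ioc hs ha0]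
    _ = ENNReal.ofReal (1 / s) * f := by
        rw [ha, ← Real.rpow_mul ENNReal.toReal_nonneg, one_div_mul_cancel hs.ne', Real.rpow_one,
          div_eq_inv_mul, ENNReal.ofReal_mul (by positivity), ENNReal.ofReal_toReal hf, one_div]

lemma lint_even {F : ℝ → ℝ≥0∞} (hF : ∀ x, F (-x) = F x) :
    ∫⁻ x, F x = 2 * ∫⁻ x in Ioi (0:ℝ), F x := by
  have h1 : ∫⁻ x in Iio (0:ℝ), F x = ∫⁻ x in Ioi (0:ℝ), F x := by
    have := (Measure.measurePreserving_neg (volume : Measure ℝ)).setLIntegral_comp_preimage_emb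
      (MeasurableEquiv.neg ℝ).measurableEmbedding F (Ioi 0)
    rw [← this]
    simp [hF]
  rw [← lintegral_add_compl F (measurableSet_Ioi (a := (0:ℝ))), compl_Ioi,
    ← setLIntegral_congr Iio_ae_eq_Iic, h1, two_mul]

/-- 1D Riesz kernel -/
def k1 (κ : ℝ) (z : ℝ) : ℝ≥0∞ := ‖z‖ₑ ^ (-κ)

lemma meas_k1 (κ : ℝ) : Measurable (k1 κ) := by unfold k1; fun_prop

lemma k1_pos {κ z : ℝ} (hz : 0 < z) : k1 κ z = ENNReal.ofReal (z ^ (-κ)) := by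
  rw [k1, Real.enorm_eq_ofReal hz.le, ENNReal.ofReal_rpow_of_pos hz]

lemma k1_near {κ δ : ℝ} (hκ : κ < 1) (hδ : 0 < δ) :
    ∫⁻ z, (if |z| < δ then k1 κ z else 0) ≤ ENNReal.ofReal (2 / (1 - κ) * δ ^ (1 - κ)) := by
  rw [lint_even (by intro x; simp [k1])]
  calc _ ≤ 2 * ∫⁻ z in Ioi (0:ℝ), (Ioc 0 δ).indicator (fun τ => ENNReal.ofReal (τ ^ ((1 - κ) - 1))) z := by
        gcongr 2 * ?_
        refine setLIntegral_mono' measurableSet_Ioi fun z hz => ?_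
        split_ifs with h
        · rw [indicator_of_mem, k1_pos hz]
          · ring_nf; rfl
          · exact ⟨hz, (le_abs_self z).trans h.le⟩
        · exact zero_le
    _ ≤ 2 * ∫⁻ z, (Ioc 0 δ).indicator (fun τ => ENNReal.ofReal (τ ^ ((1 - κ) - 1))) z := by
        gcongr; exact Measure.restrict_le_self
    _ = _ := by
        rw [lintegral_indicator measurableSet_Ioc, lint_rpow_Ioc (by linarith) hδ.le,
          show (2:ℝ≥0∞) = ENNReal.ofReal 2 by simp, ← ENNReal.ofReal_mul (by norm_num)]
        congr 1; ring

lemma k1_far {κ δ : ℝ} (hκ : 1 / 2 < κ) (hδ : 0 < δ) :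
    ∫⁻ z, (if |z| < δ then 0 else k1 κ z) ^ 2 ≤ ENNReal.ofReal (2 / (2 * κ - 1) * δ ^ (1 - 2 * κ)) := by
  rw [lint_even (by intro x; simp [k1])]
  calc _ ≤ 2 * ∫⁻ z in Ioi (0:ℝ), (Ici δ).indicator (fun τ => ENNReal.ofReal (τ ^ (-(2 * κ)))) z := by
        gcongr 2 * ?_
        refine setLIntegral_mono' measurableSet_Ioi fun z hz => ?_
        split_ifs with h
        · simp
        · rw [indicator_of_mem, k1_pos hz, ← ENNReal.ofReal_pow (Real.rpow_nonneg (le_of_lt hz) _),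
            ← Real.rpow_natCast, ← Real.rpow_mul (le_of_lt hz)]
          · ring_nf; rfl
          · rw [abs_of_pos hz] at h; exact not_lt.1 h
    _ ≤ 2 * ∫⁻ z, (Ici δ).indicator (fun τ => ENNReal.ofReal (τ ^ (-(2 * κ)))) z := by
        gcongr; exact Measure.restrict_le_self
    _ = _ := by
        rw [lintegral_indicator measurableSet_Ici, ← setLIntegral_congr Ioi_ae_eq_Ici,
          lint_rpow_Ioi (by linarith) hδ,
          show (2:ℝ≥0∞) = ENNReal.ofReal 2 by simp, ← ENNReal.ofReal_mul (by norm_num)]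
        congr 1; ring


/-- 1D Riesz potential -/
def rz (κ : ℝ) (f : ℝ → ℝ≥0∞) (x : ℝ) : ℝ≥0∞ := ∫⁻ y, k1 κ (x - y) * f y

lemma lintegral_sub_left_self' (F : ℝ → ℝ≥0∞) (x : ℝ) : ∫⁻ y, F (x - y) = ∫⁻ y, F y :=
  lintegral_sub_left_eq_self F x

lemma cs_lint {α : Type*} [MeasurableSpace α] (μ : Measure α) {f g : α → ℝ≥0∞}
    (hf : AEMeasurable f μ) (hg : AEMeasurable g μ) :
    ∫⁻ a, f a * g a ∂μ ≤ (∫⁻ a, f a ^ 2 ∂μ) ^ (1/2 : ℝ) * (∫⁻ a, g a ^ 2 ∂μ) ^ (1/2 : ℝ) := by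
  have := ENNReal.lintegral_mul_le_Lp_mul_Lq μ Real.HolderConjugate.two_two hf hg
  simpa using this

lemma hls1_normalized {κ s : ℝ} (h1 : 1 / 2 < κ) (h2 : κ < 1) (hs : s * (κ - 1/2) = 1) :
    ∃ C : ℝ, 0 < C ∧ ∀ f : ℝ → ℝ≥0∞, Measurable f → ∫⁻ y, f y ^ 2 ≤ 1 →
      ∫⁻ x, (rz κ f x) ^ s ≤ ENNReal.ofReal C := by
  have hs0 : 0 < s := by
    by_contra h
    have := mul_nonpos_of_nonpos_of_nonneg (not_lt.1 h) (by linarith : 0 ≤ κ - 1/2)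
    linarith
  set c1 : ℝ := (2 / (2 * κ - 1)) ^ (1/2 : ℝ) with hc1
  set c2 : ℝ := 2 / (1 - κ) with hc2
  have hc1p : 0 < c1 := Real.rpow_pos_of_pos (div_pos two_pos (by linarith)) _
  have hc2p : 0 < c2 := div_pos two_pos (by linarith)
  set c : ℝ := c1 + c2 + 1 with hc
  have hcp : 0 < c := by positivity
  refine ⟨c ^ s * s * c2 * (1 / (s / 2)), by positivity, fun f hf hf1 => ?_⟩
  have hmk : Measurable (fun z : ℝ × ℝ => k1 κ (z.1 - z.2)) :=
    (meas_k1 κ).comp (measurable_fst.sub measurable_snd)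
  have hmrz : Measurable (rz κ f) :=
    Measurable.lintegral_prod_right' (f := fun z : ℝ × ℝ => k1 κ (z.1 - z.2) * f z.2)
      (hmk.mul (hf.comp measurable_snd))
  -- level set estimate
  have level : ∀ τ : ℝ, 0 < τ → volume {x | ENNReal.ofReal (c * τ) < rz κ f x} ≤
      ENNReal.ofReal (c2 * τ ^ (-(s/2))) *
        ∫⁻ y, (if ENNReal.ofReal (τ ^ (s/2)) < f y then f y else 0) := by
    intro τ hτ
    set δ : ℝ := τ ^ (-s) with hδ
    have hδp : 0 < δ := Real.rpow_pos_of_pos hτ _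
    set h : ℝ≥0∞ := ENNReal.ofReal (τ ^ (s/2)) with hh
    set kn : ℝ → ℝ≥0∞ := fun z => if |z| < δ then k1 κ z else 0 with hkn
    set kf : ℝ → ℝ≥0∞ := fun z => if |z| < δ then 0 else k1 κ z with hkf
    have hset : MeasurableSet {z : ℝ | |z| < δ} := measurableSet_lt (by fun_prop) (by fun_prop)
    have mkn : Measurable kn := Measurable.ite hset (meas_k1 κ) measurable_const
    have mkf : Measurable kf := Measurable.ite hset measurable_const (meas_k1 κ)
    set fh : ℝ → ℝ≥0∞ := fun y => if h < f y then f y else 0 with hfh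
    set fl : ℝ → ℝ≥0∞ := fun y => if h < f y then 0 else f y with hfl
    have mset : MeasurableSet {y | h < f y} := measurableSet_lt measurable_const hf
    have mfh : Measurable fh := Measurable.ite mset hf measurable_const
    have mfl : Measurable fl := Measurable.ite mset measurable_const hf
    have mkn' : ∀ x, Measurable fun y => kn (x - y) := fun x => mkn.comp (by fun_prop)
    have mkf' : ∀ x, Measurable fun y => kf (x - y) := fun x => mkf.comp (by fun_prop)
    have split : ∀ x, rz κ f x = (∫⁻ y, kn (x - y) * fh y) + ((∫⁻ y, kn (x - y) * fl y) +
        ∫⁻ y, kf (x - y) * f y) := by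
      intro x
      rw [rz, ← lintegral_add_left (f := fun y => kn (x - y) * fl y) ((mkn' x).mul mfl),
        ← lintegral_add_left (f := fun y => kn (x - y) * fh y) ((mkn' x).mul mfh)]
      refine lintegral_congr fun y => ?_
      simp only [hkn, hkf, hfh, hfl]
      split_ifs <;> simp
    have near : ∀ x, ∫⁻ y, kn (x - y) ≤ ENNReal.ofReal (c2 * δ ^ (1 - κ)) := by
      intro x
      rw [lintegral_sub_left_self' kn x]
      exact k1_near h2 hδp
    have b2 : ∀ x, ∫⁻ y, kn (x - y) * fl y ≤ ENNReal.ofReal (c2 * τ) := by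
      intro x
      calc _ ≤ ∫⁻ y, kn (x - y) * h := by
            refine lintegral_mono fun y => ?_
            simp only [hfl]
            gcongr
            split_ifs with hy
            · exact zero_le
            · exact not_lt.1 hy
        _ = (∫⁻ y, kn (x - y)) * h := lintegral_mul_const _ (mkn' x)
        _ ≤ ENNReal.ofReal (c2 * δ ^ (1 - κ)) * h := by gcongr; exact near x
        _ = ENNReal.ofReal (c2 * τ) := by
            rw [hh, ← ENNReal.ofReal_mul (by positivity), hδ, ← Real.rpow_mul hτ.le, mul_assoc,
              ← Real.rpow_add hτ, show -s * (1 - κ) + s / 2 = 1 by linarith, Real.rpow_one]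
    have b3 : ∀ x, ∫⁻ y, kf (x - y) * f y ≤ ENNReal.ofReal (c1 * τ) := by
      intro x
      calc _ ≤ (∫⁻ y, kf (x - y) ^ 2) ^ (1/2 : ℝ) * (∫⁻ y, f y ^ 2) ^ (1/2 : ℝ) :=
            cs_lint _ (mkf' x).aemeasurable hf.aemeasurable
        _ ≤ (ENNReal.ofReal (2 / (2 * κ - 1) * δ ^ (1 - 2 * κ))) ^ (1/2 : ℝ) * 1 ^ (1/2 : ℝ) := by
            gcongr
            rw [lintegral_sub_left_self' (fun z => kf z ^ 2) x]
            exact k1_far h1 hδp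
        _ = ENNReal.ofReal (c1 * τ) := by
            rw [ENNReal.one_rpow, mul_one, ENNReal.ofReal_rpow_of_nonneg _ (by norm_num)]
            · rw [Real.mul_rpow (div_nonneg zero_le_two (by linarith)) (by positivity), hδ,
                ← Real.rpow_mul hτ.le, ← Real.rpow_mul hτ.le,
                show -s * (1 - 2 * κ) * (1/2) = 1 by linarith, Real.rpow_one]
            · exact mul_nonneg (div_nonneg zero_le_two (by linarith)) (by positivity)
    have sub : {x | ENNReal.ofReal (c * τ) < rz κ f x} ⊆
        {x | ENNReal.ofReal τ ≤ ∫⁻ y, kn (x - y) * fh y} := by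
      intro x hx
      simp only [mem_ofPred_eq] at hx ⊢
      by_contra hcon
      rw [not_le] at hcon
      have : rz κ f x ≤ ENNReal.ofReal (c * τ) := by
        rw [split x]
        calc _ ≤ ENNReal.ofReal τ + (ENNReal.ofReal (c2 * τ) + ENNReal.ofReal (c1 * τ)) := by
              gcongr
              · exact b2 x
              · exact b3 x
          _ = _ := by
              rw [← ENNReal.ofReal_add (by positivity) (by positivity),
                ← ENNReal.ofReal_add (by positivity) (by positivity)]
              congr 1; rw [hc]; ring
      exact absurd hx (not_lt.2 this)
    have mprod : Measurable (fun z : ℝ × ℝ => kn (z.1 - z.2) * fh z.2) :=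
      (mkn.comp (measurable_fst.sub measurable_snd)).mul (mfh.comp measurable_snd)
    have mnh : Measurable fun x => ∫⁻ y, kn (x - y) * fh y :=
      Measurable.lintegral_prod_right' (f := fun z : ℝ × ℝ => kn (z.1 - z.2) * fh z.2) mprod
    calc volume {x | ENNReal.ofReal (c * τ) < rz κ f x}
        ≤ volume {x | ENNReal.ofReal τ ≤ ∫⁻ y, kn (x - y) * fh y} := measure_mono sub
      _ ≤ (∫⁻ x, ∫⁻ y, kn (x - y) * fh y) / ENNReal.ofReal τ :=
          meas_ge_le_lintegral_div mnh.aemeasurable (by simpa using hτ) ENNReal.ofReal_ne_top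
      _ = (∫⁻ y, (∫⁻ x, kn (x - y)) * fh y) / ENNReal.ofReal τ := by
          rw [lintegral_lintegral_swap mprod.aemeasurable]
          congr 1
          refine lintegral_congr fun y => ?_
          rw [lintegral_mul_const]
          exact mkn.comp (by fun_prop)
      _ ≤ (∫⁻ y, ENNReal.ofReal (c2 * δ ^ (1 - κ)) * fh y) / ENNReal.ofReal τ := by
          gcongr with y
          rw [lintegral_sub_right_eq_self kn y]
          exact k1_near h2 hδp
      _ = _ := by
          rw [lintegral_const_mul _ mfh, div_eq_mul_inv, mul_right_comm,
            ← ENNReal.ofReal_inv_of_pos hτ, ← ENNReal.ofReal_mul (by positivity)]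
          congr 2
          rw [hδ, ← Real.rpow_mul hτ.le, mul_assoc, ← Real.rpow_neg_one, ← Real.rpow_add hτ]
          congr 2; linarith
  -- integrate the level sets
  have mprod2 : Measurable (fun z : ℝ × ℝ => if ENNReal.ofReal z.2 < rz κ f z.1 / ENNReal.ofReal c
      then ENNReal.ofReal (z.2 ^ (s - 1)) else 0) := by
    refine Measurable.ite (measurableSet_lt (by fun_prop) ?_) (by fun_prop) measurable_const
    exact (hmrz.comp measurable_fst).div_const _
  have hcE : ENNReal.ofReal c ≠ 0 := by simpa using hcp
  have mprod3 : Measurable (fun z : ℝ × ℝ => if ENNReal.ofReal (z.1 ^ (s/2)) < f z.2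
      then ENNReal.ofReal (z.1 ^ (s/2 - 1)) * f z.2 else 0) := by
    refine Measurable.ite (measurableSet_lt (by fun_prop) (hf.comp measurable_snd)) ?_ measurable_const
    exact (by fun_prop : Measurable fun z : ℝ × ℝ => ENNReal.ofReal (z.1 ^ (s/2 - 1))).mul
      (hf.comp measurable_snd)
  calc ∫⁻ x, rz κ f x ^ s = ENNReal.ofReal (c ^ s) * ∫⁻ x, (rz κ f x / ENNReal.ofReal c) ^ s := by
        rw [← lintegral_const_mul _ ((hmrz.div_const _).pow_const s)]
        refine lintegral_congr fun x => ?_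
        rw [← ENNReal.ofReal_rpow_of_pos hcp, ← ENNReal.mul_rpow_of_nonneg _ _ hs0.le,
          ENNReal.mul_div_cancel hcE ENNReal.ofReal_ne_top]
    _ ≤ ENNReal.ofReal (c ^ s) * ∫⁻ x, ENNReal.ofReal s * ∫⁻ τ in Ioi (0:ℝ),
          (if ENNReal.ofReal τ < rz κ f x / ENNReal.ofReal c
            then ENNReal.ofReal (τ ^ (s - 1)) else 0) := by
        gcongr with x
        exact rpow_le_lint _ hs0
    _ = ENNReal.ofReal (c ^ s) * (ENNReal.ofReal s * ∫⁻ τ in Ioi (0:ℝ), ∫⁻ x,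
          (if ENNReal.ofReal τ < rz κ f x / ENNReal.ofReal c
            then ENNReal.ofReal (τ ^ (s - 1)) else 0)) := by
        rw [lintegral_const_mul _ (Measurable.lintegral_prod_right' (f := fun z : ℝ × ℝ =>
          if ENNReal.ofReal z.2 < rz κ f z.1 / ENNReal.ofReal c
          then ENNReal.ofReal (z.2 ^ (s - 1)) else 0) mprod2)]
        rw [lintegral_lintegral_swap mprod2.aemeasurable]
    _ ≤ ENNReal.ofReal (c ^ s) * (ENNReal.ofReal s * ∫⁻ τ in Ioi (0:ℝ), ENNReal.ofReal c2 *
          ∫⁻ y, (if ENNReal.ofReal (τ ^ (s/2)) < f y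
            then ENNReal.ofReal (τ ^ (s/2 - 1)) * f y else 0)) := by
        gcongr ENNReal.ofReal (c ^ s) * (ENNReal.ofReal s * ?_)
        refine setLIntegral_mono' measurableSet_Ioi fun τ hτ => ?_
        have hτ' : (0:ℝ) < τ := hτ
        have e1 : ∀ x, (if ENNReal.ofReal τ < rz κ f x / ENNReal.ofReal c
            then ENNReal.ofReal (τ ^ (s - 1)) else 0) =
            {x | ENNReal.ofReal (c * τ) < rz κ f x}.indicator
              (fun _ => ENNReal.ofReal (τ ^ (s - 1))) x := by
          intro x
          rw [indicator_apply]
          congr 1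
          rw [mem_ofPred_eq, ENNReal.lt_div_iff_mul_lt (Or.inl hcE) (Or.inl ENNReal.ofReal_ne_top),
            ← ENNReal.ofReal_mul hτ'.le, mul_comm c]
        simp_rw [e1]
        rw [lintegral_indicator_const (measurableSet_lt measurable_const hmrz)]
        calc _ ≤ ENNReal.ofReal (τ ^ (s - 1)) * (ENNReal.ofReal (c2 * τ ^ (-(s/2))) *
              ∫⁻ y, (if ENNReal.ofReal (τ ^ (s/2)) < f y then f y else 0)) := by
              gcongr; exact level τ hτ'
          _ = ENNReal.ofReal c2 * (ENNReal.ofReal (τ ^ (s/2 - 1)) *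
              ∫⁻ y, (if ENNReal.ofReal (τ ^ (s/2)) < f y then f y else 0)) := by
              rw [← mul_assoc, ← mul_assoc, ← ENNReal.ofReal_mul (by positivity),
                ← ENNReal.ofReal_mul (by positivity)]
              congr 2
              rw [mul_left_comm, ← Real.rpow_add hτ']
              congr 2; ring
          _ = _ := by
              rw [← lintegral_const_mul' _ _ ENNReal.ofReal_ne_top]
              congr 1
              refine lintegral_congr fun y => ?_
              split_ifs <;> simp
    _ = ENNReal.ofReal (c ^ s) * (ENNReal.ofReal s * (ENNReal.ofReal c2 *
          ∫⁻ y, (∫⁻ τ in Ioi (0:ℝ), (if ENNReal.ofReal (τ ^ (s/2)) < f y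
            then ENNReal.ofReal (τ ^ (s/2 - 1)) else 0)) * f y)) := by
        rw [lintegral_const_mul' _ _ ENNReal.ofReal_ne_top,
          lintegral_lintegral_swap mprod3.aemeasurable]
        congr 3
        refine lintegral_congr fun y => ?_
        rw [← lintegral_mul_const]
        · refine lintegral_congr fun τ => ?_
          split_ifs <;> simp
        · exact Measurable.ite (measurableSet_lt (by fun_prop) measurable_const) (by fun_prop)
            measurable_const
    _ ≤ ENNReal.ofReal (c ^ s) * (ENNReal.ofReal s * (ENNReal.ofReal c2 *
          ∫⁻ y, ENNReal.ofReal (1 / (s/2)) * f y * f y)) := by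
        gcongr with y
        exact lint_le_rpow _ (by positivity)
    _ = ENNReal.ofReal (c ^ s) * (ENNReal.ofReal s * (ENNReal.ofReal c2 *
          (ENNReal.ofReal (1 / (s/2)) * ∫⁻ y, f y ^ 2))) := by
        simp_rw [pow_two, mul_assoc]
        rw [lintegral_const_mul' (ENNReal.ofReal (1 / (s/2))) _ ENNReal.ofReal_ne_top]
    _ ≤ ENNReal.ofReal (c ^ s) * (ENNReal.ofReal s * (ENNReal.ofReal c2 *
          (ENNReal.ofReal (1 / (s/2)) * 1))) := by gcongr
    _ = _ := by
        rw [mul_one, ← ENNReal.ofReal_mul (by positivity), ← ENNReal.ofReal_mul (by positivity),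
          ← ENNReal.ofReal_mul (by positivity)]
        congr 1; ring

/-- 1D Hardy-Littlewood-Sobolev inequality, `L² → L^s`. -/
lemma hls1 {κ s : ℝ} (h1 : 1 / 2 < κ) (h2 : κ < 1) (hs : s * (κ - 1/2) = 1) :
    ∃ C : ℝ, 0 < C ∧ ∀ f : ℝ → ℝ≥0∞, Measurable f →
      (∫⁻ x, (rz κ f x) ^ s) ^ (1 / s) ≤ ENNReal.ofReal C * (∫⁻ y, f y ^ 2) ^ (1/2 : ℝ) := by
  have hs0 : 0 < s := by
    by_contra h
    have := mul_nonpos_of_nonpos_of_nonneg (not_lt.1 h) (by linarith : 0 ≤ κ - 1/2)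
    linarith
  obtain ⟨C, hC, H⟩ := hls1_normalized h1 h2 hs
  refine ⟨C ^ (1/s), by positivity, fun f hf => ?_⟩
  set M : ℝ≥0∞ := (∫⁻ y, f y ^ 2) ^ (1/2 : ℝ) with hM
  have hM2 : ∫⁻ y, f y ^ 2 = M ^ 2 := by
    rw [hM, ← ENNReal.rpow_natCast, ← ENNReal.rpow_mul]; simp
  have hCE : ENNReal.ofReal (C ^ (1/s)) ≠ 0 := by simp; positivity
  by_cases hMt : M = ∞
  · rw [hMt, ENNReal.mul_top hCE]; exact le_top
  by_cases hM0 : M = 0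
  · have : ∫⁻ y, f y ^ 2 = 0 := by rw [hM2, hM0]; simp
    rw [lintegral_eq_zero_iff (hf.pow_const 2)] at this
    have hf0 : f =ᵐ[volume] 0 := by
      filter_upwards [this] with y hy
      simpa using hy
    have : ∀ x, rz κ f x = 0 := by
      intro x
      rw [rz, lintegral_congr_ae (g := fun _ => 0), lintegral_zero]
      filter_upwards [hf0] with y hy
      simp [hy]
    simp [this, ENNReal.zero_rpow_of_pos, hs0]
  have := H (fun y => M⁻¹ * f y) (hf.const_mul _) (by
    simp_rw [mul_pow]
    rw [lintegral_const_mul _ (hf.pow_const 2), hM2, ← mul_pow, ENNReal.inv_mul_cancel hM0 hMt, one_pow])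
  have hMi : M⁻¹ ≠ ∞ := by simpa using hM0
  have e : ∀ x, rz κ (fun y => M⁻¹ * f y) x = M⁻¹ * rz κ f x := by
    intro x
    rw [rz, rz, ← lintegral_const_mul' _ _ hMi]
    exact lintegral_congr fun y => by ring
  have e2 : ∫⁻ x, rz κ (fun y => M⁻¹ * f y) x ^ s = (M⁻¹) ^ s * ∫⁻ x, rz κ f x ^ s := by
    rw [← lintegral_const_mul' _ _ (by simp [hs0.le, hMi, hs0])]
    exact lintegral_congr fun x => by rw [e, ENNReal.mul_rpow_of_nonneg _ _ hs0.le]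
  rw [e2] at this
  have h3 : (M⁻¹ ^ s * ∫⁻ x, rz κ f x ^ s) ^ (1/s) ≤ ENNReal.ofReal (C ^ (1/s)) := by
    rw [← ENNReal.ofReal_rpow_of_pos hC]
    exact ENNReal.rpow_le_rpow this (by positivity)
  rw [ENNReal.mul_rpow_of_nonneg _ _ (by positivity), ← ENNReal.rpow_mul,
    mul_one_div_cancel hs0.ne', ENNReal.rpow_one] at h3
  calc _ = M * (M⁻¹ * (∫⁻ x, rz κ f x ^ s) ^ (1/s)) := by
        rw [← mul_assoc, ENNReal.mul_inv_cancel hM0 hMt, one_mul]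
    _ ≤ M * ENNReal.ofReal (C ^ (1/s)) := by gcongr
    _ = _ := mul_comm _ _

end NSD

end

section

namespace NSD

lemma mink2 {α β : Type*} [MeasurableSpace α] [MeasurableSpace β] (μ : Measure α) (ν : Measure β)
    [SFinite μ] [SFinite ν] {g : α × β → ℝ≥0∞} (hg : Measurable g) :
    (∫⁻ x, (∫⁻ y, g (x, y) ∂ν) ^ 2 ∂μ) ^ (1/2 : ℝ) ≤ ∫⁻ y, (∫⁻ x, g (x, y) ^ 2 ∂μ) ^ (1/2 : ℝ) ∂ν := by
  set n : β → ℝ≥0∞ := fun y => (∫⁻ x, g (x, y) ^ 2 ∂μ) ^ (1/2 : ℝ) with hn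
  have mg1 : ∀ x, Measurable fun y => g (x, y) := fun x => hg.comp (by fun_prop)
  have mg2 : ∀ y, Measurable fun x => g (x, y) := fun y => hg.comp (by fun_prop)
  have mn : Measurable n :=
    (Measurable.lintegral_prod_left' (hg.pow_const 2)).pow_const _
  have m3 : Measurable fun z : (α × β) × β => g (z.1.1, z.1.2) * g (z.1.1, z.2) :=
    (hg.comp (by fun_prop)).mul (hg.comp (by fun_prop))
  have key : ∫⁻ x, (∫⁻ y, g (x, y) ∂ν) ^ 2 ∂μ ≤ (∫⁻ y, n y ∂ν) ^ 2 := by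
    calc ∫⁻ x, (∫⁻ y, g (x, y) ∂ν) ^ 2 ∂μ
        = ∫⁻ x, ∫⁻ y, ∫⁻ y', g (x, y) * g (x, y') ∂ν ∂ν ∂μ := by
          refine lintegral_congr fun x => ?_
          rw [pow_two, ← lintegral_mul_const _ (mg1 x)]
          exact lintegral_congr fun y => (lintegral_const_mul _ (mg1 x)).symm
      _ = ∫⁻ y, ∫⁻ x, ∫⁻ y', g (x, y) * g (x, y') ∂ν ∂μ ∂ν :=
          lintegral_lintegral_swap (Measurable.lintegral_prod_right' m3).aemeasurable
      _ = ∫⁻ y, ∫⁻ y', ∫⁻ x, g (x, y) * g (x, y') ∂μ ∂ν ∂ν := by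
          refine lintegral_congr fun y => lintegral_lintegral_swap ?_
          exact (((mg2 y).comp measurable_fst).mul (hg.comp (by fun_prop))).aemeasurable
      _ ≤ ∫⁻ y, ∫⁻ y', n y * n y' ∂ν ∂ν := by
          gcongr with y y'
          exact cs_lint μ (mg2 y).aemeasurable (mg2 y').aemeasurable
      _ = (∫⁻ y, n y ∂ν) ^ 2 := by
          rw [pow_two, ← lintegral_mul_const _ mn]
          exact lintegral_congr fun y => lintegral_const_mul _ mn
  calc _ ≤ ((∫⁻ y, n y ∂ν) ^ 2) ^ (1/2 : ℝ) := ENNReal.rpow_le_rpow key (by norm_num)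
    _ = _ := by rw [← ENNReal.rpow_natCast, ← ENNReal.rpow_mul]; simp

/-- iterated anisotropic norm of an `ℝ≥0∞`-valued function. -/
def aC (q1 q2 q3 : ℝ) (F : ℝ → ℝ → ℝ → ℝ≥0∞) : ℝ≥0∞ :=
  (∫⁻ x3 : ℝ, (∫⁻ x2 : ℝ, (∫⁻ x1 : ℝ, F x1 x2 x3 ^ q1) ^ (q2 / q1)) ^ (q3 / q2)) ^ (1 / q3)

lemma half_sq (a : ℝ≥0∞) : (a ^ (1/2 : ℝ)) ^ 2 = a := by
  rw [← ENNReal.rpow_natCast, ← ENNReal.rpow_mul]; simp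

lemma aC_riesz {κ1 κ2 κ3 s1 s2 s3 : ℝ} (h1 : 1/2 < κ1) (h1' : κ1 < 1) (hs1 : s1 * (κ1 - 1/2) = 1)
    (h2 : 1/2 < κ2) (h2' : κ2 < 1) (hs2 : s2 * (κ2 - 1/2) = 1)
    (h3 : 1/2 < κ3) (h3' : κ3 < 1) (hs3 : s3 * (κ3 - 1/2) = 1)
    (hp1 : 0 < s1) (hp2 : 0 < s2) (hp3 : 0 < s3) :
    ∃ C : ℝ, 0 < C ∧ ∀ G : ℝ × ℝ × ℝ → ℝ≥0∞, Measurable G →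
      aC s1 s2 s3 (fun x1 x2 x3 => ∫⁻ y3, ∫⁻ y2, ∫⁻ y1,
        k1 κ3 (x3 - y3) * (k1 κ2 (x2 - y2) * (k1 κ1 (x1 - y1) * G (y3, y2, y1))))
      ≤ ENNReal.ofReal C * (∫⁻ y3, ∫⁻ y2, ∫⁻ y1, G (y3, y2, y1) ^ 2) ^ (1/2 : ℝ) := by
  obtain ⟨C1, hC1, H1⟩ := hls1 h1 h1' hs1
  obtain ⟨C2, hC2, H2⟩ := hls1 h2 h2' hs2
  obtain ⟨C3, hC3, H3⟩ := hls1 h3 h3' hs3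
  refine ⟨C1 * C2 * C3, by positivity, fun G hG => ?_⟩
  set G1 : ℝ × ℝ → ℝ≥0∞ := fun z => (∫⁻ y1, G (z.1, z.2, y1) ^ 2) ^ (1/2 : ℝ) with hG1
  have mG' : Measurable fun z : (ℝ × ℝ) × ℝ => G (z.1.1, z.1.2, z.2) := hG.comp (by fun_prop)
  have mG1 : Measurable G1 :=
    (Measurable.lintegral_prod_right' (mG'.pow_const 2)).pow_const _
  set G2 : ℝ → ℝ≥0∞ := fun y3 => (∫⁻ y2, G1 (y3, y2) ^ 2) ^ (1/2 : ℝ) with hG2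
  have mG2 : Measurable G2 := (Measurable.lintegral_prod_right' (mG1.pow_const 2)).pow_const _
  -- step 1
  have st1 : ∀ x2 x3, (∫⁻ x1, (∫⁻ y3, ∫⁻ y2, ∫⁻ y1,
        k1 κ3 (x3 - y3) * (k1 κ2 (x2 - y2) * (k1 κ1 (x1 - y1) * G (y3, y2, y1)))) ^ s1) ^ (1/s1)
      ≤ ENNReal.ofReal C1 * ∫⁻ y2, k1 κ2 (x2 - y2) * ∫⁻ y3, k1 κ3 (x3 - y3) * G1 (y3, y2) := by
    intro x2 x3
    have mk2 : Measurable fun y => k1 κ2 (x2 - y) := (meas_k1 κ2).comp (by fun_prop)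
    have mk3 : Measurable fun y => k1 κ3 (x3 - y) := (meas_k1 κ3).comp (by fun_prop)
    set g : ℝ × (ℝ × ℝ) → ℝ≥0∞ := fun z =>
      k1 κ3 (x3 - z.2.1) * (k1 κ2 (x2 - z.2.2) * G (z.2.1, z.2.2, z.1)) with hg
    have mg : Measurable g :=
      (mk3.comp (measurable_fst.comp measurable_snd)).mul
        ((mk2.comp (measurable_snd.comp measurable_snd)).mul (hG.comp (by fun_prop)))
    set H : ℝ → ℝ≥0∞ := fun y1 => ∫⁻ z : ℝ × ℝ, g (y1, z) with hH
    have mH : Measurable H := Measurable.lintegral_prod_right' mg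
    have e1 : ∀ x1, (∫⁻ y3, ∫⁻ y2, ∫⁻ y1,
        k1 κ3 (x3 - y3) * (k1 κ2 (x2 - y2) * (k1 κ1 (x1 - y1) * G (y3, y2, y1)))) = rz κ1 H x1 := by
      intro x1
      have mk : Measurable fun y => k1 κ1 (x1 - y) := (meas_k1 κ1).comp (by fun_prop)
      have m4 : Measurable fun z : ℝ × (ℝ × ℝ) => k1 κ1 (x1 - z.1) * g z :=
        (mk.comp measurable_fst).mul mg
      calc _ = ∫⁻ y3, ∫⁻ y2, ∫⁻ y1, k1 κ1 (x1 - y1) * g (y1, y3, y2) := by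
            refine lintegral_congr fun y3 => lintegral_congr fun y2 => lintegral_congr fun y1 => ?_
            simp only [hg]; ring
        _ = ∫⁻ z : ℝ × ℝ, ∫⁻ y1, k1 κ1 (x1 - y1) * g (y1, z) := by
            have m5 : Measurable fun z : ℝ × ℝ => ∫⁻ y1, k1 κ1 (x1 - y1) * g (y1, z) :=
              Measurable.lintegral_prod_left' m4
            rw [Measure.volume_eq_prod, lintegral_prod _ m5.aemeasurable]
        _ = ∫⁻ y1, ∫⁻ z : ℝ × ℝ, k1 κ1 (x1 - y1) * g (y1, z) := by
            rw [← lintegral_lintegral_swap m4.aemeasurable]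
        _ = _ := by
            rw [rz]
            refine lintegral_congr fun y1 => ?_
            rw [lintegral_const_mul]
            exact mg.comp (by fun_prop)
    simp_rw [e1]
    refine (H1 H mH).trans ?_
    gcongr ENNReal.ofReal C1 * ?_
    refine (mink2 volume volume mg).trans ?_
    have e2 : ∀ z : ℝ × ℝ, (∫⁻ y1, g (y1, z) ^ 2) ^ (1/2 : ℝ) =
        k1 κ2 (x2 - z.2) * (k1 κ3 (x3 - z.1) * G1 z) := by
      intro z
      have : ∀ y1, g (y1, z) ^ 2 = (k1 κ3 (x3 - z.1) * k1 κ2 (x2 - z.2)) ^ 2 * G (z.1, z.2, y1) ^ 2 := by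
        intro y1; simp only [hg]; ring
      have mGz : Measurable fun y1 => G (z.1, z.2, y1) := hG.comp (by fun_prop)
      simp_rw [this]
      rw [lintegral_const_mul _ (mGz.pow_const 2),
        ENNReal.mul_rpow_of_nonneg _ _ (by norm_num), ← ENNReal.rpow_natCast, ← ENNReal.rpow_mul]
      simp only [hG1]
      norm_num
      ring
    simp_rw [e2]
    have m6 : Measurable fun z : ℝ × ℝ => k1 κ2 (x2 - z.2) * (k1 κ3 (x3 - z.1) * G1 z) :=
      (mk2.comp measurable_snd).mul ((mk3.comp measurable_fst).mul mG1)
    rw [Measure.volume_eq_prod, lintegral_prod_symm' _ m6]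
    refine le_of_eq (lintegral_congr fun y2 => ?_)
    have mGz : Measurable fun y3 => G1 (y3, y2) := mG1.comp (by fun_prop)
    have mm : Measurable fun y3 => k1 κ3 (x3 - y3) * G1 (y3, y2) := mk3.mul mGz
    exact lintegral_const_mul (k1 κ2 (x2 - y2)) mm
  -- step 2
  have st2 : ∀ x3, (∫⁻ x2, (∫⁻ y2, k1 κ2 (x2 - y2) * ∫⁻ y3, k1 κ3 (x3 - y3) * G1 (y3, y2)) ^ s2) ^ (1/s2)
      ≤ ENNReal.ofReal C2 * rz κ3 G2 x3 := by
    intro x3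
    have mk3 : Measurable fun y => k1 κ3 (x3 - y) := (meas_k1 κ3).comp (by fun_prop)
    have mg : Measurable fun z : ℝ × ℝ => k1 κ3 (x3 - z.2) * G1 (z.2, z.1) :=
      (mk3.comp measurable_snd).mul (mG1.comp (by fun_prop))
    have mH : Measurable fun y2 => ∫⁻ y3, k1 κ3 (x3 - y3) * G1 (y3, y2) :=
      Measurable.lintegral_prod_right' mg
    refine (H2 _ mH).trans ?_
    gcongr ENNReal.ofReal C2 * ?_
    refine (mink2 volume volume mg).trans ?_
    refine le_of_eq (lintegral_congr fun y3 => ?_)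
    simp only [mul_pow]
    have mGz : Measurable fun y2 => G1 (y3, y2) := mG1.comp (by fun_prop)
    rw [lintegral_const_mul _ (mGz.pow_const 2),
        ENNReal.mul_rpow_of_nonneg _ _ (by norm_num), ← ENNReal.rpow_natCast, ← ENNReal.rpow_mul]
    simp only [hG2]
    norm_num
  have st3 := H3 G2 mG2
  have e3 : ∫⁻ y, G2 y ^ 2 = ∫⁻ y3, ∫⁻ y2, ∫⁻ y1, G (y3, y2, y1) ^ 2 := by
    simp only [hG2, hG1, half_sq]
  rw [e3] at st3
  set L := (∫⁻ y3, ∫⁻ y2, ∫⁻ y1, G (y3, y2, y1) ^ 2) ^ (1/2 : ℝ) with hL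
  have pull : ∀ (c : ℝ) (s : ℝ) (f : ℝ → ℝ≥0∞), 0 < s → (∫⁻ x, (ENNReal.ofReal c * f x) ^ s) ^ (1/s) =
      ENNReal.ofReal c * (∫⁻ x, f x ^ s) ^ (1/s) := by
    intro c s f hs
    simp_rw [ENNReal.mul_rpow_of_nonneg _ _ hs.le]
    rw [lintegral_const_mul' _ _ (by simp [hs.le]), ENNReal.mul_rpow_of_nonneg _ _ (by positivity),
      ← ENNReal.rpow_mul, mul_one_div_cancel hs.ne', ENNReal.rpow_one]
  have rp : ∀ (X : ℝ≥0∞) (a b : ℝ), X ^ (a / b) = (X ^ (1 / b)) ^ a := by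
    intro X a b; rw [← ENNReal.rpow_mul]; congr 1; ring
  rw [aC]
  simp_rw [rp _ s2 s1, rp _ s3 s2]
  calc _ ≤ (∫⁻ x3, ((∫⁻ x2, (ENNReal.ofReal C1 * ∫⁻ y2, k1 κ2 (x2 - y2) *
            ∫⁻ y3, k1 κ3 (x3 - y3) * G1 (y3, y2)) ^ s2) ^ (1/s2)) ^ s3) ^ (1/s3) := by
        gcongr with x3 x2
        exact st1 x2 x3
    _ ≤ (∫⁻ x3, (ENNReal.ofReal (C1 * C2) * rz κ3 G2 x3) ^ s3) ^ (1/s3) := by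
        gcongr with x3
        rw [pull _ _ _ hp2, ENNReal.ofReal_mul hC1.le, mul_assoc]
        gcongr
        exact st2 x3
    _ = ENNReal.ofReal (C1 * C2) * (∫⁻ x3, rz κ3 G2 x3 ^ s3) ^ (1/s3) := pull _ _ _ hp3
    _ ≤ ENNReal.ofReal (C1 * C2) * (ENNReal.ofReal C3 * L) := by gcongr
    _ = _ := by rw [← mul_assoc, ← ENNReal.ofReal_mul (by positivity)]

end NSD

end

section

namespace NSD

@[simp] lemma pt3_0 (a b c : ℝ) : pt3 a b c 0 = a := rfl
@[simp] lemma pt3_1 (a b c : ℝ) : pt3 a b c 1 = b := rfl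
@[simp] lemma pt3_2 (a b c : ℝ) : pt3 a b c 2 = c := rfl

/-- coordinates as a measurable equivalence -/
def T3 : ℝ × ℝ × ℝ → E3 := fun z => pt3 z.2.2 z.2.1 z.1

lemma meas_T3 : Measurable T3 := by
  have h : T3 = (fun v : Fin 3 → ℝ => (WithLp.toLp 2 v : E3)) ∘ (fun z : ℝ × ℝ × ℝ => ![z.2.2, z.2.1, z.1]) := rfl
  rw [h]
  refine Measurable.comp (WithLp.measurable_toLp 2 (Fin 3 → ℝ)) ?_
  rw [measurable_pi_iff]
  intro i
  fin_cases i
  · exact measurable_snd.comp measurable_snd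
  · exact measurable_fst.comp measurable_snd
  · exact measurable_fst

lemma mp_T3 : MeasurePreserving T3 volume volume := by
  have a := (volume_preserving_piFinSuccAbove (fun _ : Fin 3 => ℝ) 2).symm
  have b := (volume_preserving_finTwoArrow ℝ).symm
  have c := (MeasurePreserving.id (volume : Measure ℝ)).prod b
  have d : MeasurePreserving (Prod.swap : ℝ × ℝ → ℝ × ℝ) volume volume := Measure.measurePreserving_swap
  have d' := (MeasurePreserving.id (volume : Measure ℝ)).prod d
  have e := PiLp.volume_preserving_toLp (Fin 3)
  have f := e.comp (a.comp (c.comp d'))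
  have hT : T3 = (WithLp.toLp 2) ∘ (MeasurableEquiv.piFinSuccAbove (fun _ : Fin 3 => ℝ) 2).symm ∘
      Prod.map id (MeasurableEquiv.finTwoArrow (α := ℝ)).symm ∘ Prod.map id Prod.swap := by
    funext z
    ext i
    fin_cases i <;> rfl
  rw [hT]
  exact f

lemma lint_E3 {F : E3 → ℝ≥0∞} (hF : Measurable F) :
    ∫⁻ x, F x = ∫⁻ x3, ∫⁻ x2, ∫⁻ x1, F (pt3 x1 x2 x3) := by
  rw [← mp_T3.lintegral_comp hF]
  have m : Measurable fun z => F (T3 z) := hF.comp meas_T3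
  rw [Measure.volume_eq_prod, lintegral_prod _ m.aemeasurable]
  refine lintegral_congr fun x3 => ?_
  have m2 : Measurable fun z : ℝ × ℝ => F (T3 (x3, z)) := m.comp (by fun_prop)
  rw [Measure.volume_eq_prod, lintegral_prod _ m2.aemeasurable]
  rfl

lemma ae_E3 {p : E3 → Prop} (h : ∀ᵐ x, p x) : ∀ᵐ x3 : ℝ, ∀ᵐ x2 : ℝ, ∀ᵐ x1 : ℝ, p (pt3 x1 x2 x3) := by
  have h1 : ∀ᵐ z : ℝ × ℝ × ℝ, p (T3 z) := mp_T3.quasiMeasurePreserving.ae h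
  have h2 := Measure.ae_ae_of_ae_prod h1
  filter_upwards [h2] with x3 h3
  exact Measure.ae_ae_of_ae_prod h3

/-- anisotropic norm of an `ℝ≥0∞`-valued function on `E3`. -/
def aN (q1 q2 q3 : ℝ) (F : E3 → ℝ≥0∞) : ℝ≥0∞ := aC q1 q2 q3 fun x1 x2 x3 => F (pt3 x1 x2 x3)

lemma aN_mono {q1 q2 q3 : ℝ} (h1 : 0 < q1) (h2 : 0 < q2) (h3 : 0 < q3) {F F' : E3 → ℝ≥0∞}
    (h : ∀ᵐ x, F x ≤ F' x) : aN q1 q2 q3 F ≤ aN q1 q2 q3 F' := by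
  unfold aN aC
  refine ENNReal.rpow_le_rpow ?_ (by positivity)
  refine lintegral_mono_ae ?_
  filter_upwards [ae_E3 h] with x3 H3
  refine ENNReal.rpow_le_rpow ?_ (by positivity)
  refine lintegral_mono_ae ?_
  filter_upwards [H3] with x2 H2
  refine ENNReal.rpow_le_rpow ?_ (by positivity)
  refine lintegral_mono_ae ?_
  filter_upwards [H2] with x1 H1
  exact ENNReal.rpow_le_rpow H1 h1.le

lemma aN_const_mul {q1 q2 q3 : ℝ} (h1 : 0 < q1) (h2 : 0 < q2) (h3 : 0 < q3) (c : ℝ≥0∞) (hc : c ≠ ∞)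
    (F : E3 → ℝ≥0∞) : aN q1 q2 q3 (fun x => c * F x) = c * aN q1 q2 q3 F := by
  unfold aN aC
  simp_rw [ENNReal.mul_rpow_of_nonneg _ _ h1.le]
  have pull : ∀ (e e' : ℝ) (f : ℝ → ℝ≥0∞), 0 ≤ e → 0 ≤ e' → (∫⁻ x, c ^ e * f x) ^ e' = c ^ (e * e') * (∫⁻ x, f x) ^ e' := by
    intro e e' f he he'
    rw [lintegral_const_mul' _ _ (by simp [hc, he]), ENNReal.mul_rpow_of_nonneg _ _ he', ← ENNReal.rpow_mul]
  simp_rw [pull q1 (q2/q1) _ h1.le (by positivity)]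
  rw [show q1 * (q2 / q1) = q2 by field_simp]
  simp_rw [pull q2 (q3/q2) _ h2.le (by positivity)]
  rw [show q2 * (q3 / q2) = q3 by field_simp]
  rw [pull q3 (1/q3) _ h3.le (by positivity)]
  rw [show q3 * (1 / q3) = 1 by field_simp, ENNReal.rpow_one]

lemma hol1 {α : Type*} [MeasurableSpace α] (μ : Measure α) {a b q s : ℝ} (ha : 0 ≤ a) (hb : 0 ≤ b)
    (hq : 0 < q) (hs : 0 < s)
    (h : a / q + b / s = 1) {f g : α → ℝ≥0∞} (hf : AEMeasurable f μ) (hg : AEMeasurable g μ) :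
    ∫⁻ x, f x ^ a * g x ^ b ∂μ ≤ (∫⁻ x, f x ^ q ∂μ) ^ (a / q) * (∫⁻ x, g x ^ s ∂μ) ^ (b / s) := by
  have := ENNReal.lintegral_mul_norm_pow_le (hf.pow_const q) (hg.pow_const s) (p := a/q) (q := b/s)
    (by positivity) (by positivity) h
  refine le_trans (le_of_eq ?_) this
  refine lintegral_congr fun x => ?_
  rw [← ENNReal.rpow_mul, ← ENNReal.rpow_mul]
  congr 2 <;> field_simp

lemma aN_holder {q1 q2 q3 s1 s2 s3 a b : ℝ} (h1 : 0 < q1) (h2 : 0 < q2) (h3 : 0 < q3)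
    (h1' : 0 < s1) (h2' : 0 < s2) (h3' : 0 < s3) (ha : 0 ≤ a) (hb : 0 ≤ b)
    (e1 : a / q1 + b / s1 = 1) (e2 : a / q2 + b / s2 = 1) (e3 : a / q3 + b / s3 = 1)
    {F F' : E3 → ℝ≥0∞} (hF : Measurable F) (hF' : Measurable F') :
    ∫⁻ x, F x ^ a * F' x ^ b ≤ aN q1 q2 q3 F ^ a * aN s1 s2 s3 F' ^ b := by
  rw [lint_E3 (F := fun x => F x ^ a * F' x ^ b) ((hF.pow_const _).mul (hF'.pow_const _))]
  have M : ∀ H : E3 → ℝ≥0∞, Measurable H → Measurable fun z : (ℝ × ℝ) × ℝ => H (pt3 z.2 z.1.2 z.1.1) :=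
    fun H hH => hH.comp (meas_T3.comp (by fun_prop : Measurable fun z : (ℝ × ℝ) × ℝ => (z.1.1, z.1.2, z.2)))
  have M1 : ∀ H : E3 → ℝ≥0∞, Measurable H → ∀ (q : ℝ), Measurable fun z : ℝ × ℝ => ∫⁻ x1, H (pt3 x1 z.2 z.1) ^ q :=
    fun H hH q => Measurable.lintegral_prod_right' ((M H hH).pow_const q)
  have M2 : ∀ H : E3 → ℝ≥0∞, Measurable H → ∀ (q e : ℝ), Measurable fun x3 => ∫⁻ x2, (∫⁻ x1, H (pt3 x1 x2 x3) ^ q) ^ e :=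
    fun H hH q e => Measurable.lintegral_prod_right' ((M1 H hH q).pow_const e)
  have rp : ∀ (X : ℝ≥0∞) (a b : ℝ), X ^ (a / b) = (X ^ (1 / b)) ^ a := by
    intro X a b; rw [← ENNReal.rpow_mul]; congr 1; ring
  have mp : ∀ x2 x3 : ℝ, Measurable fun x1 => pt3 x1 x2 x3 := fun x2 x3 =>
    meas_T3.comp (by fun_prop : Measurable fun x1 : ℝ => (x3, x2, x1))
  unfold aN aC
  calc ∫⁻ x3, ∫⁻ x2, ∫⁻ x1, F (pt3 x1 x2 x3) ^ a * F' (pt3 x1 x2 x3) ^ b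
      ≤ ∫⁻ x3, ∫⁻ x2, ((∫⁻ x1, F (pt3 x1 x2 x3) ^ q1) ^ (1/q1)) ^ a * ((∫⁻ x1, F' (pt3 x1 x2 x3) ^ s1) ^ (1/s1)) ^ b := by
        gcongr with x3 x2
        rw [← rp, ← rp]
        exact hol1 volume ha hb h1 h1' e1 (hF.comp (mp x2 x3)).aemeasurable (hF'.comp (mp x2 x3)).aemeasurable
    _ ≤ ∫⁻ x3, ((∫⁻ x2, (∫⁻ x1, F (pt3 x1 x2 x3) ^ q1) ^ (q2/q1)) ^ (1/q2)) ^ a *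
          ((∫⁻ x2, (∫⁻ x1, F' (pt3 x1 x2 x3) ^ s1) ^ (s2/s1)) ^ (1/s2)) ^ b := by
        gcongr with x3
        rw [← rp, ← rp]
        simp_rw [rp _ q2 q1, rp _ s2 s1]
        refine hol1 volume ha hb h2 h2' e2 ?_ ?_
        · exact ((Measurable.comp (M1 F hF q1) (by fun_prop : Measurable fun x2 : ℝ => (x3, x2))).pow_const _).aemeasurable
        · exact ((Measurable.comp (M1 F' hF' s1) (by fun_prop : Measurable fun x2 : ℝ => (x3, x2))).pow_const _).aemeasurable
    _ ≤ _ := by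
        rw [← rp, ← rp]
        simp_rw [rp _ q3 q2, rp _ s3 s2]
        refine hol1 volume ha hb h3 h3' e3 ?_ ?_
        · exact ((M2 F hF q1 _).pow_const _).aemeasurable
        · exact ((M2 F' hF' s1 _).pow_const _).aemeasurable

lemma abs_coord_le (z : E3) (i : Fin 3) : ‖z i‖ₑ ≤ ‖z‖ₑ := by
  have := PiLp.norm_apply_le z i
  rwa [← ofReal_norm, ← ofReal_norm, ENNReal.ofReal_le_ofReal_iff (norm_nonneg _)]

lemma aN_riesz {s1 s2 s3 γ : ℝ} (h1 : 2 < s1) (h2 : 2 < s2) (h3 : 2 < s3)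
    (hγ : γ = 3/2 - (1/s1 + 1/s2 + 1/s3)) :
    ∃ C : ℝ, 0 < C ∧ ∀ G : E3 → ℝ≥0∞, Measurable G →
      aN s1 s2 s3 (fun x => ∫⁻ y, ‖x - y‖ₑ ^ (-(3 - γ)) * G y)
      ≤ ENNReal.ofReal C * (∫⁻ y, G y ^ 2) ^ (1/2 : ℝ) := by
  have hk : ∀ s : ℝ, 2 < s → 1/2 < 1/2 + 1/s ∧ 1/2 + 1/s < 1 ∧ s * ((1/2 + 1/s) - 1/2) = 1 ∧ 0 < s := by
    intro s hs
    have h0 : 0 < s := by linarith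
    have : 0 < 1/s := by positivity
    have : 1/s < 1/2 := one_div_lt_one_div_of_lt (by norm_num) hs
    exact ⟨by linarith, by linarith, by field_simp; ring, h0⟩
  obtain ⟨a1, b1, c1, d1⟩ := hk s1 h1
  obtain ⟨a2, b2, c2, d2⟩ := hk s2 h2
  obtain ⟨a3, b3, c3, d3⟩ := hk s3 h3
  obtain ⟨C, hC, H⟩ := aC_riesz a1 b1 c1 a2 b2 c2 a3 b3 c3 d1 d2 d3
  refine ⟨C, hC, fun G hG => ?_⟩
  have := H (fun z => G (T3 z)) (hG.comp meas_T3)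
  rw [lint_E3 (hG.pow_const 2)]
  refine le_trans ?_ this
  unfold aN aC
  gcongr with x3 x2 x1
  beta_reduce
  rw [lint_E3 (by fun_prop)]
  refine lintegral_mono fun y3 => lintegral_mono fun y2 => lintegral_mono fun y1 => ?_
  change _ ≤ _ * (_ * (_ * G (pt3 y1 y2 y3)))
  rw [← mul_assoc, ← mul_assoc]
  refine mul_le_mul_left ?_ _
  set z := pt3 x1 x2 x3 - pt3 y1 y2 y3 with hz
  have z0 : x1 - y1 = z 0 := rfl
  have z1 : x2 - y2 = z 1 := rfl
  have z2 : x3 - y3 = z 2 := rfl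
  rw [z0, z1, z2]
  unfold k1
  rcases eq_or_ne z 0 with h0 | h0
  · rw [h0]
    have : ∀ k : ℝ, 1/2 < k → (0:ℝ≥0∞) ^ (-k) = ∞ := fun k hk => ENNReal.zero_rpow_of_neg (by linarith)
    simp only [PiLp.zero_apply, enorm_zero, this _ a1, this _ a2, this _ a3]
    simp
  · have e : -(3 - γ) = -(1/2 + 1/s3) + -(1/2 + 1/s2) + -(1/2+1/s1) := by rw [hγ]; ring
    rw [e, ENNReal.rpow_add _ _ (by simpa using h0) (by simp), ENNReal.rpow_add _ _ (by simpa using h0) (by simp)]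
    have : ∀ (k : ℝ) i, 1/2 < k → ‖z‖ₑ ^ (-k) ≤ ‖z i‖ₑ ^ (-k) := by
      intro k i hk
      rw [ENNReal.rpow_neg, ENNReal.rpow_neg]
      exact ENNReal.inv_le_inv.2 (ENNReal.rpow_le_rpow (abs_coord_le z i) (by linarith))
    exact mul_le_mul' (mul_le_mul' (this _ _ a3) (this _ _ a2)) (this _ _ a1)

end NSD

end

section

namespace NSD

/-- convolution of nonnegative functions -/
def cv (k f : E3 → ℝ≥0∞) (x : E3) : ℝ≥0∞ := ∫⁻ y, k (x - y) * f y

lemma meas_cv {k f : E3 → ℝ≥0∞} (hk : Measurable k) (hf : Measurable f) : Measurable (cv k f) := by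
  unfold cv
  refine Measurable.lintegral_prod_right' (f := fun z : E3 × E3 => k (z.1 - z.2) * f z.2) ?_
  exact (hk.comp (by fun_prop)).mul (hf.comp (by fun_prop))

lemma young {a s b : ℝ} (ha : 0 < a) (hs : 0 < s) (hb : 0 < b) (hab : a ≤ b) (hsb : s ≤ b)
    (h : 1/a + 1/s = 1 + 1/b) {k f : E3 → ℝ≥0∞} (hk : Measurable k) (hf : Measurable f) :
    ∫⁻ x, cv k f x ^ b ≤ (∫⁻ x, k x ^ s) ^ (b/s) * (∫⁻ x, f x ^ a) ^ (b/a) := by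
  set K := ∫⁻ x, k x ^ s with hK
  set F := ∫⁻ x, f x ^ a with hF
  have p2 : 0 ≤ 1/s - 1/b := sub_nonneg.2 (one_div_le_one_div_of_le hs hsb)
  have p3 : 0 ≤ 1/a - 1/b := sub_nonneg.2 (one_div_le_one_div_of_le ha hab)
  have p1 : 0 ≤ 1/b := by positivity
  have mkx : ∀ x, Measurable fun y => k (x - y) := fun x => hk.comp (by fun_prop)
  have pt : ∀ x, cv k f x ≤ (∫⁻ y, k (x - y) ^ s * f y ^ a) ^ (1/b) * (K ^ (1/s - 1/b) * F ^ (1/a - 1/b)) := by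
    intro x
    have hh := ENNReal.lintegral_prod_norm_pow_le (μ := (volume : Measure E3)) (Finset.univ : Finset (Fin 3))
      (f := ![fun y => k (x - y) ^ s * f y ^ a, fun y => k (x - y) ^ s, fun y => f y ^ a])
      (p := ![1/b, 1/s - 1/b, 1/a - 1/b]) (by
        intro i _
        fin_cases i
        · exact (((mkx x).pow_const s).mul (hf.pow_const a)).aemeasurable
        · exact ((mkx x).pow_const s).aemeasurable
        · exact (hf.pow_const a).aemeasurable) (by
        simp [Fin.sum_univ_three]; simp only [one_div] at h; linarith) (by
        intro i _; fin_cases i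
        · exact p1
        · exact p2
        · exact p3)
    simp only [Fin.prod_univ_three, Matrix.cons_val_zero, Matrix.cons_val_one, Matrix.cons_val_two,
      Matrix.head_cons, Matrix.tail_cons] at hh
    have hKx : ∫⁻ y, k (x - y) ^ s = K := lintegral_sub_left_eq_self (fun y => k y ^ s) x
    rw [hKx] at hh
    rw [← mul_assoc]
    refine le_trans (le_of_eq ?_) hh
    refine lintegral_congr fun y => ?_
    rw [ENNReal.mul_rpow_of_nonneg _ _ p1, ← ENNReal.rpow_mul, ← ENNReal.rpow_mul, ← ENNReal.rpow_mul,
      ← ENNReal.rpow_mul]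
    have e1 : k (x - y) = k (x - y) ^ (s * (1/b)) * k (x-y) ^ (s * (1/s - 1/b)) := by
      rw [← ENNReal.rpow_add_of_nonneg _ _ (by positivity) (by positivity)]
      rw [show s * (1/b) + s * (1/s - 1/b) = 1 by field_simp; ring, ENNReal.rpow_one]
    have e2 : f y = f y ^ (a * (1/b)) * f y ^ (a * (1/a - 1/b)) := by
      rw [← ENNReal.rpow_add_of_nonneg _ _ (by positivity) (by positivity)]
      rw [show a * (1/b) + a * (1/a - 1/b) = 1 by field_simp; ring, ENNReal.rpow_one]
    nth_rewrite 1 [e1]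
    nth_rewrite 1 [e2]
    ring
  have m3 : Measurable fun z : E3 × E3 => k (z.1 - z.2) ^ s * f z.2 ^ a :=
    ((hk.comp (by fun_prop)).pow_const s).mul ((hf.comp (by fun_prop)).pow_const a)
  have ff : ∫⁻ x, ∫⁻ y, k (x - y) ^ s * f y ^ a = K * F := by
    rw [lintegral_lintegral_swap m3.aemeasurable]
    have : ∀ y, ∫⁻ x, k (x - y) ^ s * f y ^ a = K * f y ^ a := by
      intro y
      have mm : Measurable fun x => k (x - y) := hk.comp (by fun_prop)
      rw [lintegral_mul_const _ (mm.pow_const s)]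
      congr 1
      exact lintegral_sub_right_eq_self (fun y => k y ^ s) y
    simp_rw [this]
    rw [lintegral_const_mul _ (hf.pow_const a)]
  calc ∫⁻ x, cv k f x ^ b
      ≤ ∫⁻ x, ((∫⁻ y, k (x - y) ^ s * f y ^ a) ^ (1/b) * (K ^ (1/s - 1/b) * F ^ (1/a - 1/b))) ^ b := by
        gcongr with x; exact pt x
    _ = ∫⁻ x, (∫⁻ y, k (x - y) ^ s * f y ^ a) * (K ^ (1/s - 1/b) * F ^ (1/a - 1/b)) ^ b := by
        refine lintegral_congr fun x => ?_
        rw [ENNReal.mul_rpow_of_nonneg _ _ hb.le, ← ENNReal.rpow_mul, one_div_mul_cancel hb.ne', ENNReal.rpow_one]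
    _ = K * F * (K ^ (1/s - 1/b) * F ^ (1/a - 1/b)) ^ b := by
        rw [lintegral_mul_const _ (Measurable.lintegral_prod_right' m3), ff]
    _ = _ := by
        rw [ENNReal.mul_rpow_of_nonneg _ _ hb.le, ← ENNReal.rpow_mul, ← ENNReal.rpow_mul]
        have e1 : K ^ (b/s) = K * K ^ ((1/s - 1/b) * b) := by
          nth_rewrite 2 [← ENNReal.rpow_one K]
          rw [← ENNReal.rpow_add_of_nonneg _ _ (by norm_num) (by positivity)]
          congr 1; field_simp; ring
        have e2 : F ^ (b/a) = F * F ^ ((1/a - 1/b) * b) := by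
          nth_rewrite 2 [← ENNReal.rpow_one F]
          rw [← ENNReal.rpow_add_of_nonneg _ _ (by norm_num) (by positivity)]
          congr 1; field_simp; ring
        rw [e1, e2]; ring

lemma lint_scale {F : E3 → ℝ≥0∞} (hF : Measurable F) {l : ℝ} (hl : 0 < l) :
    ∫⁻ x, F x = ENNReal.ofReal (l ^ 3) * ∫⁻ x, F (l • x) := by
  have h1 := Measure.map_addHaar_smul (volume : Measure E3) hl.ne'
  have h2 : ∫⁻ x, F (l • x) = ∫⁻ x, F x ∂(Measure.map (fun x : E3 => l • x) volume) :=
    (lintegral_map hF (by fun_prop)).symm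
  rw [h2, h1, lintegral_smul_measure]
  simp only [finrank_euclideanSpace, Fintype.card_fin, smul_eq_mul]
  rw [← mul_assoc, ← ENNReal.ofReal_mul (by positivity), abs_of_pos (by positivity),
    mul_inv_cancel₀ (by positivity)]
  simp

/-- near kernel -/
def kn (l : ℝ) (z : E3) : ℝ := l ^ 2 * (‖z‖ ^ 2)⁻¹ * (‖z‖ ^ 2 + l ^ 2)⁻¹
/-- far kernel -/
def kf (l : ℝ) (z : E3) : ℝ := (‖z‖ ^ 2 + l ^ 2) ^ (-(3/2) : ℝ)

lemma kn_nonneg (l : ℝ) (z : E3) : 0 ≤ kn l z := by unfold kn; positivity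
lemma kf_nonneg (l : ℝ) (z : E3) : 0 ≤ kf l z := by unfold kf; positivity
lemma meas_kn (l : ℝ) : Measurable (kn l) := by unfold kn; fun_prop
lemma meas_kf (l : ℝ) : Measurable (kf l) := by unfold kf; fun_prop

lemma kn_int : ∃ C : ℝ, 0 < C ∧ ∀ l : ℝ, 0 < l → ∫⁻ z, ENNReal.ofReal (kn l z) ≤ ENNReal.ofReal (C * l) := by
  have hi : Integrable (fun z : E3 => kn 1 z) volume := by
    have h := (integrable_fun_norm_addHaar (volume : Measure E3)
      (f := fun y : ℝ => 1 ^ 2 * (y ^ 2)⁻¹ * (y ^ 2 + 1 ^ 2)⁻¹)).2 ?_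
    · exact h
    · refine (integrable_inv_one_add_sq.integrableOn (s := Ioi 0)).congr_fun ?_ measurableSet_Ioi
      intro y hy
      have : (0:ℝ) < y := hy
      simp only [finrank_euclideanSpace, Fintype.card_fin, smul_eq_mul]
      norm_num
      field_simp
      ring
  have hfin : ∫⁻ z, ENNReal.ofReal (kn 1 z) < ∞ := hi.lintegral_lt_top
  refine ⟨(∫⁻ z, ENNReal.ofReal (kn 1 z)).toReal + 1, by positivity, fun l hl => ?_⟩
  rw [lint_scale (meas_kn l).ennreal_ofReal hl]
  have : ∀ x, ENNReal.ofReal (kn l (l • x)) = ENNReal.ofReal ((l^2)⁻¹) * ENNReal.ofReal (kn 1 x) := by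
    intro x
    rw [← ENNReal.ofReal_mul (by positivity)]
    congr 1
    unfold kn
    rw [norm_smul, Real.norm_of_nonneg hl.le, mul_pow]
    rw [show l^2 * ‖x‖^2 + l^2 = l^2 * (‖x‖^2 + 1^2) by ring, mul_inv, mul_inv]
    field_simp
  simp_rw [this]
  rw [lintegral_const_mul _ (meas_kn 1).ennreal_ofReal, ← mul_assoc, ← ENNReal.ofReal_mul (by positivity),
    show l^3 * (l^2)⁻¹ = l by field_simp, mul_comm _ l, ENNReal.ofReal_mul hl.le]
  gcongr
  rw [ENNReal.ofReal_add (by positivity) (by norm_num), ENNReal.ofReal_toReal hfin.ne]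
  exact le_self_add

lemma kf_int {s : ℝ} (hs : 1 < s) : ∃ C : ℝ, 0 < C ∧ ∀ l : ℝ, 0 < l →
    ∫⁻ z, ENNReal.ofReal (kf l z) ^ s ≤ ENNReal.ofReal (C * l ^ (3 - 3 * s)) := by
  have e0 : ∀ l z, 0 < l → ENNReal.ofReal (kf l z) ^ s = ENNReal.ofReal ((‖z‖^2 + l^2) ^ (-(3*s)/2)) := by
    intro l z hl
    rw [ENNReal.ofReal_rpow_of_nonneg (kf_nonneg l z) (by linarith)]
    congr 1; unfold kf
    rw [← Real.rpow_mul (by positivity)]; congr 1; ring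
  have hi : Integrable (fun z : E3 => (1 + ‖z‖^2) ^ (-(3*s)/2)) volume :=
    integrable_rpow_neg_one_add_norm_sq (by simp; linarith)
  have hfin : ∫⁻ z : E3, ENNReal.ofReal ((1 + ‖z‖^2) ^ (-(3*s)/2)) < ∞ := hi.lintegral_lt_top
  refine ⟨(∫⁻ z : E3, ENNReal.ofReal ((1 + ‖z‖^2) ^ (-(3*s)/2))).toReal + 1, by positivity, fun l hl => ?_⟩
  simp_rw [e0 l _ hl]
  rw [lint_scale (by fun_prop) hl]
  have : ∀ x : E3, ENNReal.ofReal ((‖l • x‖^2 + l^2) ^ (-(3*s)/2)) = ENNReal.ofReal (l ^ (-(3*s))) *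
      ENNReal.ofReal ((1 + ‖x‖^2) ^ (-(3*s)/2)) := by
    intro x
    rw [← ENNReal.ofReal_mul (by positivity)]
    congr 1
    rw [norm_smul, Real.norm_of_nonneg hl.le, mul_pow]
    rw [show l^2 * ‖x‖^2 + l^2 = l^2 * (1 + ‖x‖^2) by ring, Real.mul_rpow (by positivity) (by positivity),
      ← Real.rpow_natCast l 2, ← Real.rpow_mul hl.le]
    congr 2; push_cast; ring
  simp_rw [this]
  rw [lintegral_const_mul _ (by fun_prop), ← mul_assoc, ← ENNReal.ofReal_mul (by positivity),
    ← Real.rpow_natCast l 3, ← Real.rpow_add hl, mul_comm _ (l ^ (3 - 3 * s)), ENNReal.ofReal_mul (by positivity)]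
  gcongr ?_ * ?_
  · apply le_of_eq; congr 2
  rw [ENNReal.ofReal_add (by positivity) (by norm_num), ENNReal.ofReal_toReal hfin.ne]
  exact le_self_add

end NSD

end

section

namespace NSD

/-- smooth functions -/
abbrev Sm (f : E3 → ℝ) : Prop := ContDiff ℝ (⊤ : ℕ∞) f

lemma Sm.diff {f : E3 → ℝ} (h : Sm f) : Differentiable ℝ f := h.differentiable (by simp)

lemma Sm.pd {f : E3 → ℝ} (h : Sm f) (i : Fin 3) : Sm (pd i f) := by
  unfold Sm _root_.pd
  exact (h.fderiv_right (m := ((⊤ : ℕ∞) : WithTop ℕ∞)) (by simp)).clm_apply contDiff_const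

lemma pd_add {f g : E3 → ℝ} (hf : Sm f) (hg : Sm g) (i : Fin 3) (x : E3) :
    pd i (fun y => f y + g y) x = pd i f x + pd i g x := by
  unfold pd; rw [fderiv_fun_add (hf.diff x) (hg.diff x)]; rfl

lemma pd_sub {f g : E3 → ℝ} (hf : Sm f) (hg : Sm g) (i : Fin 3) (x : E3) :
    pd i (fun y => f y - g y) x = pd i f x - pd i g x := by
  unfold pd; rw [fderiv_fun_sub (hf.diff x) (hg.diff x)]; rfl

lemma pd_mul {f g : E3 → ℝ} (hf : Sm f) (hg : Sm g) (i : Fin 3) (x : E3) :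
    pd i (fun y => f y * g y) x = pd i f x * g x + f x * pd i g x := by
  unfold pd; rw [fderiv_fun_mul (hf.diff x) (hg.diff x)]; simp; ring

lemma pd_const_mul {f : E3 → ℝ} (hf : Sm f) (c : ℝ) (i : Fin 3) (x : E3) :
    pd i (fun y => c * f y) x = c * pd i f x := by
  unfold pd; rw [fderiv_const_mul (hf.diff x)]; rfl

lemma pd_smul_arg {f : E3 → ℝ} (hf : Sm f) (c : ℝ) (i : Fin 3) (x : E3) :
    pd i (fun y => f (c • y)) x = c * pd i f (c • x) := by
  unfold pd
  have h : HasFDerivAt (fun y : E3 => f (c • y)) ((fderiv ℝ f (c • x)).comp (c • ContinuousLinearMap.id ℝ E3)) x :=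
    ((hf.diff (c • x)).hasFDerivAt).comp x ((hasFDerivAt_id x).const_smul c)
  rw [h.fderiv]; simp

lemma pd_comm {f : E3 → ℝ} (hf : Sm f) (i j : Fin 3) (x : E3) :
    pd i (pd j f) x = pd j (pd i f) x := by
  unfold pd
  have hd : Differentiable ℝ (fderiv ℝ f) :=
    (hf.fderiv_right (m := ((⊤ : ℕ∞) : WithTop ℕ∞)) (by simp)).differentiable (by simp)
  have e : ∀ a b : E3, fderiv ℝ (fun y => fderiv ℝ f y a) x b = fderiv ℝ (fderiv ℝ f) x b a := by
    intro a b
    rw [fderiv_clm_apply (hd x) (by fun_prop)]; simp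
  rw [e, e]
  have : IsSymmSndFDerivAt ℝ f x := hf.contDiffAt.isSymmSndFDerivAt (by simpa using (mod_cast le_top : ((2:ℕ∞) : WithTop ℕ∞) ≤ ((⊤ : ℕ∞) : WithTop ℕ∞)))
  exact this _ _

lemma tsupport_pd {f : E3 → ℝ} (i : Fin 3) : tsupport (pd i f) ⊆ tsupport f := by
  refine (closure_mono ?_).trans (tsupport_fderiv_subset ℝ (f := f))
  intro x hx
  simp only [Function.mem_support, pd] at hx ⊢
  intro h; rw [h] at hx; simp at hx

lemma hcs_pd {f : E3 → ℝ} (h : HasCompactSupport f) (i : Fin 3) : HasCompactSupport (pd i f) :=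
  h.mono' (subset_closure.trans (tsupport_pd i))

/-- regularised Newton kernel -/
def nk (ε : ℝ) (z : E3) : ℝ := (Real.sqrt (‖z‖ ^ 2 + ε ^ 2))⁻¹
def d1 (ε : ℝ) (i : Fin 3) (z : E3) : ℝ := -(z i * nk ε z ^ 3)
def d2 (ε : ℝ) (i j : Fin 3) (z : E3) : ℝ :=
  -((if i = j then 1 else 0) * nk ε z ^ 3) + 3 * (z i * z j) * nk ε z ^ 5
def et (ε : ℝ) (z : E3) : ℝ := 3 * ε ^ 2 * nk ε z ^ 5

lemma apos {ε : ℝ} (hε : 0 < ε) (z : E3) : 0 < ‖z‖ ^ 2 + ε ^ 2 := by positivity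
lemma nk_pos {ε : ℝ} (hε : 0 < ε) (z : E3) : 0 < nk ε z := by
  unfold nk; have := apos hε z; positivity
lemma nk_sq {ε : ℝ} (z : E3) : nk ε z ^ 2 = (‖z‖ ^ 2 + ε ^ 2)⁻¹ := by
  unfold nk; rw [inv_pow, Real.sq_sqrt (by positivity)]

lemma sm_sub {f : E3 → ℝ} (hf : Sm f) (x : E3) : Sm (fun y => f (y - x)) :=
  hf.comp (contDiff_id.sub contDiff_const)

lemma sm_nk {ε : ℝ} (hε : 0 < ε) : Sm (nk ε) := by
  unfold nk
  refine ContDiff.inv ?_ ?_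
  · exact ContDiff.sqrt ((contDiff_norm_sq ℝ).add contDiff_const) fun x => (apos hε x).ne'
  · intro x; exact (Real.sqrt_pos.2 (apos hε x)).ne'

lemma sm_coord (i : Fin 3) : Sm (fun z : E3 => z i) := by
  unfold Sm; fun_prop

lemma sm_d1 {ε : ℝ} (hε : 0 < ε) (i : Fin 3) : Sm (d1 ε i) :=
  ((sm_coord i).mul ((sm_nk hε).pow 3)).neg

lemma sm_et {ε : ℝ} (hε : 0 < ε) : Sm (et ε) :=
  contDiff_const.mul ((sm_nk hε).pow 5)

lemma pd_nk {ε : ℝ} (hε : 0 < ε) (i : Fin 3) (z : E3) : pd i (nk ε) z = d1 ε i z := by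
  have h1 : HasFDerivAt (fun y : E3 => ‖y‖ ^ 2 + ε ^ 2) (2 • innerSL ℝ z) z := by
    have := (hasStrictFDerivAt_norm_sq z).hasFDerivAt
    exact this.add_const _
  set s := ‖z‖ ^ 2 + ε ^ 2 with hs
  have hs0 : 0 < s := apos hε z
  have h2 : HasDerivAt (fun s : ℝ => (Real.sqrt s)⁻¹) (-(1 / (2 * Real.sqrt s)) / Real.sqrt s ^ 2) s :=
    (Real.hasDerivAt_sqrt hs0.ne').inv (Real.sqrt_pos.2 hs0).ne'
  have h3 : HasFDerivAt (nk ε) ((-(1 / (2 * Real.sqrt s)) / Real.sqrt s ^ 2) • (2 • innerSL ℝ z)) z :=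
    HasDerivAt.comp_hasFDerivAt (h₂ := fun s : ℝ => (Real.sqrt s)⁻¹) z h2 h1
  unfold pd
  rw [h3.fderiv]
  have hq := Real.sqrt_pos.2 hs0
  simp only [d1, nk, ← hs]
  simp [EuclideanSpace.inner_single_right]
  field_simp

lemma pd_translate {f : E3 → ℝ} (x : E3) (i : Fin 3) (y : E3) :
    pd i (fun y => f (y - x)) y = pd i f (y - x) := by
  unfold pd; simp_rw [sub_eq_add_neg]; rw [fderiv_comp_add_right]

lemma pd_coord (i j : Fin 3) (z : E3) : pd j (fun z : E3 => z i) z = if i = j then 1 else 0 := by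
  unfold pd
  have : HasFDerivAt (fun z : E3 => z i) (EuclideanSpace.proj i : E3 →L[ℝ] ℝ) z :=
    (EuclideanSpace.proj i : E3 →L[ℝ] ℝ).hasFDerivAt
  rw [this.fderiv]
  simp

lemma pd_pow {f : E3 → ℝ} (hf : Sm f) (n : ℕ) (i : Fin 3) (x : E3) :
    pd i (fun y => f y ^ (n+1)) x = (n+1) * f x ^ n * pd i f x := by
  unfold pd
  rw [((hf.diff x).hasFDerivAt.pow (n+1)).fderiv]
  simp

lemma pd_d1 {ε : ℝ} (hε : 0 < ε) (i j : Fin 3) (z : E3) : pd j (d1 ε i) z = d2 ε i j z := by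
  have e : d1 ε i = fun z => (-1) * (z i * nk ε z ^ (2+1)) := by funext z; simp [d1]
  have s3 : Sm (fun z => nk ε z ^ (2+1)) := (sm_nk hε).pow 3
  rw [e, pd_const_mul ((sm_coord i).mul s3), pd_mul (sm_coord i) s3, pd_pow (sm_nk hε), pd_nk hε, pd_coord]
  simp only [d1, d2]
  push_cast
  ring

lemma sm_d2 {ε : ℝ} (hε : 0 < ε) (i j : Fin 3) : Sm (d2 ε i j) := by
  have : d2 ε i j = pd j (d1 ε i) := by funext z; rw [pd_d1 hε]
  rw [this]; exact (sm_d1 hε i).pd j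

lemma norm_sq3 (z : E3) : ‖z‖ ^ 2 = z 0 ^ 2 + z 1 ^ 2 + z 2 ^ 2 := by
  rw [EuclideanSpace.norm_sq_eq]; simp [Fin.sum_univ_three]

lemma lap_nk {ε : ℝ} (hε : 0 < ε) (z : E3) : ∑ i, d2 ε i i z = - et ε z := by
  simp only [Fin.sum_univ_three, d2, et, if_true]
  have h := nk_sq (ε := ε) z
  have h3 : nk ε z ^ 3 = nk ε z ^ 5 * (‖z‖^2 + ε^2) := by
    have : nk ε z ^ 5 = nk ε z ^ 3 * nk ε z ^ 2 := by ring
    rw [this, h, mul_assoc, inv_mul_cancel₀ (apos hε z).ne', mul_one]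
  rw [h3, norm_sq3]; ring

lemma coord_le (z : E3) (i : Fin 3) : |z i| ≤ ‖z‖ := by
  simpa using PiLp.norm_apply_le z i

lemma nk_mul_norm {ε : ℝ} (hε : 0 < ε) (z : E3) : ‖z‖ * nk ε z ≤ 1 := by
  unfold nk
  rw [← div_eq_mul_inv, div_le_one (Real.sqrt_pos.2 (apos hε z))]
  exact Real.le_sqrt_of_sq_le (by nlinarith [sq_nonneg ε])

lemma nk_mul_eps {ε : ℝ} (hε : 0 < ε) (z : E3) : ε * nk ε z ≤ 1 := by
  unfold nk
  rw [← div_eq_mul_inv, div_le_one (Real.sqrt_pos.2 (apos hε z))]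
  exact Real.le_sqrt_of_sq_le (by nlinarith [sq_nonneg ‖z‖])

lemma kf_eq {l : ℝ} (hl : 0 < l) (z : E3) : kf l z = nk l z ^ 3 := by
  unfold kf nk
  have := apos hl z
  rw [Real.sqrt_eq_rpow, ← Real.rpow_neg this.le, ← Real.rpow_natCast (_ ^ (-(1/2:ℝ))) 3, ← Real.rpow_mul this.le]
  norm_num

lemma d1_bound {ε : ℝ} (hε : 0 < ε) (i : Fin 3) (z : E3) : |d1 ε i z| ≤ nk ε z ^ 2 := by
  have h := nk_pos hε z
  rw [d1, abs_neg, abs_mul, abs_of_pos (pow_pos h 3)]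
  calc |z i| * nk ε z ^ 3 ≤ ‖z‖ * nk ε z ^ 3 := by gcongr; exact coord_le z i
    _ = (‖z‖ * nk ε z) * nk ε z ^ 2 := by ring
    _ ≤ 1 * nk ε z ^ 2 := by gcongr; exact nk_mul_norm hε z
    _ = _ := one_mul _

lemma d2_bound {ε : ℝ} (hε : 0 < ε) (i j : Fin 3) (z : E3) : |d2 ε i j z| ≤ 4 * nk ε z ^ 3 := by
  have h := nk_pos hε z
  rw [d2]
  refine (abs_add_le _ _).trans ?_
  have a1 : |-((if i = j then (1:ℝ) else 0) * nk ε z ^ 3)| ≤ nk ε z ^ 3 := by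
    rw [abs_neg, abs_mul, abs_of_pos (pow_pos h 3)]
    split_ifs <;> simp [h.le]
  have a2 : |3 * (z i * z j) * nk ε z ^ 5| ≤ 3 * nk ε z ^ 3 := by
    rw [abs_mul, abs_mul, abs_mul, abs_of_pos (pow_pos h 5), abs_of_pos (by norm_num : (0:ℝ) < 3)]
    calc 3 * (|z i| * |z j|) * nk ε z ^ 5 ≤ 3 * (‖z‖ * ‖z‖) * nk ε z ^ 5 := by
          gcongr <;> exact coord_le z _
      _ = 3 * ((‖z‖ * nk ε z) * (‖z‖ * nk ε z)) * nk ε z ^ 3 := by ring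
      _ ≤ 3 * (1 * 1) * nk ε z ^ 3 := by
          have := nk_mul_norm hε z
          gcongr
      _ = _ := by ring
  linarith

/-- the near estimates -/
lemma near_aux {ε l : ℝ} (hε : 0 < ε) (hl : ε ≤ l) (z : E3) :
    0 ≤ nk ε z - nk l z ∧ nk ε z - nk l z ≤ l ^ 2 * nk ε z * nk l z ^ 2 ∧
      nk ε z ^ 3 - nk l z ^ 3 ≤ 3 * l ^ 2 * nk ε z ^ 3 * nk l z ^ 2 := by
  have hl0 : 0 < l := hε.trans_le hl
  set x := nk ε z with hx
  set y := nk l z with hy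
  have px : 0 < x := nk_pos hε z
  have py : 0 < y := nk_pos hl0 z
  have hxy : y ≤ x := by
    rw [hx, hy]; unfold nk
    have := apos hε z
    gcongr
  have hx2 : x ^ 2 * (‖z‖^2 + ε^2) = 1 := by rw [hx, nk_sq, inv_mul_cancel₀ (apos hε z).ne']
  have hy2 : y ^ 2 * (‖z‖^2 + l^2) = 1 := by rw [hy, nk_sq, inv_mul_cancel₀ (apos hl0 z).ne']
  have e : x ^ 2 - y ^ 2 = (l^2 - ε^2) * x^2 * y^2 := by
    calc x ^ 2 - y ^ 2 = x^2 * (y ^ 2 * (‖z‖^2 + l^2)) - y^2 * (x ^ 2 * (‖z‖^2 + ε^2)) := by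
          rw [hx2, hy2]; ring
      _ = _ := by ring
  have e' : x ^ 2 - y ^ 2 ≤ l^2 * x^2 * y^2 := by
    rw [e]; gcongr; nlinarith
  have b : x - y ≤ l ^ 2 * x * y ^ 2 := by
    have h1 : (x - y) * x ≤ (l ^ 2 * x * y ^ 2) * x := by nlinarith
    exact le_of_mul_le_mul_right h1 px
  refine ⟨by linarith, b, ?_⟩
  calc x ^ 3 - y ^ 3 = (x - y) * (x^2 + x*y + y^2) := by ring
    _ ≤ (l ^ 2 * x * y ^ 2) * (x^2 + x*x + x^2) := by
        have : 0 ≤ x - y := by linarith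
        gcongr
    _ = _ := by ring

lemma kn_alt {l : ℝ} {z : E3} (hz : z ≠ 0) : kn l z * ‖z‖ ^ 2 = l ^ 2 * nk l z ^ 2 := by
  rw [nk_sq]; unfold kn
  have : ‖z‖ ≠ 0 := by simpa using hz
  field_simp

lemma nk_le_inv {ε : ℝ} (hε : 0 < ε) {z : E3} (hz : z ≠ 0) : nk ε z ≤ ‖z‖⁻¹ := by
  have : 0 < ‖z‖ := by simpa using hz
  rw [← one_div, le_div_iff₀ this, mul_comm]; exact nk_mul_norm hε z

lemma near_d1 {ε l : ℝ} (hε : 0 < ε) (hl : ε ≤ l) (i : Fin 3) {z : E3} (hz : z ≠ 0) :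
    |d1 ε i z - d1 l i z| ≤ 3 * kn l z := by
  obtain ⟨h1, h2, h3⟩ := near_aux hε hl z
  have px : 0 < nk ε z := nk_pos hε z
  have hl0 : 0 < l := hε.trans_le hl
  have py : 0 < nk l z := nk_pos hl0 z
  have hz0 : 0 < ‖z‖ := by simpa using hz
  have h4 : 0 ≤ nk ε z ^ 3 - nk l z ^ 3 := by
    have : nk l z ^ 3 ≤ nk ε z ^ 3 := by gcongr; linarith
    linarith
  have e : d1 ε i z - d1 l i z = -(z i * (nk ε z ^ 3 - nk l z ^ 3)) := by simp only [d1]; ring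
  rw [e, abs_neg, abs_mul, abs_of_nonneg h4]
  have hk : kn l z = ‖z‖⁻¹ ^ 2 * (l ^ 2 * nk l z ^ 2) := by
    rw [← kn_alt hz]; field_simp
  calc |z i| * (nk ε z ^ 3 - nk l z ^ 3) ≤ ‖z‖ * (3 * l ^ 2 * nk ε z ^ 3 * nk l z ^ 2) := by
        gcongr; exact coord_le z i
    _ ≤ ‖z‖ * (3 * l ^ 2 * ‖z‖⁻¹ ^ 3 * nk l z ^ 2) := by gcongr; exact nk_le_inv hε hz
    _ = _ := by rw [hk]; field_simp

lemma near_n {ε l : ℝ} (hε : 0 < ε) (hl : ε ≤ l) {z : E3} (hz : z ≠ 0) :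
    |nk ε z - nk l z| ≤ ‖z‖ * kn l z := by
  obtain ⟨h1, h2, h3⟩ := near_aux hε hl z
  have hl0 : 0 < l := hε.trans_le hl
  have py : 0 < nk l z := nk_pos hl0 z
  have hz0 : 0 < ‖z‖ := by simpa using hz
  have hk : kn l z = ‖z‖⁻¹ ^ 2 * (l ^ 2 * nk l z ^ 2) := by
    rw [← kn_alt hz]; field_simp
  rw [abs_of_nonneg h1]
  calc _ ≤ l ^ 2 * nk ε z * nk l z ^ 2 := h2
    _ ≤ l ^ 2 * ‖z‖⁻¹ * nk l z ^ 2 := by gcongr; exact nk_le_inv hε hz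
    _ = _ := by rw [hk]; field_simp

end NSD

end

section

namespace NSD

lemma om_tendsto (p : ℝ≥0∞) [Fact (1 ≤ p)] [Fact (p ≠ ∞)] {f : E3 → ℝ} (hf : MemLp f p volume) :
    Tendsto (fun h : E3 => eLpNorm (fun x => f (h + x) - f x) p volume) (𝓝 0) (𝓝 0) := by
  have c : Continuous fun h : E3 => (DomAddAct.mk h) +ᵥ (hf.toLp f) :=
    (continuous_vadd.comp (Continuous.prodMk DomAddAct.continuous_mk continuous_const))
  have t := (c.tendsto 0)
  have z : (DomAddAct.mk (0:E3)) +ᵥ (hf.toLp f) = hf.toLp f := by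
    rw [DomAddAct.mk_zero, zero_vadd]
  rw [z] at t
  have t2 := tendsto_iff_edist_tendsto_0.1 t
  refine t2.congr fun h => ?_
  rw [DomAddAct.mk_vadd_toLp, Lp.edist_toLp_toLp]
  rfl

/-- normalising constant -/
def c0 : ℝ := ∫ z, et 1 z

lemma et_pos {ε : ℝ} (hε : 0 < ε) (z : E3) : 0 < et ε z := by
  unfold et; have := nk_pos hε z; positivity

lemma et_le {z : E3} : et 1 z ≤ 3 := by
  have h := nk_mul_eps one_pos z
  have h0 := nk_pos one_pos z
  unfold et
  have : nk 1 z ^ 5 ≤ 1 := pow_le_one₀ h0.le (by linarith)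
  linarith

lemma et_integrable : Integrable (et 1) volume := by
  have hi : Integrable (fun z : E3 => (1 + ‖z‖^2) ^ (-(5:ℝ)/2)) volume :=
    integrable_rpow_neg_one_add_norm_sq (by simp; norm_num)
  refine (hi.const_mul 3).congr (ae_of_all _ fun z => ?_)
  have := apos one_pos z
  simp only [et, nk]
  rw [Real.sqrt_eq_rpow, ← Real.rpow_neg this.le, ← Real.rpow_natCast (_ ^ (-(1/2:ℝ))) 5, ← Real.rpow_mul this.le]
  norm_num [add_comm]

lemma c0_pos : 0 < c0 := by
  unfold c0
  refine integral_pos_of_integrable_nonneg_nonzero (x := 0) (sm_et one_pos).continuous et_integrable ?_ ?_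
  · intro z; exact (et_pos one_pos z).le
  · exact (et_pos one_pos 0).ne'

lemma et_scale {ε : ℝ} (hε : 0 < ε) (z : E3) : et ε (ε • z) = (ε ^ 3)⁻¹ * et 1 z := by
  unfold et
  have : nk ε (ε • z) = ε⁻¹ * nk 1 z := by
    unfold nk
    rw [norm_smul, Real.norm_of_nonneg hε.le, mul_pow, show ε^2 * ‖z‖^2 + ε^2 = ε^2 * (‖z‖^2+1^2) by ring,
      Real.sqrt_mul (by positivity), Real.sqrt_sq hε.le, mul_inv]
  rw [this]; field_simp

/-- mollification -/
def mol (ε : ℝ) (f : E3 → ℝ) (x : E3) : ℝ := ∫ y, f y * et ε (y - x)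

lemma mol_eq {ε : ℝ} (hε : 0 < ε) (f : E3 → ℝ) (x : E3) :
    mol ε f x = ∫ z, f (ε • z + x) * et 1 z := by
  unfold mol
  rw [← integral_add_right_eq_self (fun y => f y * et ε (y - x)) x]
  have := Measure.integral_comp_smul (volume : Measure E3) (fun y => f (y + x) * et ε (y + x - x)) ε
  simp only [add_sub_cancel_right, finrank_euclideanSpace, Fintype.card_fin, et_scale hε] at this ⊢
  rw [abs_of_pos (by positivity)] at this
  have e : ∫ y, f (y + x) * et ε y = ε ^ 3 * ((ε ^ 3)⁻¹ • ∫ y, f (y + x) * et ε y) := by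
    simp only [smul_eq_mul]; field_simp
  rw [e, ← this, ← integral_const_mul]
  refine integral_congr_ae (ae_of_all _ fun z => ?_)
  simp only []; field_simp

lemma mol_sub {ε : ℝ} (hε : 0 < ε) {f : E3 → ℝ} (hf : Integrable f) (x : E3) :
    ‖mol ε f x - c0 * f x‖ₑ ≤ ∫⁻ z, ‖et 1 z‖ₑ * ‖f (ε • z + x) - f x‖ₑ := by
  have i1 : Integrable (fun z => f (ε • z + x) * et 1 z) := by
    have i0 : Integrable (fun z => f (ε • z + x)) := (hf.comp_add_right x).comp_smul hε.ne'
    refine i0.mul_bdd (c := 3) (sm_et one_pos).continuous.aestronglyMeasurable (ae_of_all _ fun z => ?_)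
    rw [Real.norm_of_nonneg (et_pos one_pos z).le]; exact et_le
  have i2 : Integrable (fun z => f x * et 1 z) := et_integrable.const_mul _
  have e : mol ε f x - c0 * f x = ∫ z, et 1 z * (f (ε • z + x) - f x) := by
    rw [mol_eq hε, c0, mul_comm, ← integral_const_mul, ← integral_sub i1 i2]
    congr 1; funext z; ring
  rw [e]
  refine (enorm_integral_le_lintegral_enorm _).trans (le_of_eq ?_)
  simp only [enorm_mul]

lemma et_enorm_meas : Measurable fun z : E3 => ‖et 1 z‖ₑ := (sm_et one_pos).continuous.measurable.enorm

lemma et_lint : ∫⁻ z, ‖et 1 z‖ₑ < ∞ := et_integrable.2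

lemma om_dct {ω : E3 → ℝ≥0∞} (mω : Measurable ω) {M : ℝ≥0∞} (hM : M ≠ ∞) (hb : ∀ h, ω h ≤ M)
    (ht : Tendsto ω (𝓝 0) (𝓝 0)) :
    Tendsto (fun ε : ℝ => ∫⁻ z, ‖et 1 z‖ₑ * ω (ε • z)) (𝓝[>] 0) (𝓝 0) := by
  have : (0:ℝ≥0∞) = ∫⁻ z : E3, 0 := by simp
  rw [this]
  refine tendsto_lintegral_filter_of_dominated_convergence (fun z => ‖et 1 z‖ₑ * M) ?_ ?_ ?_ ?_
  · exact Eventually.of_forall fun ε => et_enorm_meas.mul (mω.comp (by fun_prop))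
  · exact Eventually.of_forall fun ε => ae_of_all _ fun z => by gcongr; exact hb _
  · rw [lintegral_mul_const _ et_enorm_meas]
    exact ENNReal.mul_ne_top et_lint.ne hM
  · refine ae_of_all _ fun z => ?_
    have h1 : Tendsto (fun ε : ℝ => ε • z) (𝓝[>] 0) (𝓝 0) := by
      have : Tendsto (fun ε : ℝ => ε • z) (𝓝 0) (𝓝 ((0:ℝ) • z)) := (continuous_id.smul continuous_const).tendsto 0
      rw [zero_smul] at this
      exact this.mono_left nhdsWithin_le_nhds
    have h2 := ENNReal.Tendsto.const_mul (a := ‖et 1 z‖ₑ) (ht.comp h1) (Or.inr (by simp))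
    simpa using h2

lemma joint_meas {f : E3 → ℝ} (mf : Measurable f) :
    Measurable fun z : E3 × E3 => ‖f (z.1 + z.2) - f z.2‖ₑ := by
  have a : Measurable fun z : E3 × E3 => f (z.1 + z.2) := mf.comp (by fun_prop)
  have b : Measurable fun z : E3 × E3 => f z.2 := mf.comp (by fun_prop)
  exact (a.sub b).enorm

/-- L1 modulus of continuity -/
def om1 (f : E3 → ℝ) (h : E3) : ℝ≥0∞ := ∫⁻ x, ‖f (h + x) - f x‖ₑ

/-- L2 modulus of continuity -/
def om2 (f : E3 → ℝ) (h : E3) : ℝ≥0∞ := (∫⁻ x, ‖f (h + x) - f x‖ₑ ^ 2) ^ (1/2 : ℝ)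

lemma meas_om1 {f : E3 → ℝ} (mf : Measurable f) : Measurable (om1 f) :=
  Measurable.lintegral_prod_right' (joint_meas mf)

lemma meas_om2 {f : E3 → ℝ} (mf : Measurable f) : Measurable (om2 f) := by
  have := Measurable.lintegral_prod_right' (ν := (volume : Measure E3)) ((joint_meas mf).pow_const 2)
  exact this.pow_const _

lemma en2 (g : E3 → ℝ) : eLpNorm g 2 volume = (∫⁻ x, ‖g x‖ₑ ^ 2) ^ (1/2 : ℝ) := by
  rw [eLpNorm_eq_lintegral_rpow_enorm_toReal (by simp) (by simp)]
  simp

lemma om1_le {f : E3 → ℝ} (mf : Measurable f) (h : E3) : om1 f h ≤ (∫⁻ x, ‖f x‖ₑ) + ∫⁻ x, ‖f x‖ₑ := by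
  calc om1 f h ≤ ∫⁻ x, (‖f (h + x)‖ₑ + ‖f x‖ₑ) := lintegral_mono fun x => enorm_sub_le
      _ = _ := by
        rw [lintegral_add_right _ mf.enorm, lintegral_add_left_eq_self (fun x => ‖f x‖ₑ) h]

lemma om2_le {f : E3 → ℝ} (mf : Measurable f) (h : E3) : om2 f h ≤ eLpNorm f 2 volume + eLpNorm f 2 volume := by
  unfold om2
  rw [← en2]
  have mp := measurePreserving_add_left (volume : Measure E3) h
  have m1 : AEStronglyMeasurable (fun x => f (h + x)) volume := 
    (mf.comp (measurable_const_add h)).aestronglyMeasurable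
  refine (eLpNorm_sub_le m1 mf.aestronglyMeasurable (by norm_num)).trans ?_
  have := eLpNorm_comp_measurePreserving (p := 2) mf.aestronglyMeasurable mp
  exact add_le_add this.le le_rfl

lemma om1_t {f : E3 → ℝ} (hf : Integrable f) : Tendsto (om1 f) (𝓝 0) (𝓝 0) := by
  have : Fact ((1:ℝ≥0∞) ≤ 1) := ⟨le_rfl⟩
  have : Fact ((1:ℝ≥0∞) ≠ ∞) := ⟨by simp⟩
  refine (om_tendsto 1 (memLp_one_iff_integrable.2 hf)).congr fun h => ?_
  rw [eLpNorm_one_eq_lintegral_enorm]; rfl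

lemma om2_t {f : E3 → ℝ} (hf : MemLp f 2 volume) : Tendsto (om2 f) (𝓝 0) (𝓝 0) := by
  have : Fact ((1:ℝ≥0∞) ≤ 2) := ⟨by norm_num⟩
  have : Fact ((2:ℝ≥0∞) ≠ ∞) := ⟨by simp⟩
  exact (om_tendsto 2 hf).congr fun h => en2 _

lemma meas_mm {f : E3 → ℝ} (mf : Measurable f) (ε : ℝ) :
    Measurable fun z : E3 × E3 => ‖et 1 z.2‖ₑ * ‖f (ε • z.2 + z.1) - f z.1‖ₑ := by
  have a : Measurable fun z : E3 × E3 => f (ε • z.2 + z.1) :=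
    mf.comp ((measurable_snd.const_smul ε).add measurable_fst)
  have b : Measurable fun z : E3 × E3 => f z.1 := mf.comp measurable_fst
  have c : Measurable fun z : E3 × E3 => ‖et 1 z.2‖ₑ := et_enorm_meas.comp measurable_snd
  exact c.mul (a.sub b).enorm

lemma mol1_le {f : E3 → ℝ} (mf : Measurable f) (hf : Integrable f) {ε : ℝ} (hε : 0 < ε) :
    ∫⁻ x, ‖mol ε f x - c0 * f x‖ₑ ≤ ∫⁻ z, ‖et 1 z‖ₑ * om1 f (ε • z) := 
  calc ∫⁻ x, ‖mol ε f x - c0 * f x‖ₑ ≤ ∫⁻ x, ∫⁻ z, ‖et 1 z‖ₑ * ‖f (ε • z + x) - f x‖ₑ :=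
        lintegral_mono fun x => mol_sub hε hf x
    _ = ∫⁻ z, ∫⁻ x, ‖et 1 z‖ₑ * ‖f (ε • z + x) - f x‖ₑ := lintegral_lintegral_swap (meas_mm mf ε).aemeasurable
    _ = ∫⁻ z, ‖et 1 z‖ₑ * om1 f (ε • z) := by
        refine lintegral_congr fun z => ?_
        rw [lintegral_const_mul' _ _ enorm_ne_top]; rfl

lemma mol2_le {f : E3 → ℝ} (mf : Measurable f) (hf : Integrable f) {ε : ℝ} (hε : 0 < ε) :
    (∫⁻ x, ‖mol ε f x - c0 * f x‖ₑ ^ 2) ^ (1/2 : ℝ) ≤ ∫⁻ z, ‖et 1 z‖ₑ * om2 f (ε • z) := 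
  calc (∫⁻ x, ‖mol ε f x - c0 * f x‖ₑ ^ 2) ^ (1/2 : ℝ)
      ≤ (∫⁻ x, (∫⁻ z, ‖et 1 z‖ₑ * ‖f (ε • z + x) - f x‖ₑ) ^ 2) ^ (1/2 : ℝ) := by
        refine ENNReal.rpow_le_rpow (lintegral_mono fun x => ?_) (by norm_num)
        exact pow_le_pow_left' (mol_sub hε hf x) 2
    _ ≤ ∫⁻ z, (∫⁻ x, (‖et 1 z‖ₑ * ‖f (ε • z + x) - f x‖ₑ) ^ 2) ^ (1/2 : ℝ) := mink2 volume volume (meas_mm mf ε)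
    _ = ∫⁻ z, ‖et 1 z‖ₑ * om2 f (ε • z) := by
        refine lintegral_congr fun z => ?_
        simp_rw [mul_pow]
        rw [lintegral_const_mul' _ _ (ENNReal.pow_ne_top enorm_ne_top), ENNReal.mul_rpow_of_nonneg _ _ (by norm_num),
          ← ENNReal.rpow_natCast, ← ENNReal.rpow_mul]
        norm_num [om2]

lemma approx1 {f : E3 → ℝ} (mf : Measurable f) (hf : Integrable f) :
    Tendsto (fun ε : ℝ => ∫⁻ x, ‖mol ε f x - c0 * f x‖ₑ) (𝓝[>] 0) (𝓝 0) := by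
  have hfin : ∫⁻ x, ‖f x‖ₑ ≠ ∞ := hf.2.ne
  have h2 := om_dct (meas_om1 mf) (ENNReal.add_ne_top.2 ⟨hfin, hfin⟩) (om1_le mf) (om1_t hf)
  refine tendsto_of_tendsto_of_tendsto_of_le_of_le' tendsto_const_nhds h2
    (Eventually.of_forall fun _ => zero_le) ?_
  filter_upwards [self_mem_nhdsWithin] with ε hε
  exact mol1_le mf hf hε

lemma approx2 {f : E3 → ℝ} (mf : Measurable f) (hf : Integrable f) (hf2 : MemLp f 2 volume) :
    Tendsto (fun ε : ℝ => (∫⁻ x, ‖mol ε f x - c0 * f x‖ₑ ^ 2) ^ (1/2 : ℝ)) (𝓝[>] 0) (𝓝 0) := by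
  have h2 := om_dct (meas_om2 mf) (ENNReal.add_ne_top.2 ⟨hf2.2.ne, hf2.2.ne⟩) (om2_le mf) (om2_t hf2)
  refine tendsto_of_tendsto_of_tendsto_of_le_of_le' tendsto_const_nhds h2
    (Eventually.of_forall fun _ => zero_le) ?_
  filter_upwards [self_mem_nhdsWithin] with ε hε
  exact mol2_le mf hf hε

lemma meas_mol {ε : ℝ} (hε : 0 < ε) {f : E3 → ℝ} (mf : Measurable f) : Measurable (mol ε f) := by
  unfold mol
  have : StronglyMeasurable fun z : E3 × E3 => f z.2 * et ε (z.2 - z.1) := by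
    have m1 : Measurable fun z : E3 × E3 => f z.2 := mf.comp measurable_snd
    have m2 : Measurable fun z : E3 × E3 => et ε (z.2 - z.1) :=
      (sm_et hε).continuous.measurable.comp (by fun_prop)
    exact (m1.mul m2).stronglyMeasurable
  exact this.integral_prod_right'.measurable

lemma mol_ae {f : E3 → ℝ} (mf : Measurable f) (hf : Integrable f) :
    ∃ e : ℕ → ℝ, (∀ n, 0 < e n) ∧ Tendsto e atTop (𝓝 0) ∧
      ∀ᵐ x, Tendsto (fun n => mol (e n) f x) atTop (𝓝 (c0 * f x)) := by
  set s : ℕ → ℝ := fun n => 1 / ((n:ℝ) + 1) with hs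
  have s0 : ∀ n, 0 < s n := fun n => by simp only [hs]; positivity
  have st : Tendsto s atTop (𝓝 0) := tendsto_one_div_add_atTop_nhds_zero_nat
  have st' : Tendsto s atTop (𝓝[>] 0) := tendsto_nhdsWithin_iff.2 ⟨st, Eventually.of_forall s0⟩
  have t1 := (approx1 mf hf).comp st'
  have tm : TendstoInMeasure volume (fun n => mol (s n) f) atTop (fun x => c0 * f x) := by
    refine tendstoInMeasure_of_tendsto_eLpNorm (p := 1) (by simp)
      (fun n => (meas_mol (s0 n) mf).aestronglyMeasurable) (mf.const_mul c0).aestronglyMeasurable ?_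
    refine t1.congr fun n => ?_
    rw [eLpNorm_one_eq_lintegral_enorm]
    rfl
  obtain ⟨ns, hns, h⟩ := tm.exists_seq_tendsto_ae
  exact ⟨fun n => s (ns n), fun n => s0 _, st.comp hns.tendsto_atTop, h⟩

end NSD

end

section

namespace NSD

lemma int_cs {R : ℝ} {f χ : E3 → ℝ} (hf : Integrable f) (sf : ∀ x, R ≤ ‖x‖ → f x = 0)
    (hχ : Continuous χ) : Integrable (fun x => f x * χ x) := by
  obtain ⟨M, hM⟩ := (isCompact_closedBall (0:E3) R).exists_bound_of_continuousOn hχ.continuousOn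
  refine (hf.norm.mul_const M).mono' (hf.1.mul hχ.aestronglyMeasurable) (ae_of_all _ fun x => ?_)
  by_cases h : R ≤ ‖x‖
  · simp [sf x h]
  · rw [norm_mul]
    exact mul_le_mul_of_nonneg_left (hM x (by simpa using (not_le.1 h).le)) (norm_nonneg _)

lemma int_of_l2 {R : ℝ} {f : E3 → ℝ} (hf : MemLp f 2 volume) (sf : ∀ x, R ≤ ‖x‖ → f x = 0) :
    Integrable f := by
  have h : IntegrableOn f (closedBall 0 R) := by
    have : Fact (volume (closedBall (0:E3) R) < ∞) := ⟨measure_closedBall_lt_top⟩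
    exact (hf.restrict _).integrable (by norm_num)
  refine (integrableOn_iff_integrable_of_support_subset ?_).1 h
  intro x hx
  by_contra h2
  exact hx (sf x (by simpa using (not_le.1 (by simpa using h2)).le))

/-- `G` is the weak gradient of the compactly supported `L²` function `w`. -/
structure WD (R : ℝ) (w : E3 → ℝ) (G : Fin 3 → E3 → ℝ) : Prop where
  mw : Measurable w
  mG : ∀ j, Measurable (G j)
  lw : MemLp w 2 volume
  lG : ∀ j, MemLp (G j) 2 volume
  sw : ∀ x, R ≤ ‖x‖ → w x = 0
  sG : ∀ j x, R ≤ ‖x‖ → G j x = 0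
  wk : ∀ χ, Sm χ → ∀ j, ∫ x, w x * pd j χ x = - ∫ x, G j x * χ x

lemma WD.iw {R : ℝ} {w : E3 → ℝ} {G : Fin 3 → E3 → ℝ} (h : WD R w G) : Integrable w :=
  int_of_l2 h.lw h.sw

lemma WD.iG {R : ℝ} {w : E3 → ℝ} {G : Fin 3 → E3 → ℝ} (h : WD R w G) (j) : Integrable (G j) :=
  int_of_l2 (h.lG j) (h.sG j)

variable {R : ℝ} {w : E3 → ℝ} {G : Fin 3 → E3 → ℝ}

lemma WD.rep (h : WD R w G) {ε : ℝ} (hε : 0 < ε) (x : E3) :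
    mol ε w x = ∑ j, ∫ y, G j y * d1 ε j (y - x) := by
  have e : ∀ j, ∫ y, w y * d2 ε j j (y - x) = - ∫ y, G j y * d1 ε j (y - x) := by
    intro j
    rw [← h.wk _ (sm_sub (sm_d1 hε j) x) j]
    congr 1; funext y
    rw [pd_translate, pd_d1 hε]
  have i : ∀ j ∈ Finset.univ, Integrable fun y => w y * d2 ε j j (y - x) := fun j _ =>
    int_cs h.iw h.sw (sm_sub (sm_d2 hε j j) x).continuous
  have : - mol ε w x = ∑ j, ∫ y, w y * d2 ε j j (y - x) := by
    rw [← integral_finsetSum _ i, mol, ← integral_neg]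
    congr 1; funext y
    rw [← Finset.mul_sum, lap_nk hε]; ring
  simp only [e] at this
  rw [Finset.sum_neg_distrib] at this
  linarith

lemma ae_ne (x : E3) : ∀ᵐ y : E3, y ≠ x := by
  simp [ae_iff]

lemma kn_even (l : ℝ) (x y : E3) : kn l (y - x) = kn l (x - y) := by
  unfold kn; rw [norm_sub_rev]

lemma et_even (l : ℝ) (x y : E3) : et l (y - x) = et l (x - y) := by
  unfold et nk; rw [norm_sub_rev]

lemma WD.mol_diff (h : WD R w G) {ε l : ℝ} (hε : 0 < ε) (hl : ε ≤ l) (x : E3) :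
    ‖mol ε w x‖ₑ ≤ cv (fun z => ENNReal.ofReal (et l z)) (fun y => ‖w y‖ₑ) x
      + ∑ j, 3 * cv (fun z => ENNReal.ofReal (kn l z)) (fun y => ‖G j y‖ₑ) x := by
  have hl0 : 0 < l := hε.trans_le hl
  have e : mol ε w x = mol l w x + ∑ j, ∫ y, G j y * (d1 ε j (y - x) - d1 l j (y - x)) := by
    rw [h.rep hε, h.rep hl0, ← Finset.sum_add_distrib]
    refine Finset.sum_congr rfl fun j _ => ?_
    have i1 : Integrable fun y => G j y * d1 l j (y - x) :=
      int_cs (h.iG j) (h.sG j) (sm_sub (sm_d1 hl0 j) x).continuous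
    have i2 : Integrable fun y => G j y * (d1 ε j (y - x) - d1 l j (y - x)) :=
      int_cs (h.iG j) (h.sG j) ((sm_sub (sm_d1 hε j) x).continuous.sub (sm_sub (sm_d1 hl0 j) x).continuous)
    rw [← integral_add i1 i2]
    congr 1; funext y; ring
  rw [e]
  refine (enorm_add_le _ _).trans (add_le_add ?_ ((enorm_sum_le _ _).trans (Finset.sum_le_sum fun j _ => ?_)))
  · refine (enorm_integral_le_lintegral_enorm _).trans (le_of_eq ?_)
    refine lintegral_congr fun y => ?_
    rw [enorm_mul, mul_comm, et_even, Real.enorm_eq_ofReal (et_pos hl0 _).le]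
  · refine (enorm_integral_le_lintegral_enorm _).trans ?_
    unfold cv
    rw [← lintegral_const_mul' _ _ (by simp)]
    refine lintegral_mono_ae ?_
    filter_upwards [ae_ne x] with y hy
    rw [enorm_mul, mul_comm, ← mul_assoc]
    refine mul_le_mul' ?_ le_rfl
    rw [Real.enorm_eq_ofReal_abs, show (3:ℝ≥0∞) = ENNReal.ofReal 3 by simp, ← ENNReal.ofReal_mul (by norm_num)]
    exact ENNReal.ofReal_le_ofReal ((near_d1 hε hl j (sub_ne_zero.2 hy)).trans (by rw [kn_even]))

lemma WD.ptw (h : WD R w G) {l : ℝ} (hl : 0 < l) :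
    ∀ᵐ x, ENNReal.ofReal c0 * ‖w x‖ₑ ≤ cv (fun z => ENNReal.ofReal (et l z)) (fun y => ‖w y‖ₑ) x
      + ∑ j, 3 * cv (fun z => ENNReal.ofReal (kn l z)) (fun y => ‖G j y‖ₑ) x := by
  obtain ⟨e, e0, et0, ht⟩ := mol_ae h.mw h.iw
  filter_upwards [ht] with x hx
  have h2 := hx.enorm
  rw [enorm_mul, Real.enorm_eq_ofReal c0_pos.le] at h2
  refine le_of_tendsto h2 ?_
  filter_upwards [et0.eventually (ge_mem_nhds hl)] with n hn
  exact h.mol_diff (e0 n) hn x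

lemma kn_riesz {l γ : ℝ} (hl : 0 < l) (h0 : 0 ≤ γ) (h1 : γ ≤ 1) {z : E3} (hz : z ≠ 0) :
    kn l z ≤ l ^ (1 - γ) * ‖z‖ ^ (-(3 - γ)) := by
  have hn := nk_pos hl z
  have zp : 0 < ‖z‖ := norm_pos_iff.2 hz
  have a : (l * nk l z) ^ (1 + γ) ≤ 1 := Real.rpow_le_one (by positivity) (nk_mul_eps hl z) (by linarith)
  have b : (‖z‖ * nk l z) ^ (1 - γ) ≤ 1 := Real.rpow_le_one (by positivity) (nk_mul_norm hl z) (by linarith)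
  have ab : (l * nk l z) ^ (1 + γ) * (‖z‖ * nk l z) ^ (1 - γ) ≤ 1 :=
    mul_le_one₀ a (by positivity) b
  have k : kn l z = l ^ (1 - γ) * ‖z‖ ^ (-(3 - γ)) * ((l * nk l z) ^ (1 + γ) * (‖z‖ * nk l z) ^ (1 - γ)) := by
    have := kn_alt (l := l) hz
    have e : kn l z = l ^ (2:ℝ) * ‖z‖ ^ (-2:ℝ) * nk l z ^ (2:ℝ) := by
      rw [Real.rpow_neg zp.le]; simp only [Real.rpow_ofNat]
      field_simp; exact this
    rw [e, Real.mul_rpow hl.le hn.le, Real.mul_rpow zp.le hn.le,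
      show l ^ (1 - γ) * ‖z‖ ^ (-(3 - γ)) * ((l ^ (1 + γ) * nk l z ^ (1 + γ)) * (‖z‖ ^ (1 - γ) * nk l z ^ (1 - γ)))
        = (l ^ (1 - γ) * l ^ (1 + γ)) * (‖z‖ ^ (-(3 - γ)) * ‖z‖ ^ (1 - γ)) * (nk l z ^ (1 + γ) * nk l z ^ (1 - γ)) by ring,
      ← Real.rpow_add hl, ← Real.rpow_add zp, ← Real.rpow_add hn]
    ring_nf
  rw [k]
  exact mul_le_of_le_one_right (by positivity) ab

lemma et_riesz {l γ : ℝ} (hl : 0 < l) (h0 : 0 ≤ γ) (h1 : γ ≤ 1) {z : E3} (hz : z ≠ 0) :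
    et l z ≤ 3 * (l ^ (-γ) * ‖z‖ ^ (-(3 - γ))) := by
  have hn := nk_pos hl z
  have zp : 0 < ‖z‖ := norm_pos_iff.2 hz
  have a : (l * nk l z) ^ (2 + γ) ≤ 1 := Real.rpow_le_one (by positivity) (nk_mul_eps hl z) (by linarith)
  have b : (‖z‖ * nk l z) ^ (3 - γ) ≤ 1 := Real.rpow_le_one (by positivity) (nk_mul_norm hl z) (by linarith)
  have ab : (l * nk l z) ^ (2 + γ) * (‖z‖ * nk l z) ^ (3 - γ) ≤ 1 :=
    mul_le_one₀ a (by positivity) b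
  have k : et l z = 3 * (l ^ (-γ) * ‖z‖ ^ (-(3 - γ))) * ((l * nk l z) ^ (2 + γ) * (‖z‖ * nk l z) ^ (3 - γ)) := by
    have e : et l z = 3 * l ^ (2:ℝ) * ‖z‖ ^ (0:ℝ) * nk l z ^ (5:ℝ) := by
      simp only [Real.rpow_ofNat, Real.rpow_zero]; unfold et; ring
    rw [e, Real.mul_rpow hl.le hn.le, Real.mul_rpow zp.le hn.le,
      show 3 * (l ^ (-γ) * ‖z‖ ^ (-(3 - γ))) * ((l ^ (2 + γ) * nk l z ^ (2 + γ)) * (‖z‖ ^ (3 - γ) * nk l z ^ (3 - γ)))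
        = 3 * (l ^ (-γ) * l ^ (2 + γ)) * (‖z‖ ^ (-(3 - γ)) * ‖z‖ ^ (3 - γ)) * (nk l z ^ (2 + γ) * nk l z ^ (3 - γ)) by ring,
      ← Real.rpow_add hl, ← Real.rpow_add zp, ← Real.rpow_add hn]
    ring_nf
  rw [k]
  exact mul_le_of_le_one_right (by positivity) ab

lemma cv_riesz {γ c : ℝ} {k : E3 → ℝ} (hc : 0 ≤ c) (hk : ∀ z, z ≠ 0 → k z ≤ c * ‖z‖ ^ (-(3 - γ)))
    (f : E3 → ℝ≥0∞) (x : E3) :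
    cv (fun z => ENNReal.ofReal (k z)) f x ≤ ENNReal.ofReal c * ∫⁻ y, ‖x - y‖ₑ ^ (-(3 - γ)) * f y := by
  unfold cv
  rw [← lintegral_const_mul' _ _ (by simp)]
  refine lintegral_mono_ae ?_
  filter_upwards [ae_ne x] with y hy
  rw [← mul_assoc]
  refine mul_le_mul' ?_ le_rfl
  have hz : x - y ≠ 0 := sub_ne_zero.2 hy.symm
  have := hk _ hz
  rw [← ofReal_norm, ENNReal.ofReal_rpow_of_pos (norm_pos_iff.2 hz), ← ENNReal.ofReal_mul hc]
  exact ENNReal.ofReal_le_ofReal this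

lemma sq2 (a b : ℝ≥0∞) : (a + b) ^ 2 ≤ 2 * (a ^ 2 + b ^ 2) := by
  have := ENNReal.rpow_add_le_mul_rpow_add_rpow a b (p := 2) (by norm_num)
  norm_num at this
  exact this

lemma sq4 (a b c d : ℝ≥0∞) : (a + (b + c + d)) ^ 2 ≤ 4 * (a ^ 2 + (b ^ 2 + c ^ 2 + d ^ 2)) := by
  calc (a + (b + c + d)) ^ 2 = ((a + b) + (c + d)) ^ 2 := by ring
    _ ≤ 2 * ((a + b) ^ 2 + (c + d) ^ 2) := sq2 _ _
    _ ≤ 2 * (2 * (a ^ 2 + b ^ 2) + 2 * (c ^ 2 + d ^ 2)) :=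
      mul_le_mul' le_rfl (add_le_add (sq2 _ _) (sq2 _ _))
    _ = _ := by ring

lemma meas_riesz (x : E3) (κ : ℝ) : Measurable fun y : E3 => ‖x - y‖ₑ ^ κ :=
  (measurable_const.sub measurable_id).enorm.pow_const κ

lemma c0_cancel {a b : ℝ≥0∞} (h : ENNReal.ofReal c0 * a ≤ b) : a ≤ ENNReal.ofReal c0⁻¹ * b := by
  have h2 := mul_le_mul' (le_refl (ENNReal.ofReal c0⁻¹)) h
  rwa [← mul_assoc, ← ENNReal.ofReal_mul (by have := c0_pos; positivity), inv_mul_cancel₀ c0_pos.ne',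
    ENNReal.ofReal_one, one_mul] at h2

lemma sobolev {s1 s2 s3 γ : ℝ} (h1 : 2 < s1) (h2 : 2 < s2) (h3 : 2 < s3)
    (hγ : γ = 3 / 2 - (1 / s1 + 1 / s2 + 1 / s3)) (h0 : 0 ≤ γ) (hγ1 : γ ≤ 1) :
    ∃ C : ℝ, 0 < C ∧ ∀ (R : ℝ) (w : E3 → ℝ) (G : Fin 3 → E3 → ℝ), WD R w G → ∀ A B : ℝ, 0 < A → 0 < B →
      ∫⁻ x, ‖w x‖ₑ ^ 2 ≤ ENNReal.ofReal (A ^ 2) →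
      ∑ j, ∫⁻ x, ‖G j x‖ₑ ^ 2 ≤ ENNReal.ofReal (B ^ 2) →
      aN s1 s2 s3 (fun x => ‖w x‖ₑ) ≤ ENNReal.ofReal (C * A ^ (1 - γ) * B ^ γ) := by
  obtain ⟨C, hC, hr⟩ := aN_riesz h1 h2 h3 hγ
  refine ⟨c0⁻¹ * (3 * (C * 3)), by have := c0_pos; positivity, ?_⟩
  intro R w G h A B hA hB hwA hGB
  set l := A / B with hl
  have l0 : 0 < l := by positivity
  set H : E3 → ℝ≥0∞ := fun y => ‖w y‖ₑ + ∑ j, ENNReal.ofReal l * ‖G j y‖ₑ with hH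
  have mH : Measurable H := h.mw.enorm.add (Finset.measurable_sum _ fun j _ => (h.mG j).enorm.const_mul _)
  have key : ∀ᵐ x, ‖w x‖ₑ ≤ ENNReal.ofReal (c0⁻¹ * (3 * l ^ (-γ))) * ∫⁻ y, ‖x - y‖ₑ ^ (-(3 - γ)) * H y := by
    filter_upwards [h.ptw l0] with x hx
    have a1 := cv_riesz (γ := γ) (c := 3 * l ^ (-γ)) (k := et l) (by positivity)
      (fun z hz => (et_riesz l0 h0 hγ1 hz).trans (le_of_eq (by ring))) (fun y => ‖w y‖ₑ) x
    have a2 : ∀ j, 3 * cv (fun z => ENNReal.ofReal (kn l z)) (fun y => ‖G j y‖ₑ) x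
        ≤ ENNReal.ofReal (3 * l ^ (-γ)) * ∫⁻ y, ‖x - y‖ₑ ^ (-(3 - γ)) * (ENNReal.ofReal l * ‖G j y‖ₑ) := by
      intro j
      have := cv_riesz (γ := γ) (c := l ^ (1-γ)) (k := kn l) (by positivity)
        (fun z hz => (kn_riesz l0 h0 hγ1 hz)) (fun y => ‖G j y‖ₑ) x
      refine (mul_le_mul' le_rfl this).trans (le_of_eq ?_)
      simp_rw [mul_left_comm _ (ENNReal.ofReal l)]
      rw [lintegral_const_mul' _ _ (by simp), ← mul_assoc, ← mul_assoc, ← ENNReal.ofReal_mul (by positivity),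
        show (3:ℝ≥0∞) = ENNReal.ofReal 3 by simp, ← ENNReal.ofReal_mul (by positivity)]
      congr 2
      rw [sub_eq_add_neg, add_comm, Real.rpow_add l0, Real.rpow_one]; ring
    have a3 : ∫⁻ y, ‖x - y‖ₑ ^ (-(3 - γ)) * H y = (∫⁻ y, ‖x - y‖ₑ ^ (-(3 - γ)) * ‖w y‖ₑ)
        + ∑ j, ∫⁻ y, ‖x - y‖ₑ ^ (-(3 - γ)) * (ENNReal.ofReal l * ‖G j y‖ₑ) := by
      simp only [hH, mul_add, Finset.mul_sum]
      have m1 : Measurable fun y => ‖x - y‖ₑ ^ (-(3 - γ)) * ‖w y‖ₑ := (meas_riesz x _).mul h.mw.enorm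
      rw [lintegral_add_left m1, lintegral_finsetSum]
      intro j _
      exact (meas_riesz x _).mul ((h.mG j).enorm.const_mul _)
    have a4 := hx.trans (add_le_add a1 (Finset.sum_le_sum fun j _ => a2 j))
    rw [← Finset.mul_sum, ← mul_add, ← a3] at a4
    rw [ENNReal.ofReal_mul (by have := c0_pos; positivity), mul_assoc]
    exact c0_cancel a4
  have hH2 : (∫⁻ y, H y ^ 2) ^ (1/2 : ℝ) ≤ ENNReal.ofReal (3 * A) := by
    have b1 : ∫⁻ y, H y ^ 2 ≤ ENNReal.ofReal ((3 * A) ^ 2) := by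
      calc ∫⁻ y, H y ^ 2 ≤ ∫⁻ y, 4 * (‖w y‖ₑ ^ 2 + ENNReal.ofReal (l ^ 2) * ∑ j, ‖G j y‖ₑ ^ 2) := by
            refine lintegral_mono fun y => ?_
            simp only [hH, Fin.sum_univ_three]
            refine (sq4 _ _ _ _).trans (le_of_eq ?_)
            rw [ENNReal.ofReal_pow l0.le]; ring
        _ = 4 * ((∫⁻ y, ‖w y‖ₑ ^ 2) + ENNReal.ofReal (l ^ 2) * ∑ j, ∫⁻ y, ‖G j y‖ₑ ^ 2) := by
            rw [lintegral_const_mul' _ _ (by simp), lintegral_add_left (h.mw.enorm.pow_const 2),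
              lintegral_const_mul' _ _ (by simp), lintegral_finsetSum _ fun j _ => ((h.mG j).enorm.pow_const 2)]
        _ ≤ 4 * (ENNReal.ofReal (A ^ 2) + ENNReal.ofReal (l ^ 2) * ENNReal.ofReal (B ^ 2)) := by gcongr
        _ = ENNReal.ofReal (8 * A ^ 2) := by
            rw [← ENNReal.ofReal_mul (by positivity), ← ENNReal.ofReal_add (by positivity) (by positivity),
              show (4:ℝ≥0∞) = ENNReal.ofReal 4 by simp, ← ENNReal.ofReal_mul (by positivity)]
            congr 1; rw [hl]; field_simp; ring
        _ ≤ _ := ENNReal.ofReal_le_ofReal (by nlinarith)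
    refine (ENNReal.rpow_le_rpow b1 (by norm_num)).trans (le_of_eq ?_)
    rw [ENNReal.ofReal_pow (by positivity), ← ENNReal.rpow_natCast, ← ENNReal.rpow_mul]; norm_num
  have cp := c0_pos
  calc aN s1 s2 s3 (fun x => ‖w x‖ₑ)
      ≤ aN s1 s2 s3 (fun x => ENNReal.ofReal (c0⁻¹ * (3 * l ^ (-γ))) * ∫⁻ y, ‖x - y‖ₑ ^ (-(3 - γ)) * H y) :=
        aN_mono (by linarith) (by linarith) (by linarith) key
    _ = ENNReal.ofReal (c0⁻¹ * (3 * l ^ (-γ))) * aN s1 s2 s3 (fun x => ∫⁻ y, ‖x - y‖ₑ ^ (-(3 - γ)) * H y) :=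
        aN_const_mul (by linarith) (by linarith) (by linarith) _ (by simp) _
    _ ≤ ENNReal.ofReal (c0⁻¹ * (3 * l ^ (-γ))) * (ENNReal.ofReal C * ENNReal.ofReal (3 * A)) := by
        refine mul_le_mul' le_rfl ((hr H mH).trans (mul_le_mul' le_rfl hH2))
    _ = _ := by
        rw [← ENNReal.ofReal_mul (by positivity), ← ENNReal.ofReal_mul (by positivity)]
        congr 1
        rw [hl, Real.div_rpow hA.le hB.le, Real.rpow_neg hB.le, sub_eq_add_neg, Real.rpow_add hA, Real.rpow_one]
        simp only [div_eq_mul_inv, inv_inv]; ring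

end NSD

end

section

namespace NSD

lemma int_prod {R : ℝ} {f g K : E3 → ℝ} (hf : Integrable f) (hg : Integrable g)
    (sf : ∀ x, R ≤ ‖x‖ → f x = 0) (sg : ∀ x, R ≤ ‖x‖ → g x = 0) (hK : Continuous K) :
    Integrable (fun z : E3 × E3 => f z.1 * (g z.2 * K (z.2 - z.1))) (volume.prod volume) := by
  obtain ⟨M, hM⟩ := (isCompact_closedBall (0:E3) (2*R)).exists_bound_of_continuousOn hK.continuousOn
  have i := hf.mul_prod hg
  have mK : AEStronglyMeasurable (fun z : E3 × E3 => K (z.2 - z.1)) (volume.prod volume) :=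
    (hK.comp (continuous_snd.sub continuous_fst)).aestronglyMeasurable
  have : Integrable (fun z : E3 × E3 => (f z.1 * g z.2) * K (z.2 - z.1)) (volume.prod volume) := by
    refine (i.norm.mul_const M).mono' (i.1.mul mK) (ae_of_all _ fun z => ?_)
    by_cases h : R ≤ ‖z.1‖
    · simp [sf _ h]
    by_cases h' : R ≤ ‖z.2‖
    · simp [sg _ h']
    rw [norm_mul]
    refine mul_le_mul_of_nonneg_left (hM _ ?_) (norm_nonneg _)
    have := norm_sub_le z.2 z.1
    simp only [mem_closedBall, dist_zero_right]; linarith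
  exact this.congr (ae_of_all _ fun z => by simp only []; ring)

lemma fub {R : ℝ} {f g K : E3 → ℝ} (hf : Integrable f) (hg : Integrable g)
    (sf : ∀ x, R ≤ ‖x‖ → f x = 0) (sg : ∀ x, R ≤ ‖x‖ → g x = 0) (hK : Continuous K) :
    ∫ x, f x * ∫ y, g y * K (y - x) = ∫ y, g y * ∫ x, f x * K (y - x) := by
  simp_rw [← integral_const_mul]
  rw [integral_integral_swap (int_prod hf hg sf sg hK)]
  congr 1; funext y; congr 1; funext x; ring

lemma int_mol {R : ℝ} {f g K : E3 → ℝ} (hf : Integrable f) (hg : Integrable g)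
    (sf : ∀ x, R ≤ ‖x‖ → f x = 0) (sg : ∀ x, R ≤ ‖x‖ → g x = 0) (hK : Continuous K) :
    Integrable (fun x => f x * ∫ y, g y * K (y - x)) := by
  have := (int_prod hf hg sf sg hK).integral_prod_left
  simp_rw [integral_const_mul] at this
  exact this

lemma l2_cs {R : ℝ} {f χ : E3 → ℝ} (hf : MemLp f 2 volume) (sf : ∀ x, R ≤ ‖x‖ → f x = 0)
    (hχ : Continuous χ) : MemLp (fun x => f x * χ x) 2 volume := by
  obtain ⟨M, hM⟩ := (isCompact_closedBall (0:E3) R).exists_bound_of_continuousOn hχ.continuousOn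
  refine (hf.norm.mul_const M).mono (hf.1.mul hχ.aestronglyMeasurable) (ae_of_all _ fun x => ?_)
  by_cases h : R ≤ ‖x‖
  · simp [sf x h]
  · rw [norm_mul, norm_mul, norm_norm]
    exact mul_le_mul_of_nonneg_left ((hM x (by simpa using (not_le.1 h).le)).trans (le_abs_self M)) (norm_nonneg _)

lemma mol_lim {R : ℝ} {h f : E3 → ℝ} (mh : Measurable h) (hh : MemLp h 2 volume) (sh : ∀ x, R ≤ ‖x‖ → h x = 0)
    (mf : Measurable f) (hf : MemLp f 2 volume) (sf : ∀ x, R ≤ ‖x‖ → f x = 0) :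
    Tendsto (fun ε : ℝ => ∫ x, h x * mol ε f x) (𝓝[>] 0) (𝓝 (c0 * ∫ x, h x * f x)) := by
  have ih := int_of_l2 hh sh
  have if' := int_of_l2 hf sf
  have i0 : Integrable fun x => h x * (c0 * f x) := by
    have : Integrable fun x => h x * f x := hh.integrable_mul hf
    exact (this.const_mul c0).congr (ae_of_all _ fun x => by simp only []; ring)
  have e : c0 * ∫ x, h x * f x = ∫ x, h x * (c0 * f x) := by
    rw [← integral_const_mul]; congr 1; funext x; ring
  rw [e]
  refine tendsto_integral_of_L1 _ i0.1 ?_ ?_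
  · filter_upwards [self_mem_nhdsWithin] with ε hε
    exact int_mol ih if' sh sf (sm_et hε).continuous
  · have t := ENNReal.Tendsto.const_mul (a := (∫⁻ x, ‖h x‖ₑ ^ 2) ^ (1/2:ℝ)) (approx2 mf if' hf) (Or.inr (by
      rw [← en2]; exact hh.2.ne))
    rw [mul_zero] at t
    refine tendsto_of_tendsto_of_tendsto_of_le_of_le' tendsto_const_nhds t
      (Eventually.of_forall fun _ => zero_le) ?_
    filter_upwards [self_mem_nhdsWithin] with ε hε
    refine le_trans (le_of_eq ?_) (cs_lint volume mh.enorm.aemeasurable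
      ((meas_mol hε mf).sub (mf.const_mul c0)).enorm.aemeasurable)
    refine lintegral_congr fun x => ?_
    rw [← enorm_mul, mul_sub]

variable {R : ℝ} {w w' : E3 → ℝ} {G G' : Fin 3 → E3 → ℝ}

lemma pd_neg_arg {K : E3 → ℝ} (hK : Sm K) (y : E3) (k : Fin 3) (x : E3) :
    pd k (fun x => K (y - x)) x = - pd k K (y - x) := by
  unfold pd
  have h1 : HasFDerivAt (fun x : E3 => y - x) (-(ContinuousLinearMap.id ℝ E3)) x := (hasFDerivAt_id x).const_sub y
  have h2 := (hK.diff (y - x)).hasFDerivAt.comp x h1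
  have h3 : fderiv ℝ (fun x => K (y - x)) x = _ := h2.fderiv
  rw [h3]; simp

lemma prod_eps (h : WD R w G) (h' : WD R w' G') {χ : E3 → ℝ} (hχ : Sm χ) (k : Fin 3) {ε : ℝ} (hε : 0 < ε) :
    ∫ x, (w' x * pd k χ x) * mol ε w x
      = - (∫ x, (G' k x * χ x) * mol ε w x) - ∫ x, (w' x * χ x) * mol ε (G k) x := by
  have ce := (sm_et hε).continuous
  have cp := ((sm_et hε).pd k).continuous
  have i1 : Integrable (fun x => w' x * pd k χ x) := int_cs h'.iw h'.sw (hχ.pd k).continuous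
  have i2 : Integrable (fun x => G' k x * χ x) := int_cs (h'.iG k) (h'.sG k) hχ.continuous
  have i3 : Integrable (fun x => w' x * χ x) := int_cs h'.iw h'.sw hχ.continuous
  have s1 : ∀ x, R ≤ ‖x‖ → w' x * pd k χ x = 0 := fun x hx => by simp [h'.sw x hx]
  have s2 : ∀ x, R ≤ ‖x‖ → G' k x * χ x = 0 := fun x hx => by simp [h'.sG k x hx]
  have s3 : ∀ x, R ≤ ‖x‖ → w' x * χ x = 0 := fun x hx => by simp [h'.sw x hx]
  have A : ∀ x, mol ε (G k) x = - ∫ y, w y * pd k (et ε) (y - x) := by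
    intro x
    have := h.wk _ (sm_sub (sm_et hε) x) k
    simp_rw [pd_translate] at this
    rw [this, neg_neg]; rfl
  have smy : ∀ y, Sm fun x => et ε (y - x) := fun y => (sm_et hε).comp (contDiff_const.sub contDiff_id)
  have B : ∀ y, (∫ x, (w' x * pd k χ x) * et ε (y - x)) = - (∫ x, (G' k x * χ x) * et ε (y - x))
      + ∫ x, (w' x * χ x) * pd k (et ε) (y - x) := by
    intro y
    have := h'.wk _ ((smy y).mul hχ) k
    simp_rw [pd_mul (smy y) hχ, pd_neg_arg (sm_et hε)] at this
    have j1 : Integrable fun x => (w' x * pd k χ x) * et ε (y - x) := int_cs i1 s1 (smy y).continuous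
    have j2 : Integrable fun x => (w' x * χ x) * pd k (et ε) (y - x) :=
      int_cs i3 s3 (cp.comp (continuous_const.sub continuous_id))
    have e1 : ∫ x, w' x * (-pd k (et ε) (y - x) * χ x + et ε (y - x) * pd k χ x)
       = (∫ x, (w' x * pd k χ x) * et ε (y - x)) - ∫ x, (w' x * χ x) * pd k (et ε) (y - x) := by
      rw [← integral_sub j1 j2]; congr 1; funext x; ring
    have e2 : ∫ x, G' k x * (et ε (y - x) * χ x) = ∫ x, (G' k x * χ x) * et ε (y - x) := by
      congr 1; funext x; ring
    rw [e1, e2] at this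
    linarith
  simp_rw [A]
  unfold mol
  simp_rw [mul_neg]
  rw [integral_neg, fub i1 h.iw s1 h.sw ce, fub i2 h.iw s2 h.sw ce, fub i3 h.iw s3 h.sw cp]
  simp_rw [B, mul_add, mul_neg]
  have ev : Continuous fun z => et ε (-z) := ce.comp continuous_neg
  have pv : Continuous fun z => pd k (et ε) (-z) := cp.comp continuous_neg
  have k1 := int_mol h.iw i2 h.sw s2 ev
  have k2 := int_mol h.iw i3 h.sw s3 pv
  simp only [neg_sub] at k1 k2
  have e := integral_add k1.neg k2
  simp only [Pi.neg_apply] at e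
  rw [e, integral_neg]
  ring

/-- weak product rule -/
lemma prod_rule (h : WD R w G) (h' : WD R w' G') {χ : E3 → ℝ} (hχ : Sm χ) (k : Fin 3) :
    ∫ x, (w x * w' x) * pd k χ x = - ∫ x, (G k x * w' x + w x * G' k x) * χ x := by
  have s1 : ∀ x, R ≤ ‖x‖ → w' x * pd k χ x = 0 := fun x hx => by simp [h'.sw x hx]
  have s2 : ∀ x, R ≤ ‖x‖ → G' k x * χ x = 0 := fun x hx => by simp [h'.sG k x hx]
  have s3 : ∀ x, R ≤ ‖x‖ → w' x * χ x = 0 := fun x hx => by simp [h'.sw x hx]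
  have l1 := l2_cs h'.lw h'.sw (hχ.pd k).continuous
  have l2 := l2_cs (h'.lG k) (h'.sG k) hχ.continuous
  have l3 := l2_cs h'.lw h'.sw hχ.continuous
  have t1 := mol_lim (h'.mw.mul (hχ.pd k).continuous.measurable) l1 s1 h.mw h.lw h.sw
  have t2 := mol_lim ((h'.mG k).mul hχ.continuous.measurable) l2 s2 h.mw h.lw h.sw
  have t3 := mol_lim (h'.mw.mul hχ.continuous.measurable) l3 s3 (h.mG k) (h.lG k) (h.sG k)
  simp only [Pi.mul_apply] at t1 t2 t3
  have t4 := t2.neg.sub t3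
  have e := tendsto_nhds_unique (t1.congr' (by
    filter_upwards [self_mem_nhdsWithin] with ε hε
    exact prod_eps h h' hχ k hε)) t4
  have e2 : (∫ x, (w' x * pd k χ x) * w x) = -(∫ x, (G' k x * χ x) * w x) - ∫ x, (w' x * χ x) * G k x := by
    apply mul_left_cancel₀ c0_pos.ne'
    rw [e]; ring
  have j2 : Integrable fun x => (G' k x * χ x) * w x := l2.integrable_mul h.lw
  have j3 : Integrable fun x => (w' x * χ x) * G k x := l3.integrable_mul (h.lG k)
  have e3 : ∫ x, (G k x * w' x + w x * G' k x) * χ x = (∫ x, (G' k x * χ x) * w x) + ∫ x, (w' x * χ x) * G k x := by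
    rw [← integral_add j2 j3]; congr 1; funext x; ring
  rw [e3]
  have e4 : ∫ x, (w x * w' x) * pd k χ x = ∫ x, (w' x * pd k χ x) * w x := by
    congr 1; funext x; ring
  rw [e4, e2]; ring

end NSD

end

section

namespace NSD

/-- local weak gradients on a ball -/
structure LWD (ρ : ℝ) (v : E3 → ℝ) (g : Fin 3 → E3 → ℝ) : Prop where
  mv : Measurable v
  mg : ∀ j, Measurable (g j)
  lv : MemLp v 2 (volume.restrict (ball 0 ρ))
  lg : ∀ j, MemLp (g j) 2 (volume.restrict (ball 0 ρ))
  wk : ∀ χ, Sm χ → HasCompactSupport χ → tsupport χ ⊆ ball 0 ρ → ∀ j,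
    ∫ x in ball 0 ρ, v x * pd j χ x = - ∫ x in ball 0 ρ, g j x * χ x

lemma off_ts {R : ℝ} {φ : E3 → ℝ} (hs : tsupport φ ⊆ ball 0 R) {x : E3} (hx : R ≤ ‖x‖) : φ x = 0 := by
  apply image_eq_zero_of_notMem_tsupport
  intro h
  have := hs h
  simp at this; linarith

lemma off_pd {R : ℝ} {φ : E3 → ℝ} (hs : tsupport φ ⊆ ball 0 R) (j : Fin 3) {x : E3} (hx : R ≤ ‖x‖) :
    pd j φ x = 0 := off_ts ((tsupport_pd j).trans hs) hx

lemma hcs_ball {R : ℝ} {φ : E3 → ℝ} (hs : tsupport φ ⊆ ball 0 R) : HasCompactSupport φ :=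
  (isCompact_closedBall (0:E3) R).of_isClosed_subset (isClosed_tsupport _) (hs.trans ball_subset_closedBall)

lemma set_int {ρ : ℝ} {f : E3 → ℝ} (h : ∀ x, ρ ≤ ‖x‖ → f x = 0) : ∫ x in ball 0 ρ, f x = ∫ x, f x := by
  refine setIntegral_eq_integral_of_forall_compl_eq_zero fun x hx => h x (by simpa using hx)

lemma l2_ball {ρ R : ℝ} (hR : R ≤ ρ) {v φ : E3 → ℝ} (lv : MemLp v 2 (volume.restrict (ball 0 ρ)))
    (hφ : Continuous φ) (sφ : ∀ x, R ≤ ‖x‖ → φ x = 0) : MemLp (fun x => φ x * v x) 2 volume := by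
  have h1 : MemLp ((ball (0:E3) ρ).indicator v) 2 volume := (memLp_indicator_iff_restrict measurableSet_ball).2 lv
  have h2 : ∀ x, ρ ≤ ‖x‖ → (ball (0:E3) ρ).indicator v x = 0 := by
    intro x hx; apply indicator_of_notMem; simpa using hx
  convert l2_cs h1 h2 hφ using 2 with x
  by_cases h : ρ ≤ ‖x‖
  · rw [sφ x (hR.trans h), h2 x h]; simp
  · rw [indicator_of_mem (by simpa using h), mul_comm]

lemma LWD.cut {ρ R : ℝ} (hR : R ≤ ρ) {v : E3 → ℝ} {g : Fin 3 → E3 → ℝ} (h : LWD ρ v g)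
    {φ : E3 → ℝ} (hφ : Sm φ) (hs : tsupport φ ⊆ ball 0 R) :
    WD R (fun x => φ x * v x) (fun j x => φ x * g j x + pd j φ x * v x) := by
  have l1 := l2_ball hR h.lv hφ.continuous (fun x hx => off_ts hs hx)
  have l2 := fun j => l2_ball hR (h.lg j) hφ.continuous (fun x hx => off_ts hs hx)
  have l3 := fun j => l2_ball hR h.lv (hφ.pd j).continuous (fun x hx => off_pd hs j hx)
  have sw : ∀ x, R ≤ ‖x‖ → φ x * v x = 0 := fun x hx => by simp [off_ts hs hx]
  have s2 : ∀ j x, R ≤ ‖x‖ → φ x * g j x = 0 := fun j x hx => by simp [off_ts hs hx]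
  have s3 : ∀ j x, R ≤ ‖x‖ → pd j φ x * v x = 0 := fun j x hx => by simp [off_pd hs j hx]
  refine ⟨hφ.continuous.measurable.mul h.mv, fun j => (hφ.continuous.measurable.mul (h.mg j)).add
    ((hφ.pd j).continuous.measurable.mul h.mv), l1, fun j => (l2 j).add (l3 j), sw,
    fun j x hx => by simp [off_ts hs hx, off_pd hs j hx], ?_⟩
  intro χ hχ j
  have ts : tsupport (fun x => φ x * χ x) ⊆ ball 0 R := (tsupport_mul_subset_left (f := φ) (g := χ)).trans hs
  have k := h.wk _ (hφ.mul hχ) (hcs_ball ts) (ts.trans (ball_subset_ball hR)) j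
  simp_rw [pd_mul hφ hχ] at k
  rw [set_int fun x hx => by simp [off_ts hs (hR.trans hx), off_pd hs j (hR.trans hx)],
    set_int fun x hx => by simp [off_ts hs (hR.trans hx)]] at k
  have i1 : Integrable fun x => (φ x * v x) * pd j χ x := int_cs (int_of_l2 l1 sw) sw (hχ.pd j).continuous
  have i2 : Integrable fun x => (φ x * g j x) * χ x := int_cs (int_of_l2 (l2 j) (s2 j)) (s2 j) hχ.continuous
  have i3 : Integrable fun x => (pd j φ x * v x) * χ x := int_cs (int_of_l2 (l3 j) (s3 j)) (s3 j) hχ.continuous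
  have e1 : ∫ x, v x * (pd j φ x * χ x + φ x * pd j χ x) = (∫ x, (pd j φ x * v x) * χ x) + ∫ x, (φ x * v x) * pd j χ x := by
    rw [← integral_add i3 i1]; congr 1; funext x; ring
  have e2 : ∫ x, (φ x * g j x + pd j φ x * v x) * χ x = (∫ x, (φ x * g j x) * χ x) + ∫ x, (pd j φ x * v x) * χ x := by
    rw [← integral_add i2 i3]; congr 1; funext x; ring
  have e3 : ∫ x, g j x * (φ x * χ x) = ∫ x, (φ x * g j x) * χ x := by
    congr 1; funext x; ring
  rw [e1, e3] at k
  rw [e2]; linarith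

variable {R : ℝ} {w : E3 → ℝ} {G : Fin 3 → E3 → ℝ}

lemma WD.mol_grad (h : WD R w G) {ε : ℝ} (hε : 0 < ε) (j : Fin 3) (x : E3) :
    mol ε (G j) x = - ∫ y, w y * pd j (et ε) (y - x) := by
  have := h.wk _ (sm_sub (sm_et hε) x) j
  simp_rw [pd_translate] at this
  rw [this, neg_neg]; rfl

lemma fderiv_sum {f : E3 → ℝ} (x v : E3) : fderiv ℝ f x v = ∑ j, v j * pd j f x := by
  have : v = ∑ j, v j • (EuclideanSpace.single j (1:ℝ) : E3) := by
    ext i; simp [Fin.sum_univ_three]; fin_cases i <;> simp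
  conv_lhs => rw [this]
  rw [map_sum]; simp [pd]

lemma line_int {K : E3 → ℝ} (hK : Sm K) (x y z : E3) :
    K (z - x) - K (z - y) = ∫ t in (0:ℝ)..1, - ∑ j, (x - y) j * pd j K (z - (y + t • (x - y))) := by
  have hd : ∀ t : ℝ, HasDerivAt (fun t : ℝ => K (z - (y + t • (x - y))))
      (- ∑ j, (x - y) j * pd j K (z - (y + t • (x - y)))) t := by
    intro t
    have h1 : HasDerivAt (fun t : ℝ => z - (y + t • (x - y))) (-((1:ℝ) • (x - y))) t :=
      (((hasDerivAt_id t).smul_const (x - y)).const_add y).const_sub z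
    have h2 := (hK.diff (z - (y + t • (x - y)))).hasFDerivAt.comp_hasDerivAt t h1
    rw [one_smul, map_neg, fderiv_sum] at h2
    exact h2
  have c : Continuous fun t : ℝ => - ∑ j, (x - y) j * pd j K (z - (y + t • (x - y))) := by
    refine (continuous_finsetSum _ fun j _ => continuous_const.mul ((hK.pd j).continuous.comp ?_)).neg
    fun_prop
  rw [intervalIntegral.integral_eq_sub_of_hasDerivAt (fun t _ => hd t) (c.intervalIntegrable _ _)]
  simp

lemma WD.mol_line (h : WD R w G) {ε : ℝ} (hε : 0 < ε) (x y : E3) :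
    mol ε w x - mol ε w y = ∫ t in (0:ℝ)..1, ∑ j, (x - y) j * mol ε (G j) (y + t • (x - y)) := by
  have ce := (sm_et hε).continuous
  have e1 : mol ε w x - mol ε w y = ∫ z, ∫ t in (0:ℝ)..1,
      w z * (- ∑ j, (x - y) j * pd j (et ε) (z - (y + t • (x - y)))) := by
    unfold mol
    have j1 : ∀ x, Integrable fun z => w z * et ε (z - x) := fun x =>
      int_cs h.iw h.sw (sm_sub (sm_et hε) x).continuous
    rw [← integral_sub (j1 x) (j1 y)]
    congr 1; funext z
    rw [intervalIntegral.integral_const_mul, ← line_int (sm_et hε)]; ring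
  set K : E3 × ℝ → ℝ := fun p => - ∑ j, (x - y) j * pd j (et ε) (p.1 - (y + p.2 • (x - y))) with hK
  have cK : Continuous K := by
    refine (continuous_finsetSum _ fun j _ => continuous_const.mul (((sm_et hε).pd j).continuous.comp ?_)).neg
    fun_prop
  obtain ⟨M, hM⟩ := ((isCompact_closedBall (0:E3) R).prod (isCompact_Icc (a := (0:ℝ)) (b := 1))).exists_bound_of_continuousOn
    cK.continuousOn
  have ii : Integrable (fun p : E3 × ℝ => w p.1 * K p) (volume.prod (volume.restrict (Ioc 0 1))) := by
    have i0 : Integrable (fun p : E3 × ℝ => w p.1 * 1) (volume.prod (volume.restrict (Ioc 0 1))) :=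
      h.iw.mul_prod (integrable_const 1)
    simp only [mul_one] at i0
    refine (i0.norm.mul_const M).mono' (i0.1.mul cK.aestronglyMeasurable) ?_
    have : ∀ᵐ p : E3 × ℝ ∂(volume.prod (volume.restrict (Ioc 0 1))), p.2 ∈ Ioc (0:ℝ) 1 := by
      have := (Measure.quasiMeasurePreserving_snd (μ := (volume : Measure E3)) (ν := (volume.restrict (Ioc (0:ℝ) 1)))).ae
        (ae_restrict_mem measurableSet_Ioc)
      exact this
    filter_upwards [this] with p hp
    by_cases hx : R ≤ ‖p.1‖
    · simp [h.sw _ hx]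
    · rw [norm_mul]
      refine mul_le_mul_of_nonneg_left (hM p ⟨by simpa using (not_le.1 hx).le, hp.1.le, hp.2⟩) (norm_nonneg _)
  have e2 := integral_integral_swap (f := fun z t => w z * K (z, t)) ii
  rw [e1]
  simp_rw [intervalIntegral.integral_of_le zero_le_one]
  refine e2.trans (integral_congr_ae (ae_of_all _ fun t => ?_))
  simp only [hK, h.mol_grad hε]
  simp_rw [mul_neg, Finset.mul_sum]
  rw [integral_neg, integral_finsetSum, Finset.sum_neg_distrib]
  · congr 1; refine Finset.sum_congr rfl fun j _ => ?_
    rw [← integral_const_mul]; congr 1; funext z; ring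
  · intro j _
    have : Integrable fun z => w z * pd j (et ε) (z - (y + t • (x - y))) := int_cs h.iw h.sw
      (((sm_et hε).pd j).continuous.comp (by fun_prop))
    exact (this.const_mul ((x - y) j)).congr (ae_of_all _ fun z => by simp only []; ring)

end NSD

end

section

namespace NSD

lemma lint_affine {t : ℝ} (ht : 1/2 ≤ t) {H : E3 → ℝ≥0∞} (c : E3) :
    ∫⁻ x, H (t • x + c) ≤ 8 * ∫⁻ x, H x := by
  have t0 : 0 < t := by linarith
  have e : ∫⁻ x, H (t • x + c) = ENNReal.ofReal (|(t ^ 3)⁻¹|) * ∫⁻ x, H x := by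
    have h1 := lintegral_add_right_eq_self (μ := (volume : Measure E3)) H c
    rw [← h1]
    have h2 := Measure.map_addHaar_smul (volume : Measure E3) t0.ne'
    have h3 : MeasurableEmbedding fun x : E3 => t • x :=
      (Homeomorph.smulOfNeZero t t0.ne').measurableEmbedding
    have := h3.lintegral_map (μ := volume) (fun x => H (x + c))
    rw [← this, h2, lintegral_smul_measure]
    simp [finrank_euclideanSpace]
  rw [e, abs_of_pos (by positivity)]
  refine mul_le_mul' ?_ le_rfl
  rw [show (8:ℝ≥0∞) = ENNReal.ofReal 8 by simp]
  refine ENNReal.ofReal_le_ofReal ?_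
  rw [inv_le_comm₀ (by positivity) (by norm_num)]
  calc (8:ℝ)⁻¹ = (1/2)^3 := by norm_num
    _ ≤ t ^ 3 := by gcongr

lemma conv_mem {r t : ℝ} (h0 : 0 ≤ t) (h1 : t ≤ 1) {x y : E3} (hx : x ∈ ball (0:E3) r) (hy : y ∈ ball (0:E3) r) :
    y + t • (x - y) ∈ ball (0:E3) r := by
  have := (convex_ball (0:E3) r) hy hx (sub_nonneg.2 h1) h0 (by ring)
  convert this using 1
  rw [smul_sub, sub_smul, one_smul]; abel

lemma seg_bound {r t : ℝ} (h0 : 0 ≤ t) (h1 : t ≤ 1) {H : E3 → ℝ≥0∞} (mH : Measurable H) :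
    ∫⁻ x in ball (0:E3) r, ∫⁻ y in ball (0:E3) r, H (y + t • (x - y))
      ≤ 8 * volume (ball (0:E3) r) * ∫⁻ x in ball (0:E3) r, H x := by
  set B := ball (0:E3) r with hB
  have mB : MeasurableSet B := measurableSet_ball
  have mm : Measurable fun z : E3 × E3 => H (z.2 + t • (z.1 - z.2)) :=
    mH.comp (measurable_snd.add ((measurable_fst.sub measurable_snd).const_smul t))
  have e : 8 * volume B * ∫⁻ x in B, H x = ∫⁻ _y in B, 8 * ∫⁻ x, B.indicator H x := by
    rw [lintegral_const, lintegral_indicator mB]; simp; ring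
  rw [e]
  rcases le_total (1/2) t with ht | ht
  · rw [lintegral_lintegral_swap mm.aemeasurable]
    refine setLIntegral_mono' mB fun y hy => ?_
    have := lint_affine ht (H := B.indicator H) (y - t • y)
    refine le_trans ?_ this
    rw [← lintegral_indicator mB]
    refine lintegral_mono fun x => ?_
    by_cases hx : x ∈ B
    swap
    · rw [indicator_of_notMem hx]; exact zero_le
    rw [indicator_of_mem hx]
    have e1 : t • x + (y - t • y) = y + t • (x - y) := by rw [smul_sub]; abel
    rw [e1, indicator_of_mem (conv_mem h0 h1 hx hy)]
  · refine setLIntegral_mono' mB fun x hx => ?_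
    have := lint_affine (t := 1 - t) (by linarith) (H := B.indicator H) (t • x)
    refine le_trans ?_ this
    rw [← lintegral_indicator mB]
    refine lintegral_mono fun y => ?_
    by_cases hy : y ∈ B
    swap
    · rw [indicator_of_notMem hy]; exact zero_le
    rw [indicator_of_mem hy]
    have e1 : (1 - t) • y + t • x = y + t • (x - y) := by rw [smul_sub, sub_smul, one_smul]; abel
    rw [e1, indicator_of_mem (conv_mem h0 h1 hx hy)]

lemma dbl_bound {r : ℝ} {H : E3 → ℝ≥0∞} (mH : Measurable H) :
    ∫⁻ x in ball (0:E3) r, ∫⁻ y in ball (0:E3) r, ∫⁻ t in Ioc (0:ℝ) 1, H (y + t • (x - y))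
      ≤ 8 * volume (ball (0:E3) r) * ∫⁻ x in ball (0:E3) r, H x := by
  set B := ball (0:E3) r with hB
  have m1 : ∀ x : E3, Measurable fun z : E3 × ℝ => H (z.1 + z.2 • (x - z.1)) := fun x =>
    mH.comp (measurable_fst.add (measurable_snd.smul (measurable_const.sub measurable_fst)))
  have m2 : Measurable fun z : (E3 × ℝ) × E3 => H (z.2 + z.1.2 • (z.1.1 - z.2)) :=
    mH.comp (measurable_snd.add (measurable_fst.snd.smul (measurable_fst.fst.sub measurable_snd)))
  have m3 : Measurable fun z : E3 × ℝ => ∫⁻ y in B, H (y + z.2 • (z.1 - y)) := m2.lintegral_prod_right'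
  calc _ = ∫⁻ x in B, ∫⁻ t in Ioc (0:ℝ) 1, ∫⁻ y in B, H (y + t • (x - y)) := by
        refine lintegral_congr fun x => lintegral_lintegral_swap (m1 x).aemeasurable
    _ = ∫⁻ t in Ioc (0:ℝ) 1, ∫⁻ x in B, ∫⁻ y in B, H (y + t • (x - y)) := lintegral_lintegral_swap m3.aemeasurable
    _ ≤ ∫⁻ _t in Ioc (0:ℝ) 1, 8 * volume B * ∫⁻ x in B, H x :=
        setLIntegral_mono' measurableSet_Ioc fun t ht => seg_bound ht.1.le ht.2 mH
    _ = _ := by rw [lintegral_const]; simp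

variable {R : ℝ} {w : E3 → ℝ} {G : Fin 3 → E3 → ℝ}

lemma WD.mol_sq (h : WD R w G) {ε : ℝ} (hε : 0 < ε) (x y : E3) :
    ‖mol ε w x - mol ε w y‖ₑ ^ 2
      ≤ ‖x - y‖ₑ ^ 2 * ∫⁻ t in Ioc (0:ℝ) 1, (∑ j, ‖mol ε (G j) (y + t • (x - y))‖ₑ) ^ 2 := by
  set F : E3 → ℝ≥0∞ := fun p => ∑ j, ‖mol ε (G j) p‖ₑ with hF
  have mF : Measurable F := Finset.measurable_sum _ fun j _ => (meas_mol hε (h.mG j)).enorm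
  have mt : Measurable fun t : ℝ => F (y + t • (x - y)) :=
    mF.comp (measurable_const.add (measurable_id.smul_const _))
  have a : ‖mol ε w x - mol ε w y‖ₑ ≤ ‖x - y‖ₑ * ∫⁻ t in Ioc (0:ℝ) 1, F (y + t • (x - y)) := by
    rw [h.mol_line hε, intervalIntegral.integral_of_le zero_le_one, ← lintegral_const_mul' _ _ enorm_ne_top]
    refine (enorm_integral_le_lintegral_enorm _).trans (lintegral_mono fun t => ?_)
    refine (enorm_sum_le _ _).trans ?_
    simp only [hF, Finset.mul_sum]
    refine Finset.sum_le_sum fun j _ => ?_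
    rw [enorm_mul]
    exact mul_le_mul' (abs_coord_le _ _) le_rfl
  have b : (∫⁻ t in Ioc (0:ℝ) 1, F (y + t • (x - y))) ^ 2 ≤ ∫⁻ t in Ioc (0:ℝ) 1, F (y + t • (x - y)) ^ 2 := by
    have := cs_lint (volume.restrict (Ioc (0:ℝ) 1)) mt.aemeasurable (g := fun _ => 1) aemeasurable_const
    simp only [mul_one, one_pow, lintegral_const, Measure.restrict_apply_univ, Real.volume_Ioc] at this
    norm_num at this
    refine (pow_le_pow_left' this 2).trans (le_of_eq ?_)
    rw [← ENNReal.rpow_natCast, ← ENNReal.rpow_mul]; norm_num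
  calc _ ≤ (‖x - y‖ₑ * ∫⁻ t in Ioc (0:ℝ) 1, F (y + t • (x - y))) ^ 2 := pow_le_pow_left' a 2
    _ ≤ _ := by rw [mul_pow]; exact mul_le_mul' le_rfl b

lemma WD.poin_eps (h : WD R w G) {ε : ℝ} (hε : 0 < ε) {r : ℝ} (hr : 0 < r) :
    ∫⁻ x in ball (0:E3) r, ∫⁻ y in ball (0:E3) r, ‖mol ε w x - mol ε w y‖ₑ ^ 2
      ≤ ENNReal.ofReal (128 * r ^ 2) * volume (ball (0:E3) r) * ∑ j, ∫⁻ x in ball (0:E3) r, ‖mol ε (G j) x‖ₑ ^ 2 := by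
  set B := ball (0:E3) r with hB
  have mB : MeasurableSet B := measurableSet_ball
  set F : E3 → ℝ≥0∞ := fun p => ∑ j, ‖mol ε (G j) p‖ₑ with hF
  have mF : Measurable F := Finset.measurable_sum _ fun j _ => (meas_mol hε (h.mG j)).enorm
  have hF2 : ∀ p, F p ^ 2 ≤ 4 * ∑ j, ‖mol ε (G j) p‖ₑ ^ 2 := by
    intro p
    simp only [hF, Fin.sum_univ_three]
    have := sq4 0 ‖mol ε (G 0) p‖ₑ ‖mol ε (G 1) p‖ₑ ‖mol ε (G 2) p‖ₑ
    simpa using this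
  calc _ ≤ ∫⁻ x in B, ∫⁻ y in B, ENNReal.ofReal (4 * r ^ 2) * ∫⁻ t in Ioc (0:ℝ) 1, F (y + t • (x - y)) ^ 2 := by
        refine setLIntegral_mono' mB fun x hx => setLIntegral_mono' mB fun y hy => ?_
        refine (h.mol_sq hε x y).trans (mul_le_mul' ?_ le_rfl)
        rw [← ofReal_norm, ← ENNReal.ofReal_pow (norm_nonneg _)]
        refine ENNReal.ofReal_le_ofReal ?_
        have h1 := norm_sub_le x y
        simp [hB] at hx hy
        have h2 := norm_nonneg (x - y)
        nlinarith
    _ = ENNReal.ofReal (4 * r ^ 2) * ∫⁻ x in B, ∫⁻ y in B, ∫⁻ t in Ioc (0:ℝ) 1, F (y + t • (x - y)) ^ 2 := by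
        rw [← lintegral_const_mul' _ _ ENNReal.ofReal_ne_top]
        refine lintegral_congr fun x => ?_
        rw [← lintegral_const_mul' _ _ ENNReal.ofReal_ne_top]
    _ ≤ ENNReal.ofReal (4 * r ^ 2) * (8 * volume B * ∫⁻ x in B, F x ^ 2) :=
        mul_le_mul' le_rfl (dbl_bound (mF.pow_const 2))
    _ ≤ ENNReal.ofReal (4 * r ^ 2) * (8 * volume B * ∫⁻ x in B, 4 * ∑ j, ‖mol ε (G j) x‖ₑ ^ 2) :=
        mul_le_mul' le_rfl (mul_le_mul' le_rfl (lintegral_mono hF2))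
    _ = _ := by
        rw [lintegral_const_mul' _ _ (by simp), lintegral_finsetSum _ fun j _ => (meas_mol hε (h.mG j)).enorm.pow_const 2,
          show (128:ℝ) * r ^ 2 = 32 * (4 * r ^ 2) by ring, ENNReal.ofReal_mul (p := 32) (by norm_num)]
        have : ENNReal.ofReal 32 = 8 * 4 := by norm_num
        rw [this]; ring

lemma mol_sq_lim {f : E3 → ℝ} (mf : Measurable f) (hf : Integrable f) (hf2 : MemLp f 2 volume) :
    Tendsto (fun ε : ℝ => ∫⁻ x, ‖mol ε f x - c0 * f x‖ₑ ^ 2) (𝓝[>] 0) (𝓝 0) := by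
  have := (ENNReal.continuous_pow 2).tendsto 0 |>.comp (approx2 mf hf hf2)
  simp only [ne_eq, OfNat.ofNat_ne_zero, not_false_eq_true, zero_pow] at this
  refine this.congr fun ε => ?_
  simp only [Function.comp]
  rw [← ENNReal.rpow_natCast, ← ENNReal.rpow_mul]; norm_num

lemma WD.poin (h : WD R w G) {r : ℝ} (hr : 0 < r) :
    ∫⁻ x in ball (0:E3) r, ∫⁻ y in ball (0:E3) r, ‖w x - w y‖ₑ ^ 2
      ≤ ENNReal.ofReal (256 * r ^ 2) * volume (ball (0:E3) r) * ∑ j, ∫⁻ x in ball (0:E3) r, ‖G j x‖ₑ ^ 2 := by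
  obtain ⟨e, e0, et0, ht⟩ := mol_ae h.mw h.iw
  have et' : Tendsto e atTop (𝓝[>] 0) := tendsto_nhdsWithin_iff.2 ⟨et0, Eventually.of_forall e0⟩
  set B := ball (0:E3) r with hB
  set μ := (volume : Measure E3).restrict B with hμ
  set K := ENNReal.ofReal (128 * r ^ 2) * volume B with hK
  have Kt : K ≠ ∞ := ENNReal.mul_ne_top ENNReal.ofReal_ne_top measure_ball_lt_top.ne
  set a : ℕ → ℝ≥0∞ := fun n => K * ∑ j, (2 * ((∫⁻ x, ‖mol (e n) (G j) x - c0 * G j x‖ₑ ^ 2)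
    + ENNReal.ofReal (c0 ^ 2) * ∫⁻ x in B, ‖G j x‖ₑ ^ 2)) with ha
  have ta : Tendsto a atTop (𝓝 (K * ∑ j, (2 * (0 + ENNReal.ofReal (c0 ^ 2) * ∫⁻ x in B, ‖G j x‖ₑ ^ 2)))) := by
    refine ENNReal.Tendsto.const_mul (tendsto_finsetSum _ fun j _ => ENNReal.Tendsto.const_mul
      (Tendsto.add_const _ ?_) (Or.inr (by simp))) (Or.inr Kt)
    exact (mol_sq_lim (h.mG j) (h.iG j) (h.lG j)).comp et'
  have mw : ∀ n, Measurable (mol (e n) w) := fun n => meas_mol (e0 n) h.mw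
  have mn : ∀ n, Measurable fun z : E3 × E3 => ‖mol (e n) w z.1 - mol (e n) w z.2‖ₑ ^ 2 := fun n =>
    (((mw n).comp measurable_fst).sub ((mw n).comp measurable_snd)).enorm.pow_const 2
  have ml : Measurable fun z : E3 × E3 => ‖c0 * w z.1 - c0 * w z.2‖ₑ ^ 2 :=
    (((h.mw.const_mul c0).comp measurable_fst).sub ((h.mw.const_mul c0).comp measurable_snd)).enorm.pow_const 2
  have le_a : ∀ n, ∫⁻ z, ‖mol (e n) w z.1 - mol (e n) w z.2‖ₑ ^ 2 ∂(μ.prod μ) ≤ a n := by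
    intro n
    rw [lintegral_prod _ (mn n).aemeasurable]
    refine (h.poin_eps (e0 n) hr).trans ?_
    refine mul_le_mul' le_rfl (Finset.sum_le_sum fun j _ => ?_)
    have mj : Measurable fun x => ‖mol (e n) (G j) x - c0 * G j x‖ₑ ^ 2 :=
      ((meas_mol (e0 n) (h.mG j)).sub ((h.mG j).const_mul c0)).enorm.pow_const 2
    calc ∫⁻ x in B, ‖mol (e n) (G j) x‖ₑ ^ 2
        ≤ ∫⁻ x in B, 2 * (‖mol (e n) (G j) x - c0 * G j x‖ₑ ^ 2 + ENNReal.ofReal (c0 ^ 2) * ‖G j x‖ₑ ^ 2) := by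
          refine lintegral_mono fun x => ?_
          have := sq2 ‖mol (e n) (G j) x - c0 * G j x‖ₑ ‖c0 * G j x‖ₑ
          rw [enorm_mul c0, mul_pow, Real.enorm_eq_ofReal c0_pos.le, ← ENNReal.ofReal_pow c0_pos.le] at this
          refine le_trans (pow_le_pow_left' ?_ 2) this
          have := enorm_add_le (mol (e n) (G j) x - c0 * G j x) (c0 * G j x)
          rwa [sub_add_cancel, enorm_mul c0, Real.enorm_eq_ofReal c0_pos.le] at this
      _ = 2 * ((∫⁻ x in B, ‖mol (e n) (G j) x - c0 * G j x‖ₑ ^ 2) + ENNReal.ofReal (c0 ^ 2) * ∫⁻ x in B, ‖G j x‖ₑ ^ 2) := by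
          rw [lintegral_const_mul' _ _ (by simp), lintegral_add_left mj, lintegral_const_mul' _ _ (by simp)]
      _ ≤ _ := mul_le_mul' le_rfl (add_le_add (setLIntegral_le_lintegral _ _) le_rfl)
  have aeB : ∀ᵐ x ∂μ, Tendsto (fun n => mol (e n) w x) atTop (𝓝 (c0 * w x)) := ae_restrict_of_ae ht
  have a1 : ∀ᵐ z : E3 × E3 ∂(μ.prod μ), Tendsto (fun n => mol (e n) w z.1) atTop (𝓝 (c0 * w z.1)) :=
    Measure.quasiMeasurePreserving_fst.ae aeB
  have a2 : ∀ᵐ z : E3 × E3 ∂(μ.prod μ), Tendsto (fun n => mol (e n) w z.2) atTop (𝓝 (c0 * w z.2)) :=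
    Measure.quasiMeasurePreserving_snd.ae aeB
  have main : ∫⁻ z, ‖c0 * w z.1 - c0 * w z.2‖ₑ ^ 2 ∂(μ.prod μ)
      ≤ K * ∑ j, (2 * (0 + ENNReal.ofReal (c0 ^ 2) * ∫⁻ x in B, ‖G j x‖ₑ ^ 2)) := by
    calc _ = ∫⁻ z, liminf (fun n => ‖mol (e n) w z.1 - mol (e n) w z.2‖ₑ ^ 2) atTop ∂(μ.prod μ) := by
          refine lintegral_congr_ae ?_
          filter_upwards [a1, a2] with z h1 h2
          have := ((ENNReal.continuous_pow 2).tendsto _).comp (h1.sub h2).enorm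
          exact this.liminf_eq.symm
      _ ≤ liminf (fun n => ∫⁻ z, ‖mol (e n) w z.1 - mol (e n) w z.2‖ₑ ^ 2 ∂(μ.prod μ)) atTop := lintegral_liminf_le mn
      _ ≤ liminf a atTop := liminf_le_liminf (Eventually.of_forall le_a)
      _ = _ := ta.liminf_eq
  rw [lintegral_prod _ ml.aemeasurable] at main
  have cc : ENNReal.ofReal (c0 ^ 2) ≠ 0 := by simp; exact c0_pos.ne'
  have lhs : ∫⁻ x in B, ∫⁻ y in B, ‖c0 * w x - c0 * w y‖ₑ ^ 2 = ENNReal.ofReal (c0 ^ 2) * ∫⁻ x in B, ∫⁻ y in B, ‖w x - w y‖ₑ ^ 2 := by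
    rw [← lintegral_const_mul' _ _ ENNReal.ofReal_ne_top]
    refine lintegral_congr fun x => ?_
    rw [← lintegral_const_mul' _ _ ENNReal.ofReal_ne_top]
    refine lintegral_congr fun y => ?_
    rw [← mul_sub, enorm_mul, mul_pow, Real.enorm_eq_ofReal c0_pos.le, ← ENNReal.ofReal_pow c0_pos.le]
  rw [lhs] at main
  refine (ENNReal.mul_le_mul_iff_right cc (by simp)).1 (main.trans (le_of_eq ?_))
  simp only [zero_add]
  rw [← Finset.mul_sum, ← Finset.mul_sum, hK, show (256:ℝ) * r^2 = 2 * (128 * r ^2) by ring,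
    ENNReal.ofReal_mul (p := 2) (by norm_num)]
  simp only [ENNReal.ofReal_ofNat]
  ring

end NSD

end

section

namespace NSD

lemma exists_cut {r R : ℝ} (h0 : 0 < r) (h1 : r < R) : ∃ φ : E3 → ℝ, Sm φ ∧ tsupport φ ⊆ ball 0 R ∧
    (∀ x, ‖x‖ < r → φ x = 1) ∧ (∀ x, 0 ≤ φ x) ∧ (∀ x, φ x ≤ 1) := by
  let b : ContDiffBump (0:E3) := ⟨r, (r + R)/2, h0, by linarith⟩
  refine ⟨b, b.contDiff, ?_, fun x hx => b.one_of_mem_closedBall (by simpa using hx.le), fun x => b.nonneg, fun x => b.le_one⟩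
  rw [b.tsupport_eq]
  exact closedBall_subset_ball (by show (r + R)/2 < R; linarith)

lemma pd_zero_of_const {φ : E3 → ℝ} {r c : ℝ} (h : ∀ x, ‖x‖ < r → φ x = c) (j : Fin 3) {x : E3} (hx : ‖x‖ < r) :
    pd j φ x = 0 := by
  have : φ =ᶠ[𝓝 x] fun _ => c := by
    filter_upwards [isOpen_ball.mem_nhds (show x ∈ ball (0:E3) r by simpa using hx)] with y hy
    exact h y (by simpa using hy)
  simp [pd, this.fderiv_eq]

lemma LWD.poin {ρ : ℝ} {v : E3 → ℝ} {g : Fin 3 → E3 → ℝ} (h : LWD ρ v g) (hρ : 0 < ρ) :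
    ∫⁻ x in ball (0:E3) ρ, ∫⁻ y in ball (0:E3) ρ, ‖v x - v y‖ₑ ^ 2
      ≤ ENNReal.ofReal (256 * ρ ^ 2) * volume (ball (0:E3) ρ) * ∑ j, ∫⁻ x in ball (0:E3) ρ, ‖g j x‖ₑ ^ 2 := by
  have mm : Measurable fun z : E3 × E3 => ‖v z.1 - v z.2‖ₑ ^ 2 :=
    ((h.mv.comp measurable_fst).sub (h.mv.comp measurable_snd)).enorm.pow_const 2
  have key : ∀ r, 0 < r → r < ρ → ∫⁻ z in ball (0:E3) r ×ˢ ball (0:E3) r, ‖v z.1 - v z.2‖ₑ ^ 2 ≤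
      ENNReal.ofReal (256 * ρ ^ 2) * volume (ball (0:E3) ρ) * ∑ j, ∫⁻ x in ball (0:E3) ρ, ‖g j x‖ₑ ^ 2 := by
    intro r r0 r1
    obtain ⟨φ, hφ, hs, h1, -, -⟩ := exists_cut r0 r1
    have hw := h.cut le_rfl hφ hs
    have := hw.poin r0
    have e1 : ∫⁻ z in ball (0:E3) r ×ˢ ball (0:E3) r, ‖v z.1 - v z.2‖ₑ ^ 2 =
      ∫⁻ x in ball (0:E3) r, ∫⁻ y in ball (0:E3) r, ‖φ x * v x - φ y * v y‖ₑ ^ 2 := by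
      rw [Measure.volume_eq_prod, ← Measure.prod_restrict, lintegral_prod _ mm.aemeasurable]
      refine setLIntegral_congr_fun measurableSet_ball fun x hx => setLIntegral_congr_fun measurableSet_ball fun y hy => ?_
      simp only []
      rw [h1 x (by simpa using hx), h1 y (by simpa using hy), one_mul, one_mul]
    rw [e1]
    refine this.trans (mul_le_mul' (mul_le_mul' (ENNReal.ofReal_le_ofReal ?_) (measure_mono (ball_subset_ball r1.le)))
      (Finset.sum_le_sum fun j _ => ?_))
    · gcongr
    · refine le_trans (le_of_eq ?_) (lintegral_mono_set (ball_subset_ball r1.le))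
      refine setLIntegral_congr_fun measurableSet_ball fun x hx => ?_
      have hx' : ‖x‖ < r := by simpa using hx
      rw [h1 x hx', pd_zero_of_const h1 j hx']; simp
  have ee : ball (0:E3) ρ ×ˢ ball (0:E3) ρ = ⋃ n : ℕ, ball (0:E3) (ρ * (1 - 1/(n+2))) ×ˢ ball (0:E3) (ρ * (1 - 1/(n+2))) := by
    ext ⟨x, y⟩
    simp only [mem_prod, mem_iUnion, mem_ball_zero_iff]
    constructor
    · rintro ⟨hx, hy⟩
      have hm : max ‖x‖ ‖y‖ < ρ := max_lt hx hy
      obtain ⟨n, hn⟩ := exists_nat_one_div_lt (show 0 < 1 - max ‖x‖ ‖y‖/ρ by rw [sub_pos, div_lt_one hρ]; exact hm)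
      have h2 : max ‖x‖ ‖y‖ < ρ * (1 - 1/(n+2)) := by
        have : 1/((n:ℝ)+2) ≤ 1/(n+1) := by gcongr; norm_num
        have h3 : max ‖x‖ ‖y‖/ρ < 1 - 1/(n+2) := by linarith
        rwa [div_lt_iff₀' hρ] at h3
      exact ⟨n, (le_max_left _ _).trans_lt h2, (le_max_right _ _).trans_lt h2⟩
    · rintro ⟨n, hx, hy⟩
      have : ρ * (1 - 1/(n+2)) ≤ ρ := by
        have : 0 ≤ 1/((n:ℝ)+2) := by positivity
        nlinarith
      exact ⟨hx.trans_le this, hy.trans_le this⟩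
  have e2 : ∫⁻ x in ball (0:E3) ρ, ∫⁻ y in ball (0:E3) ρ, ‖v x - v y‖ₑ ^ 2 =
      ∫⁻ z in ball (0:E3) ρ ×ˢ ball (0:E3) ρ, ‖v z.1 - v z.2‖ₑ ^ 2 := by
    rw [Measure.volume_eq_prod, ← Measure.prod_restrict, lintegral_prod _ mm.aemeasurable]
  rw [e2, ee, setLIntegral_iUnion_of_directed]
  · refine iSup_le fun n => key _ ?_ ?_
    · have : 1/((n:ℝ)+2) < 1 := by rw [div_lt_one (by positivity)]; linarith [Nat.cast_nonneg (α := ℝ) n]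
      exact mul_pos hρ (by linarith)
    · have : 0 < 1/((n:ℝ)+2) := by positivity
      nlinarith
  · refine Monotone.directed_le fun m n hmn => ?_
    have : ρ * (1 - 1/((m:ℝ)+2)) ≤ ρ * (1 - 1/((n:ℝ)+2)) := by
      have : (m:ℝ) ≤ n := by exact_mod_cast hmn
      gcongr
    exact prod_mono (ball_subset_ball this) (ball_subset_ball this)

lemma LWD.poin0 {ρ : ℝ} {v : E3 → ℝ} {g : Fin 3 → E3 → ℝ} (h : LWD ρ v g) (hρ : 0 < ρ)
    (hm : ∫ x in ball (0:E3) ρ, v x = 0) :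
    ∫⁻ x in ball (0:E3) ρ, ‖v x‖ₑ ^ 2 ≤ ENNReal.ofReal (256 * ρ ^ 2) * ∑ j, ∫⁻ x in ball (0:E3) ρ, ‖g j x‖ₑ ^ 2 := by
  have := h.poin hρ
  set B := ball (0:E3) ρ with hB
  set V := volume B with hV
  have Vt : V ≠ ∞ := measure_ball_lt_top.ne
  have V0 : V ≠ 0 := (measure_ball_pos _ _ hρ).ne'
  have hInt : Integrable v (volume.restrict B) := by
    haveI : IsFiniteMeasure (volume.restrict B) := ⟨by simpa using measure_ball_lt_top⟩
    exact h.lv.integrable (by norm_num)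
  have key : ∀ x, V * ‖v x‖ₑ ^ 2 ≤ ∫⁻ y in B, ‖v x - v y‖ₑ ^ 2 := by
    intro x
    have m1 : Measurable fun y => ‖v x - v y‖ₑ := (measurable_const.sub h.mv).enorm
    have h1 : V * ‖v x‖ₑ ≤ ∫⁻ y in B, ‖v x - v y‖ₑ := by
      refine le_trans (le_of_eq ?_) (enorm_integral_le_lintegral_enorm _)
      have hc : Integrable (fun _ : E3 => v x) (volume.restrict B) := integrableOn_const Vt
      rw [integral_sub hc hInt, hm, sub_zero, setIntegral_const, enorm_smul, Measure.real,
        Real.enorm_eq_ofReal ENNReal.toReal_nonneg, ENNReal.ofReal_toReal Vt]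
    have h2 := cs_lint (volume.restrict B) m1.aemeasurable (g := fun _ => 1) aemeasurable_const
    simp only [mul_one, one_pow, lintegral_const, Measure.restrict_apply_univ, one_mul] at h2
    have h3 := pow_le_pow_left' (h1.trans h2) 2
    rw [mul_pow, mul_pow, ← ENNReal.rpow_natCast (_ ^ (1/2:ℝ)), ← ENNReal.rpow_mul, ← ENNReal.rpow_natCast (_ ^ (1/2:ℝ)), ← ENNReal.rpow_mul] at h3
    norm_num at h3
    rw [← hV, sq V, mul_assoc, mul_comm _ V] at h3
    exact (ENNReal.mul_le_mul_iff_right V0 Vt).1 h3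
  have h4 : V * ∫⁻ x in B, ‖v x‖ₑ ^ 2 ≤ V * (ENNReal.ofReal (256 * ρ ^ 2) * ∑ j, ∫⁻ x in B, ‖g j x‖ₑ ^ 2) := by
    rw [← lintegral_const_mul' _ _ Vt]
    refine (lintegral_mono key).trans (this.trans (le_of_eq ?_))
    ring
  exact (ENNReal.mul_le_mul_iff_right V0 Vt).1 h4

end NSD

end

section

namespace NSD

/-- scaled cutoffs with derivative bounds -/
structure Cut (M ρ a b : ℝ) (φ : E3 → ℝ) : Prop where
  sm : Sm φ
  ts : tsupport φ ⊆ ball 0 (b * ρ)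
  one : ∀ x, ‖x‖ < a * ρ → φ x = 1
  le : ∀ x, |φ x| ≤ 1
  d1 : ∀ j x, |pd j φ x| ≤ M / ρ
  d2 : ∀ i j x, |pd i (pd j φ) x| ≤ M / ρ ^ 2

lemma bdd_of_hcs {f : E3 → ℝ} (hf : Continuous f) (hc : HasCompactSupport f) : ∃ C, 0 ≤ C ∧ ∀ x, |f x| ≤ C := by
  obtain ⟨C, hC⟩ := hf.bounded_above_of_compact_support hc
  exact ⟨C, (norm_nonneg _).trans (hC 0), hC⟩

lemma exists_Cut {a b : ℝ} (ha : 0 < a) (hab : a < b) : ∃ M : ℝ, 0 < M ∧ ∀ ρ : ℝ, 0 < ρ → ∃ φ, Cut M ρ a b φ := by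
  obtain ⟨φ, hφ, hs, h1, h2, h3⟩ := exists_cut ha hab
  have hc := hcs_ball hs
  choose C1 C1' hC1 using fun j => bdd_of_hcs (hφ.pd j).continuous (hcs_pd hc j)
  choose C2 C2' hC2 using fun i j => bdd_of_hcs ((hφ.pd j).pd i).continuous (hcs_pd (hcs_pd hc j) i)
  have p1 : 0 ≤ ∑ j, C1 j := Finset.sum_nonneg fun j _ => C1' j
  have p2 : 0 ≤ ∑ i, ∑ j, C2 i j := Finset.sum_nonneg fun i _ => Finset.sum_nonneg fun j _ => C2' i j
  have q1 : ∀ j, C1 j ≤ ∑ j, C1 j := fun j => Finset.single_le_sum (f := C1) (fun j _ => C1' j) (Finset.mem_univ j)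
  have q2 : ∀ i j, C2 i j ≤ ∑ i, ∑ j, C2 i j := fun i j =>
    (Finset.single_le_sum (f := C2 i) (fun j _ => C2' i j) (Finset.mem_univ j)).trans
    (Finset.single_le_sum (f := fun i => ∑ j, C2 i j) (fun i _ => Finset.sum_nonneg fun j _ => C2' i j) (Finset.mem_univ i))
  refine ⟨1 + (∑ j, C1 j) + ∑ i, ∑ j, C2 i j, by positivity, fun ρ hρ => ⟨fun y => φ (ρ⁻¹ • y), ?_⟩⟩
  have sm : ∀ f : E3 → ℝ, Sm f → Sm fun y => f (ρ⁻¹ • y) := fun f hf => hf.comp (contDiff_id.const_smul _)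
  have e1 : ∀ j, pd j (fun y => φ (ρ⁻¹ • y)) = fun y => ρ⁻¹ * pd j φ (ρ⁻¹ • y) := fun j => by
    funext y; rw [pd_smul_arg hφ]
  refine ⟨sm _ hφ, ?_, ?_, ?_, ?_, ?_⟩
  · have hsub : tsupport (fun y => φ (ρ⁻¹ • y)) ⊆ (fun y => ρ⁻¹ • y) ⁻¹' tsupport φ :=
      tsupport_comp_subset_preimage φ (continuous_const_smul ρ⁻¹)
    intro x hx
    have := hs (hsub hx)
    rw [mem_ball_zero_iff, norm_smul, Real.norm_of_nonneg (by positivity), inv_mul_lt_iff₀ hρ] at this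
    rw [mem_ball_zero_iff]; linarith
  · intro x hx
    apply h1
    rw [norm_smul, Real.norm_of_nonneg (by positivity), inv_mul_lt_iff₀ hρ]; linarith
  · intro x; rw [abs_of_nonneg (h2 _)]; exact h3 _
  · intro j x
    rw [e1, abs_mul, abs_of_pos (by positivity), inv_mul_eq_div]
    gcongr
    exact (hC1 j _).trans (by linarith [q1 j])
  · intro i j x
    rw [e1, pd_const_mul (sm _ (hφ.pd j)), pd_smul_arg (hφ.pd j), abs_mul, abs_mul, abs_of_pos (by positivity), ← mul_assoc,
      ← sq, inv_pow, inv_mul_eq_div]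
    gcongr
    exact (hC2 i j _).trans (by linarith [q2 i j])

/-- test function -/
def tf (φ : E3 → ℝ) (l : ℝ) (x y : E3) : ℝ := nk l (y - x) * φ y

lemma sm_tf {φ : E3 → ℝ} (hφ : Sm φ) {l : ℝ} (hl : 0 < l) (x : E3) : Sm (tf φ l x) :=
  (sm_sub (sm_nk hl) x).mul hφ

lemma pd_tf {φ : E3 → ℝ} (hφ : Sm φ) {l : ℝ} (hl : 0 < l) (x : E3) (j : Fin 3) (y : E3) :
    pd j (tf φ l x) y = d1 l j (y - x) * φ y + nk l (y - x) * pd j φ y := by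
  unfold tf
  rw [pd_mul (sm_sub (sm_nk hl) x) hφ, pd_translate, pd_nk hl]

lemma pd2_tf {φ : E3 → ℝ} (hφ : Sm φ) {l : ℝ} (hl : 0 < l) (x : E3) (i j : Fin 3) (y : E3) :
    pd i (pd j (tf φ l x)) y = d2 l j i (y - x) * φ y + d1 l j (y - x) * pd i φ y
      + d1 l i (y - x) * pd j φ y + nk l (y - x) * pd i (pd j φ) y := by
  have e : pd j (tf φ l x) = fun y => d1 l j (y - x) * φ y + nk l (y - x) * pd j φ y := by
    funext y; exact pd_tf hφ hl x j y
  rw [e, pd_add ((sm_sub (sm_d1 hl j) x).mul hφ) ((sm_sub (sm_nk hl) x).mul (hφ.pd j)),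
    pd_mul (sm_sub (sm_d1 hl j) x) hφ, pd_mul (sm_sub (sm_nk hl) x) (hφ.pd j), pd_translate, pd_translate,
    pd_d1 hl, pd_nk hl]
  ring

lemma inv_le_nk {l ρ : ℝ} (hl : 0 < l) (hlρ : l ≤ ρ) {z : E3} (hz : ‖z‖ ≤ 2 * ρ) : 1 / ρ ≤ 3 * nk l z := by
  have hρ : 0 < ρ := hl.trans_le hlρ
  unfold nk
  have h : Real.sqrt (‖z‖ ^ 2 + l ^ 2) ≤ 3 * ρ := by
    apply Real.sqrt_le_iff.2 ⟨by positivity, ?_⟩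
    have := norm_nonneg z
    nlinarith
  have h2 : 0 < Real.sqrt (‖z‖ ^ 2 + l ^ 2) := Real.sqrt_pos.2 (apos hl z)
  rw [← div_eq_mul_inv, div_le_div_iff₀ hρ h2]
  linarith

lemma pd2_tf_bound {M ρ a b : ℝ} {φ : E3 → ℝ} (hM : 0 < M) (hφ : Cut M ρ a b φ) {l : ℝ} (hl : 0 < l) (hlρ : l ≤ ρ)
    {x y : E3} (hz : ‖y - x‖ ≤ 2 * ρ) (i j : Fin 3) :
    |pd i (pd j (tf φ l x)) y| ≤ (4 + 15 * M) * kf l (y - x) := by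
  have hρ : 0 < ρ := hl.trans_le hlρ
  rw [pd2_tf hφ.sm hl, kf_eq hl]
  set n := nk l (y - x) with hn
  have n0 : 0 < n := nk_pos hl _
  have hi : 1 / ρ ≤ 3 * n := inv_le_nk hl hlρ hz
  have t1 : |d2 l j i (y - x) * φ y| ≤ 4 * n ^ 3 * 1 := by
    rw [abs_mul]; exact mul_le_mul (d2_bound hl _ _ _) (hφ.le _) (abs_nonneg _) (by positivity)
  have hd : ∀ k, |pd k φ y| ≤ 3 * M * n := fun k => (hφ.d1 k y).trans (by
    calc M / ρ = M * (1/ρ) := by ring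
      _ ≤ M * (3 * n) := by gcongr
      _ = _ := by ring)
  have hd2 : |pd i (pd j φ) y| ≤ 9 * M * n ^ 2 := (hφ.d2 i j y).trans (by
    calc M / ρ ^ 2 = M * (1/ρ) ^ 2 := by ring
      _ ≤ M * (3 * n) ^ 2 := by gcongr
      _ = _ := by ring)
  have t2 : |d1 l j (y - x) * pd i φ y| ≤ n ^ 2 * (3 * M * n) := by
    rw [abs_mul]; exact mul_le_mul (d1_bound hl _ _) (hd _) (abs_nonneg _) (by positivity)
  have t3 : |d1 l i (y - x) * pd j φ y| ≤ n ^ 2 * (3 * M * n) := by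
    rw [abs_mul]; exact mul_le_mul (d1_bound hl _ _) (hd _) (abs_nonneg _) (by positivity)
  have t4 : |n * pd i (pd j φ) y| ≤ n * (9 * M * n ^ 2) := by
    rw [abs_mul, abs_of_pos n0]; gcongr
  refine (abs_add_le _ _).trans ?_
  refine (add_le_add ((abs_add_le _ _).trans (add_le_add ((abs_add_le _ _).trans (add_le_add t1 t2)) t3)) t4).trans (le_of_eq ?_)
  ring

lemma near_tf_bound {M ρ a b : ℝ} {φ : E3 → ℝ} (hM : 0 < M) (hφ : Cut M ρ a b φ) {ε l : ℝ} (hε : 0 < ε) (hεl : ε ≤ l)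
    (hρ : 0 < ρ) {x y : E3} (hz : ‖y - x‖ ≤ 2 * ρ) (hne : y ≠ x) (j : Fin 3) :
    |pd j (fun y => tf φ ε x y - tf φ l x y) y| ≤ (3 + 2 * M) * kn l (y - x) := by
  have hl : 0 < l := hε.trans_le hεl
  have hz0 : y - x ≠ 0 := sub_ne_zero.2 hne
  rw [pd_sub (sm_tf hφ.sm hε x) (sm_tf hφ.sm hl x), pd_tf hφ.sm hε, pd_tf hφ.sm hl]
  have e : d1 ε j (y - x) * φ y + nk ε (y - x) * pd j φ y - (d1 l j (y - x) * φ y + nk l (y - x) * pd j φ y)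
    = (d1 ε j (y - x) - d1 l j (y - x)) * φ y + (nk ε (y - x) - nk l (y - x)) * pd j φ y := by ring
  rw [e]
  have k0 := kn_nonneg l (y - x)
  have t1 : |(d1 ε j (y - x) - d1 l j (y - x)) * φ y| ≤ 3 * kn l (y - x) * 1 := by
    rw [abs_mul]; exact mul_le_mul (near_d1 hε hεl j hz0) (hφ.le _) (abs_nonneg _) (by positivity)
  have t2 : |(nk ε (y - x) - nk l (y - x)) * pd j φ y| ≤ (2 * ρ * kn l (y - x)) * (M / ρ) := by
    rw [abs_mul]
    refine mul_le_mul ((near_n hε hεl hz0).trans ?_) (hφ.d1 _ _) (abs_nonneg _) (by positivity)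
    gcongr
  refine (abs_add_le _ _).trans ((add_le_add t1 t2).trans (le_of_eq ?_))
  field_simp

lemma kf_even (l : ℝ) (x y : E3) : kf l (y - x) = kf l (x - y) := by unfold kf; rw [norm_sub_rev]

lemma R_bound {M ρ a b : ℝ} {φ : E3 → ℝ} (hM : 0 < M) (hφ : Cut M ρ a b φ) {ε l : ℝ} (hε : 0 < ε) (hεl : ε ≤ l) (hlρ : l ≤ ρ)
    {w w' : E3 → ℝ} {G G' : Fin 3 → E3 → ℝ} (h : WD ρ w G) (h' : WD ρ w' G') {x : E3} (hx : ‖x‖ ≤ ρ) (i j : Fin 3) :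
    ‖∫ y, (w y * w' y) * pd i (pd j (tf φ ε x)) y‖ₑ ≤
      ENNReal.ofReal (4 + 15 * M) * cv (fun z => ENNReal.ofReal (kf l z)) (fun y => ‖w y‖ₑ * ‖w' y‖ₑ) x
      + ENNReal.ofReal (3 + 2 * M) * cv (fun z => ENNReal.ofReal (kn l z)) (fun y => ‖G i y‖ₑ * ‖w' y‖ₑ + ‖w y‖ₑ * ‖G' i y‖ₑ) x := by
  have hl : 0 < l := hε.trans_le hεl
  have hρ : 0 < ρ := hl.trans_le hlρ
  have sε := sm_tf hφ.sm hε x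
  have sl := sm_tf hφ.sm hl x
  have hww : Integrable (fun y => w y * w' y) := MemLp.integrable_mul h.lw h'.lw
  have sww : ∀ y, ρ ≤ ‖y‖ → w y * w' y = 0 := fun y hy => by rw [h.sw y hy, zero_mul]
  have sd : Sm (fun y => tf φ ε x y - tf φ l x y) := ContDiff.sub sε sl
  have e1 : ∀ y, pd i (pd j (tf φ ε x)) y = pd i (pd j (tf φ l x)) y + pd i (pd j (fun y => tf φ ε x y - tf φ l x y)) y := by
    intro y
    have : pd j (fun y => tf φ ε x y - tf φ l x y) = fun y => pd j (tf φ ε x) y - pd j (tf φ l x) y := by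
      funext y; rw [pd_sub sε sl]
    rw [this, pd_sub (sε.pd j) (sl.pd j)]; ring
  have i1 : Integrable fun y => (w y * w' y) * pd i (pd j (tf φ l x)) y := int_cs hww sww ((sl.pd j).pd i).continuous
  have i2 : Integrable fun y => (w y * w' y) * pd i (pd j (fun y => tf φ ε x y - tf φ l x y)) y :=
    int_cs hww sww ((sd.pd j).pd i).continuous
  have e2 : ∫ y, (w y * w' y) * pd i (pd j (tf φ ε x)) y = (∫ y, (w y * w' y) * pd i (pd j (tf φ l x)) y)
      + ∫ y, (w y * w' y) * pd i (pd j (fun y => tf φ ε x y - tf φ l x y)) y := by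
    rw [← integral_add i1 i2]; refine integral_congr_ae (Eventually.of_forall fun y => ?_)
    simp only []; rw [e1]; ring
  have nz : ∀ y : E3, ‖y‖ < ρ → ‖y - x‖ ≤ 2 * ρ := fun y hy => by linarith [norm_sub_le y x]
  rw [e2]
  refine (enorm_add_le _ _).trans (add_le_add ?_ ?_)
  · refine (enorm_integral_le_lintegral_enorm _).trans ?_
    unfold cv
    rw [← lintegral_const_mul' _ _ ENNReal.ofReal_ne_top]
    refine lintegral_mono fun y => ?_
    rcases lt_or_ge ‖y‖ ρ with hy | hy
    · beta_reduce
      rw [enorm_mul, enorm_mul, mul_comm, Real.enorm_eq_ofReal_abs (pd _ _ _), ← mul_assoc (ENNReal.ofReal (4 + 15 * M)), ← ENNReal.ofReal_mul (by positivity), ← kf_even]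
      exact mul_le_mul' (ENNReal.ofReal_le_ofReal (pd2_tf_bound hM hφ hl hlρ (nz y hy) i j)) le_rfl
    · rw [sww y hy]; simp
  · rw [prod_rule h h' (sd.pd j) i, enorm_neg]
    refine (enorm_integral_le_lintegral_enorm _).trans ?_
    unfold cv
    rw [← lintegral_const_mul' _ _ ENNReal.ofReal_ne_top]
    refine lintegral_mono_ae ?_
    filter_upwards [ae_ne x] with y hne
    rcases lt_or_ge ‖y‖ ρ with hy | hy
    · beta_reduce
      rw [enorm_mul, mul_comm, Real.enorm_eq_ofReal_abs (pd _ _ _), ← mul_assoc, ← ENNReal.ofReal_mul (by positivity), ← kn_even]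
      refine mul_le_mul' (ENNReal.ofReal_le_ofReal (near_tf_bound hM hφ hε hεl hρ (nz y hy) hne j)) ?_
      refine (enorm_add_le _ _).trans ?_
      rw [enorm_mul, enorm_mul]
    · rw [h.sG i y hy, h.sw y hy]; simp

end NSD

end

section

namespace NSD

/-- fixed-time slice data -/
structure FT (ρ : ℝ) (v : Fin 3 → E3 → ℝ) (g : Fin 3 → Fin 3 → E3 → ℝ) (P : E3 → ℝ) : Prop where
  lwd : ∀ i, LWD ρ (v i) (g i)
  mean : ∀ i, ∫ x in ball (0:E3) ρ, v i x = 0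
  mP : Measurable P
  iP : Integrable P (volume.restrict (ball 0 ρ))
  eqn : ∀ χ, Sm χ → HasCompactSupport χ → tsupport χ ⊆ ball 0 ρ →
    ∫ x in ball 0 ρ, P x * (∑ i, pd i (pd i χ) x) =
      - ∑ i, ∑ j, ∫ x in ball 0 ρ, (v i x * v j x) * pd i (pd j χ) x

lemma lip_line {K : E3 → ℝ} (hK : Sm K) {x y z : E3} {S : ℝ}
    (hS : ∀ t : ℝ, 0 ≤ t → t ≤ 1 → ∀ j, |pd j K (z - (y + t • (x - y)))| ≤ S) :
    |K (z - x) - K (z - y)| ≤ 3 * ‖x - y‖ * S := by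
  rw [line_int hK]
  have := intervalIntegral.norm_integral_le_of_norm_le_const (a := 0) (b := 1) (C := 3 * ‖x - y‖ * S)
    (f := fun t : ℝ => - ∑ j, (x - y) j * pd j K (z - (y + t • (x - y)))) ?_
  · simpa using this
  · intro t ht
    rw [uIoc_of_le zero_le_one] at ht
    rw [norm_neg]
    refine (norm_sum_le _ _).trans ?_
    have : ∀ j ∈ Finset.univ, ‖(x - y) j * pd j K (z - (y + t • (x - y)))‖ ≤ ‖x - y‖ * S := by
      intro j _
      rw [norm_mul]
      exact mul_le_mul (coord_le _ _) (hS t ht.1.le ht.2 j) (abs_nonneg _) (norm_nonneg _)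
    refine (Finset.sum_le_sum this).trans (le_of_eq ?_)
    simp; ring

/-- lower-order kernel -/
def Hk (φ : E3 → ℝ) (ε : ℝ) (x y : E3) : ℝ :=
  ∑ i, (2 * (d1 ε i (y - x) * pd i φ y) + nk ε (y - x) * pd i (pd i φ) y)

lemma cont_Hk {φ : E3 → ℝ} (hφ : Sm φ) {ε : ℝ} (hε : 0 < ε) (x : E3) : Continuous (Hk φ ε x) := by
  unfold Hk
  refine continuous_finsetSum _ fun i _ => ?_
  exact (continuous_const.mul (((sm_sub (sm_d1 hε i) x).continuous).mul (hφ.pd i).continuous)).add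
    (((sm_sub (sm_nk hε) x).continuous).mul ((hφ.pd i).pd i).continuous)

lemma lap_tf {φ : E3 → ℝ} (hφ : Sm φ) {ε : ℝ} (hε : 0 < ε) (x y : E3) :
    ∑ i, pd i (pd i (tf φ ε x)) y = Hk φ ε x y - φ y * et ε (y - x) := by
  have h := lap_nk hε (y - x)
  simp only [Fin.sum_univ_three] at h
  simp only [pd2_tf hφ hε, Hk, Fin.sum_univ_three]
  have : et ε (y - x) = -(d2 ε 0 0 (y - x) + d2 ε 1 1 (y - x) + d2 ε 2 2 (y - x)) := by rw [h]; ring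
  rw [this]; ring

lemma nk_far {ε ρ : ℝ} (hε : 0 < ε) (hρ : 0 < ρ) {y p : E3} (hy : ρ / 2 ≤ ‖y‖) (hp : ‖p‖ < ρ / 8) : nk ε (y - p) ≤ 3 / ρ := by
  have h1 : 3 * ρ / 8 ≤ ‖y - p‖ := by linarith [norm_sub_norm_le y p]
  have h2 : 0 < ‖y - p‖ := by linarith
  have := nk_mul_norm hε (y - p)
  have n0 := nk_pos hε (y - p)
  rw [le_div_iff₀ hρ]
  nlinarith

lemma Hk_lip {M ρ b : ℝ} {φ : E3 → ℝ} (hM : 0 < M) (hρ : 0 < ρ) (hφ : Cut M ρ (1/2) b φ) {ε μ : ℝ} (hε : 0 < ε) (hμ : μ ≤ ρ / 8)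
    {x x' : E3} (hx : ‖x‖ < μ) (hx' : ‖x'‖ < μ) (y : E3) :
    |Hk φ ε x y - Hk φ ε x' y| ≤ 4050 * M * μ / ρ ^ 4 := by
  have μ0 : 0 < μ := (norm_nonneg x).trans_lt hx
  rcases lt_or_ge ‖y‖ (1/2 * ρ) with hy | hy
  · have z1 : ∀ i, pd i φ y = 0 := fun i => pd_zero_of_const hφ.one i hy
    have z2 : ∀ i, pd i (pd i φ) y = 0 := fun i =>
      pd_zero_of_const (r := 1/2*ρ) (c := 0) (fun x hx => pd_zero_of_const hφ.one i hx) i hy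
    simp only [Hk, z1, z2]; simp; positivity
  · have hseg : ∀ t : ℝ, 0 ≤ t → t ≤ 1 → ‖x' + t • (x - x')‖ < ρ / 8 := by
      intro t h0 h1
      have := conv_mem h0 h1 (show x ∈ ball (0:E3) μ by simpa using hx) (show x' ∈ ball (0:E3) μ by simpa using hx')
      rw [mem_ball_zero_iff] at this; linarith
    have hxx : ‖x - x'‖ ≤ 2 * μ := by linarith [norm_sub_le x x']
    have hn : ∀ t : ℝ, 0 ≤ t → t ≤ 1 → nk ε (y - (x' + t • (x - x'))) ≤ 3 / ρ := fun t h0 h1 =>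
      nk_far hε hρ (by linarith) (hseg t h0 h1)
    have l1 : ∀ i, |d1 ε i (y - x) - d1 ε i (y - x')| ≤ 648 * μ / ρ ^ 3 := by
      intro i
      refine (lip_line (sm_d1 hε i) (S := 4 * (3/ρ)^3) fun t h0 h1 j => ?_).trans ?_
      · rw [pd_d1 hε]
        refine (d2_bound hε _ _ _).trans ?_
        have := nk_pos hε (y - (x' + t • (x - x')))
        have := hn t h0 h1
        gcongr
      · calc _ ≤ 3 * (2 * μ) * (4 * (3/ρ)^3) := by gcongr
          _ = _ := by ring
    have l2 : |nk ε (y - x) - nk ε (y - x')| ≤ 54 * μ / ρ ^ 2 := by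
      refine (lip_line (sm_nk hε) (S := (3/ρ)^2) fun t h0 h1 j => ?_).trans ?_
      · rw [pd_nk hε]
        refine (d1_bound hε _ _).trans ?_
        have := nk_pos hε (y - (x' + t • (x - x')))
        have := hn t h0 h1
        gcongr
      · calc _ ≤ 3 * (2 * μ) * (3/ρ)^2 := by gcongr
          _ = _ := by ring
    unfold Hk
    rw [← Finset.sum_sub_distrib]
    refine (Finset.abs_sum_le_sum_abs _ _).trans ?_
    have : ∀ i ∈ (Finset.univ : Finset (Fin 3)), |2 * (d1 ε i (y - x) * pd i φ y) + nk ε (y - x) * pd i (pd i φ) y -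
        (2 * (d1 ε i (y - x') * pd i φ y) + nk ε (y - x') * pd i (pd i φ) y)| ≤ 1350 * M * μ / ρ ^ 4 := by
      intro i _
      have e : 2 * (d1 ε i (y - x) * pd i φ y) + nk ε (y - x) * pd i (pd i φ) y -
        (2 * (d1 ε i (y - x') * pd i φ y) + nk ε (y - x') * pd i (pd i φ) y) =
        2 * ((d1 ε i (y - x) - d1 ε i (y - x')) * pd i φ y) + (nk ε (y - x) - nk ε (y - x')) * pd i (pd i φ) y := by ring
      rw [e]
      refine (abs_add_le _ _).trans ?_
      rw [abs_mul, abs_mul, abs_mul, abs_two]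
      have a1 := mul_le_mul (l1 i) (hφ.d1 i y) (abs_nonneg _) (by positivity)
      have a2 := mul_le_mul l2 (hφ.d2 i i y) (abs_nonneg _) (by positivity)
      refine (add_le_add (mul_le_mul_of_nonneg_left a1 zero_le_two) a2).trans (le_of_eq ?_)
      field_simp; ring
    refine (Finset.sum_le_sum this).trans (le_of_eq ?_)
    simp; ring

variable {ρ : ℝ} {v : Fin 3 → E3 → ℝ} {g : Fin 3 → Fin 3 → E3 → ℝ} {P : E3 → ℝ}

lemma FT.intP (h : FT ρ v g P) {χ : E3 → ℝ} (hχ : Continuous χ) : Integrable (fun y => P y * χ y) (volume.restrict (ball 0 ρ)) := by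
  obtain ⟨M, hM⟩ := (isCompact_closedBall (0:E3) ρ).exists_bound_of_continuousOn hχ.continuousOn
  refine (h.iP.norm.mul_const M).mono' (h.iP.1.mul hχ.aestronglyMeasurable) ?_
  refine (ae_restrict_iff' measurableSet_ball).2 (ae_of_all _ fun x hx => ?_)
  rw [norm_mul]
  exact mul_le_mul_of_nonneg_left (hM x (ball_subset_closedBall hx)) (norm_nonneg _)

lemma FT.rep (h : FT ρ v g P) {φ : E3 → ℝ} (hφ : Sm φ) (hs : tsupport φ ⊆ ball 0 ρ) {ε : ℝ} (hε : 0 < ε) (x : E3) :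
    mol ε (fun y => φ y * P y) x = (∫ y in ball 0 ρ, P y * Hk φ ε x y)
      + ∑ i, ∑ j, ∫ y in ball 0 ρ, (v i y * v j y) * pd i (pd j (tf φ ε x)) y := by
  have ts : tsupport (tf φ ε x) ⊆ ball 0 ρ := by
    refine (closure_mono ?_).trans hs
    intro y hy
    simp only [Function.mem_support, tf] at hy ⊢
    exact right_ne_zero_of_mul hy
  have st := sm_tf hφ hε x
  have := h.eqn _ st (hcs_ball ts) ts
  have e : ∑ i, ∑ j, ∫ y in ball 0 ρ, (v i y * v j y) * pd i (pd j (tf φ ε x)) y =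
    - ∫ y in ball 0 ρ, P y * (∑ i, pd i (pd i (tf φ ε x)) y) := by rw [this, neg_neg]
  rw [e, ← sub_eq_add_neg, ← integral_sub (h.intP (cont_Hk hφ hε x))
    (h.intP (continuous_finsetSum _ fun i _ => ((st.pd i).pd i).continuous))]
  unfold mol
  rw [← set_int (ρ := ρ) (f := fun y => φ y * P y * et ε (y - x)) (fun y hy => by rw [off_ts hs hy]; ring)]
  refine integral_congr_ae (ae_of_all _ fun y => ?_)
  simp only [lap_tf hφ hε]; ring

/-- pointwise majorant -/
def GG (M l : ℝ) (W Γ : E3 → ℝ≥0∞) (x : E3) : ℝ≥0∞ :=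
  9 * (ENNReal.ofReal (4 + 15 * M) * cv (fun z => ENNReal.ofReal (kf l z)) (fun y => W y * W y) x
      + ENNReal.ofReal (3 + 2 * M) * cv (fun z => ENNReal.ofReal (kn l z)) (fun y => 2 * (W y * Γ y)) x)

lemma cv_mono {k f f' : E3 → ℝ≥0∞} (h : ∀ y, f y ≤ f' y) (x : E3) : cv k f x ≤ cv k f' x :=
  lintegral_mono fun y => mul_le_mul' le_rfl (h y)

lemma FT.R_le (h : FT ρ v g P) {M : ℝ} {φ φ1 : E3 → ℝ} (hM : 0 < M) (hφ : Cut M ρ (1/2) (3/4) φ) (s1 : Sm φ1)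
    (ts1 : tsupport φ1 ⊆ ball 0 ρ) (o1 : ∀ x, ‖x‖ < 3/4 * ρ → φ1 x = 1)
    {ε l : ℝ} (hε : 0 < ε) (hεl : ε ≤ l) (hlρ : l ≤ ρ) {x : E3} (hx : ‖x‖ ≤ ρ) :
    ‖∑ i, ∑ j, ∫ y in ball 0 ρ, (v i y * v j y) * pd i (pd j (tf φ ε x)) y‖ₑ ≤
      GG M l (fun y => ∑ i, ‖φ1 y * v i y‖ₑ) (fun y => ∑ i, ∑ j, ‖φ1 y * g i j y + pd j φ1 y * v i y‖ₑ) x := by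
  have hw := fun i => (h.lwd i).cut le_rfl s1 ts1
  set W : E3 → ℝ≥0∞ := fun y => ∑ i, ‖φ1 y * v i y‖ₑ with hW
  set Γ : E3 → ℝ≥0∞ := fun y => ∑ i, ∑ j, ‖φ1 y * g i j y + pd j φ1 y * v i y‖ₑ with hΓ
  have W1 : ∀ i y, ‖φ1 y * v i y‖ₑ ≤ W y := fun i y =>
    Finset.single_le_sum (f := fun i => ‖φ1 y * v i y‖ₑ) (fun i _ => zero_le) (Finset.mem_univ i)
  have G1 : ∀ i j y, ‖φ1 y * g i j y + pd j φ1 y * v i y‖ₑ ≤ Γ y := fun i j y =>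
    (Finset.single_le_sum (f := fun j => ‖φ1 y * g i j y + pd j φ1 y * v i y‖ₑ) (fun j _ => zero_le) (Finset.mem_univ j)).trans
    (Finset.single_le_sum (f := fun i => ∑ j, ‖φ1 y * g i j y + pd j φ1 y * v i y‖ₑ) (fun j _ => zero_le) (Finset.mem_univ i))
  have tst : tsupport (tf φ ε x) ⊆ ball 0 (3/4*ρ) := by
    refine (closure_mono ?_).trans hφ.ts
    intro y hy
    simp only [Function.mem_support, tf] at hy ⊢
    exact right_ne_zero_of_mul hy
  have hρ : 0 < ρ := (hε.trans_le hεl).trans_le hlρ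
  have term : ∀ i j, ‖∫ y in ball 0 ρ, (v i y * v j y) * pd i (pd j (tf φ ε x)) y‖ₑ ≤
      ENNReal.ofReal (4 + 15 * M) * cv (fun z => ENNReal.ofReal (kf l z)) (fun y => W y * W y) x
      + ENNReal.ofReal (3 + 2 * M) * cv (fun z => ENNReal.ofReal (kn l z)) (fun y => 2 * (W y * Γ y)) x := by
    intro i j
    have zz : ∀ y, 3/4 * ρ ≤ ‖y‖ → pd i (pd j (tf φ ε x)) y = 0 := fun y hy =>
      off_pd ((tsupport_pd j).trans tst) i hy
    have e : ∫ y in ball 0 ρ, (v i y * v j y) * pd i (pd j (tf φ ε x)) y =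
        ∫ y, ((φ1 y * v i y) * (φ1 y * v j y)) * pd i (pd j (tf φ ε x)) y := by
      rw [set_int (fun y hy => by rw [zz y (by linarith), mul_zero])]
      refine integral_congr_ae (ae_of_all _ fun y => ?_)
      beta_reduce
      rcases lt_or_ge ‖y‖ (3/4*ρ) with hy | hy
      · rw [o1 y hy, one_mul, one_mul]
      · rw [zz y hy, mul_zero, mul_zero]
    rw [e]
    refine (R_bound hM hφ hε hεl hlρ (hw i) (hw j) hx i j).trans (add_le_add (mul_le_mul' le_rfl (cv_mono ?_ x))
      (mul_le_mul' le_rfl (cv_mono ?_ x)))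
    · intro y; exact mul_le_mul' (W1 i y) (W1 j y)
    · intro y
      rw [two_mul]
      refine add_le_add ?_ (mul_le_mul' (W1 i y) (G1 j i y))
      rw [mul_comm]; exact mul_le_mul' (W1 j y) (G1 i i y)
  refine (enorm_sum_le _ _).trans ?_
  refine (Finset.sum_le_sum fun i _ => (enorm_sum_le _ _).trans (Finset.sum_le_sum fun j _ => term i j)).trans (le_of_eq ?_)
  simp only [GG, Finset.sum_const, Finset.card_univ, Fintype.card_fin, smul_eq_mul, nsmul_eq_mul]
  push_cast; ring

lemma FT.L_osc (h : FT ρ v g P) {M b : ℝ} {φ : E3 → ℝ} (hM : 0 < M) (hρ : 0 < ρ) (hφ : Cut M ρ (1/2) b φ)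
    {ε μ : ℝ} (hε : 0 < ε) (hμ : μ ≤ ρ / 8) {x x' : E3} (hx : ‖x‖ < μ) (hx' : ‖x'‖ < μ) :
    ‖(∫ y in ball 0 ρ, P y * Hk φ ε x y) - ∫ y in ball 0 ρ, P y * Hk φ ε x' y‖ₑ ≤
      ENNReal.ofReal (4050 * M * μ / ρ ^ 4) * ∫⁻ y in ball 0 ρ, ‖P y‖ₑ := by
  rw [← integral_sub (h.intP (cont_Hk hφ.sm hε x)) (h.intP (cont_Hk hφ.sm hε x'))]
  refine (enorm_integral_le_lintegral_enorm _).trans ?_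
  rw [← lintegral_const_mul' _ _ ENNReal.ofReal_ne_top]
  refine lintegral_mono fun y => ?_
  rw [← mul_sub, enorm_mul, mul_comm, Real.enorm_eq_ofReal_abs (_ - _)]
  exact mul_le_mul' (ENNReal.ofReal_le_ofReal (Hk_lip hM hρ hφ hε hμ hx hx' y)) le_rfl

lemma FT.osc (h : FT ρ v g P) {M : ℝ} {φ φ1 : E3 → ℝ} (hM : 0 < M) (hφ : Cut M ρ (1/2) (3/4) φ) (s1 : Sm φ1)
    (ts1 : tsupport φ1 ⊆ ball 0 ρ) (o1 : ∀ x, ‖x‖ < 3/4 * ρ → φ1 x = 1)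
    {l μ : ℝ} (hl : 0 < l) (hlρ : l ≤ ρ) (hμ : μ ≤ ρ / 8) :
    ∀ᵐ x ∂(volume.restrict (ball (0:E3) μ)), ∀ᵐ x' ∂(volume.restrict (ball (0:E3) μ)),
      ENNReal.ofReal c0 * ‖P x - P x'‖ₑ ≤
      GG M l (fun y => ∑ i, ‖φ1 y * v i y‖ₑ) (fun y => ∑ i, ∑ j, ‖φ1 y * g i j y + pd j φ1 y * v i y‖ₑ) x
      + GG M l (fun y => ∑ i, ‖φ1 y * v i y‖ₑ) (fun y => ∑ i, ∑ j, ‖φ1 y * g i j y + pd j φ1 y * v i y‖ₑ) x'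
      + ENNReal.ofReal (4050 * M * μ / ρ ^ 4) * ∫⁻ y in ball 0 ρ, ‖P y‖ₑ := by
  set Φ := GG M l (fun y => ∑ i, ‖φ1 y * v i y‖ₑ) (fun y => ∑ i, ∑ j, ‖φ1 y * g i j y + pd j φ1 y * v i y‖ₑ) with hΦ
  have hρ : 0 < ρ := hl.trans_le hlρ
  have tsφ : tsupport φ ⊆ ball 0 ρ := hφ.ts.trans (ball_subset_ball (by linarith))
  have mf : Measurable fun y => φ y * P y := hφ.sm.continuous.measurable.mul h.mP
  have jf : Integrable fun y => φ y * P y := by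
    have i0 : IntegrableOn (fun y => φ y * P y) (ball 0 ρ) := by
      have := h.intP hφ.sm.continuous
      refine this.congr (ae_of_all _ fun y => ?_); ring
    refine (integrableOn_iff_integrable_of_support_subset ?_).1 i0
    intro y hy
    by_contra hc
    apply hy
    show φ y * P y = 0
    rw [off_ts tsφ (by simpa using hc), zero_mul]
  obtain ⟨e, e0, et0, ht⟩ := mol_ae mf jf
  have ev : ∀ᶠ n in atTop, e n ≤ l := (et0.eventually (ge_mem_nhds hl))
  have hφ1 : ∀ x, ‖x‖ < μ → φ x = 1 := fun x hx => hφ.one x (by linarith)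
  have aeB := ae_restrict_of_ae (s := ball (0:E3) μ) ht
  have inB : ∀ᵐ x ∂(volume.restrict (ball (0:E3) μ)), x ∈ ball (0:E3) μ := ae_restrict_mem measurableSet_ball
  filter_upwards [aeB, inB] with x hx hxB
  filter_upwards [aeB, inB] with x' hx' hxB'
  rw [mem_ball_zero_iff] at hxB hxB'
  rw [hφ1 x hxB, one_mul] at hx
  rw [hφ1 x' hxB', one_mul] at hx'
  have lim := (hx.sub hx').enorm
  rw [← mul_sub, enorm_mul, Real.enorm_eq_ofReal c0_pos.le] at lim
  refine le_of_tendsto lim ?_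
  filter_upwards [ev] with n hn
  rw [h.rep hφ.sm tsφ (e0 n), h.rep hφ.sm tsφ (e0 n)]
  have b1 := h.R_le hM hφ s1 ts1 o1 (e0 n) hn hlρ (x := x) (by linarith)
  have b2 := h.R_le hM hφ s1 ts1 o1 (e0 n) hn hlρ (x := x') (by linarith)
  have b3 := h.L_osc hM hρ hφ (e0 n) hμ hxB hxB'
  rw [← hΦ] at b1 b2
  set L1 := ∫ y in ball 0 ρ, P y * Hk φ (e n) x y
  set L2 := ∫ y in ball 0 ρ, P y * Hk φ (e n) x' y
  set R1 := ∑ i, ∑ j, ∫ y in ball 0 ρ, (v i y * v j y) * pd i (pd j (tf φ (e n) x)) y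
  set R2 := ∑ i, ∑ j, ∫ y in ball 0 ρ, (v i y * v j y) * pd i (pd j (tf φ (e n) x')) y
  rw [show L1 + R1 - (L2 + R2) = (R1 + -R2) + (L1 - L2) by ring]
  refine (enorm_add_le _ _).trans (add_le_add ((enorm_add_le _ _).trans (add_le_add b1 ?_)) b3)
  rw [enorm_neg]; exact b2

end NSD

end

section

namespace NSD

lemma jen {α : Type*} [MeasurableSpace α] (μ : Measure α) {f : α → ℝ≥0∞} (hf : AEMeasurable f μ) :
    (∫⁻ x, f x ∂μ) ^ (3/2:ℝ) ≤ μ univ ^ (1/2:ℝ) * ∫⁻ x, f x ^ (3/2:ℝ) ∂μ := by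
  have hpq : Real.HolderConjugate (3/2) 3 := Real.holderConjugate_iff.2 ⟨by norm_num, by norm_num⟩
  have := ENNReal.lintegral_mul_le_Lp_mul_Lq μ hpq hf (g := fun _ => 1) aemeasurable_const
  simp only [Pi.mul_apply, mul_one, ENNReal.one_rpow, lintegral_const, one_mul] at this
  refine (ENNReal.rpow_le_rpow this (by norm_num)).trans (le_of_eq ?_)
  rw [ENNReal.mul_rpow_of_nonneg _ _ (by norm_num), ← ENNReal.rpow_mul, ← ENNReal.rpow_mul]
  norm_num
  rw [mul_comm]

lemma p32_add (a b : ℝ≥0∞) : (a + b) ^ (3/2:ℝ) ≤ 2 * (a ^ (3/2:ℝ) + b ^ (3/2:ℝ)) := by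
  refine (ENNReal.rpow_add_le_mul_rpow_add_rpow a b (by norm_num : (1:ℝ) ≤ 3/2)).trans (mul_le_mul' ?_ le_rfl)
  calc (2:ℝ≥0∞) ^ ((3/2:ℝ) - 1) ≤ 2 ^ (1:ℝ) := ENNReal.rpow_le_rpow_of_exponent_le (by norm_num) (by norm_num)
    _ = 2 := by simp

lemma p32_add3 (a b c : ℝ≥0∞) : (a + b + c) ^ (3/2:ℝ) ≤ 4 * (a ^ (3/2:ℝ) + b ^ (3/2:ℝ) + c ^ (3/2:ℝ)) := by
  refine (p32_add _ _).trans ?_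
  calc _ ≤ 2 * (2 * (a ^ (3/2:ℝ) + b ^ (3/2:ℝ)) + 2 * c ^ (3/2:ℝ)) := by
        refine mul_le_mul' le_rfl (add_le_add (p32_add _ _) ?_)
        rw [two_mul]; exact le_self_add
    _ = _ := by ring

/-- from pairwise oscillation to mean oscillation -/
lemma mean_osc {B : Set E3} (V0 : volume B ≠ 0) (Vt : volume B ≠ ∞) {P : E3 → ℝ} (iP : Integrable P (volume.restrict B))
    {Φ : E3 → ℝ≥0∞} (mΦ : Measurable Φ) {K : ℝ≥0∞}
    (h : ∀ᵐ x ∂(volume.restrict B), ∀ᵐ x' ∂(volume.restrict B), ENNReal.ofReal c0 * ‖P x - P x'‖ₑ ≤ Φ x + Φ x' + K) :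
    ENNReal.ofReal (c0 ^ (3/2:ℝ)) * ∫⁻ x in B, ‖P x - ⨍ y in B, P y‖ₑ ^ (3/2:ℝ) ≤
      8 * (∫⁻ x in B, Φ x ^ (3/2:ℝ)) + 4 * volume B * K ^ (3/2:ℝ) := by
  set V := volume B with hV
  have cc : ENNReal.ofReal c0 ≠ ∞ := ENNReal.ofReal_ne_top
  set A := ∫⁻ x in B, Φ x with hA
  have key : ∀ᵐ x ∂(volume.restrict B), ENNReal.ofReal c0 * ‖P x - ⨍ y in B, P y‖ₑ ≤ Φ x + K + V⁻¹ * A := by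
    filter_upwards [h] with x hx
    have hc : Integrable (fun _ : E3 => P x) (volume.restrict B) := integrableOn_const Vt
    have h1 : V * ‖P x - ⨍ y in B, P y‖ₑ ≤ ∫⁻ y in B, ‖P x - P y‖ₑ := by
      refine le_trans (le_of_eq ?_) (enorm_integral_le_lintegral_enorm _)
      rw [integral_sub hc iP, setIntegral_const, setAverage_eq]
      have hV' : volume.real B ≠ 0 := by rw [Measure.real]; exact (ENNReal.toReal_pos V0 Vt).ne'
      have e : volume.real B • P x - ∫ y in B, P y = volume.real B • (P x - (volume.real B)⁻¹ • ∫ y in B, P y) := by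
        rw [smul_sub, smul_smul, mul_inv_cancel₀ hV', one_smul]
      rw [e, enorm_smul, Measure.real, Real.enorm_eq_ofReal ENNReal.toReal_nonneg, ENNReal.ofReal_toReal Vt]
    have h2 : V * (ENNReal.ofReal c0 * ‖P x - ⨍ y in B, P y‖ₑ) ≤ V * (Φ x + K + V⁻¹ * A) := by
      calc _ = ENNReal.ofReal c0 * (V * ‖P x - ⨍ y in B, P y‖ₑ) := by ring
        _ ≤ ENNReal.ofReal c0 * ∫⁻ y in B, ‖P x - P y‖ₑ := mul_le_mul' le_rfl h1
        _ = ∫⁻ y in B, ENNReal.ofReal c0 * ‖P x - P y‖ₑ := by rw [lintegral_const_mul' _ _ cc]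
        _ ≤ ∫⁻ y in B, ((Φ x + K) + Φ y) := lintegral_mono_ae (hx.mono fun y hy => hy.trans (le_of_eq (by ring)))
        _ = V * (Φ x + K + V⁻¹ * A) := by
          rw [lintegral_add_right _ mΦ, lintegral_const, Measure.restrict_apply_univ, mul_add, ← mul_assoc V V⁻¹,
            ENNReal.mul_inv_cancel V0 Vt, one_mul, mul_comm]
    exact (ENNReal.mul_le_mul_iff_right V0 Vt).1 h2
  have jA : V * (V⁻¹ * A) ^ (3/2:ℝ) ≤ ∫⁻ x in B, Φ x ^ (3/2:ℝ) := by
    have := jen (volume.restrict B) mΦ.aemeasurable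
    rw [Measure.restrict_apply_univ, ← hA, ← hV] at this
    rw [ENNReal.mul_rpow_of_nonneg _ _ (by norm_num)]
    refine (mul_le_mul' le_rfl (mul_le_mul' le_rfl this)).trans (le_of_eq ?_)
    rw [ENNReal.inv_rpow, ← ENNReal.rpow_neg, ← mul_assoc, ← mul_assoc]
    nth_rewrite 1 [← ENNReal.rpow_one V]
    rw [← ENNReal.rpow_add _ _ V0 Vt, ← ENNReal.rpow_add _ _ V0 Vt]
    norm_num
  have m1 : Measurable fun x => Φ x ^ (3/2:ℝ) := mΦ.pow_const _
  calc _ = ∫⁻ x in B, (ENNReal.ofReal c0 * ‖P x - ⨍ y in B, P y‖ₑ) ^ (3/2:ℝ) := by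
        rw [← lintegral_const_mul' _ _ ENNReal.ofReal_ne_top]
        refine lintegral_congr fun x => ?_
        rw [ENNReal.mul_rpow_of_nonneg _ _ (by norm_num), ENNReal.ofReal_rpow_of_pos c0_pos]
    _ ≤ ∫⁻ x in B, 4 * (Φ x ^ (3/2:ℝ) + (K ^ (3/2:ℝ) + (V⁻¹ * A) ^ (3/2:ℝ))) := by
        refine lintegral_mono_ae (key.mono fun x hx => ?_)
        refine (ENNReal.rpow_le_rpow hx (by norm_num)).trans ((p32_add3 _ _ _).trans (le_of_eq (by ring)))
    _ = 4 * ((∫⁻ x in B, Φ x ^ (3/2:ℝ)) + (K ^ (3/2:ℝ) + (V⁻¹ * A) ^ (3/2:ℝ)) * V) := by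
        rw [lintegral_const_mul' _ _ (by simp), lintegral_add_left m1, lintegral_const, Measure.restrict_apply_univ]
    _ = 4 * (∫⁻ x in B, Φ x ^ (3/2:ℝ)) + 4 * V * K ^ (3/2:ℝ) + 4 * (V * (V⁻¹ * A) ^ (3/2:ℝ)) := by ring
    _ ≤ 4 * (∫⁻ x in B, Φ x ^ (3/2:ℝ)) + 4 * V * K ^ (3/2:ℝ) + 4 * ∫⁻ x in B, Φ x ^ (3/2:ℝ) :=
        add_le_add le_rfl (mul_le_mul' le_rfl jA)
    _ = _ := by ring

lemma meas_GG (M l : ℝ) {W Γ : E3 → ℝ≥0∞} (hW : Measurable W) (hΓ : Measurable Γ) : Measurable (GG M l W Γ) := by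
  unfold GG
  exact (((meas_cv (meas_kf l).ennreal_ofReal (hW.mul hW)).const_mul _).add
    ((meas_cv (meas_kn l).ennreal_ofReal ((hW.mul hΓ).const_mul 2)).const_mul _)).const_mul _

/-- volume of the unit ball -/
def v1 : ℝ := (volume (ball (0:E3) 1)).toReal
lemma v1_pos : 0 < v1 := ENNReal.toReal_pos (measure_ball_pos _ _ one_pos).ne' measure_ball_lt_top.ne
lemma vol_ball {r : ℝ} (hr : 0 < r) : volume (ball (0:E3) r) = ENNReal.ofReal (v1 * r ^ 3) := by
  rw [Measure.addHaar_ball volume (0:E3) hr.le, v1, mul_comm, ENNReal.ofReal_mul ENNReal.toReal_nonneg,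
    ENNReal.ofReal_toReal measure_ball_lt_top.ne]
  simp [finrank_euclideanSpace]

lemma pterm {M ρ μ : ℝ} (hM : 0 < M) (hρ : 0 < ρ) (hμ : 0 < μ) {P : E3 → ℝ} (mP : Measurable P) :
    4 * volume (ball (0:E3) μ) * (ENNReal.ofReal (4050 * M * μ / ρ ^ 4) * ∫⁻ y in ball 0 ρ, ‖P y‖ₑ) ^ (3/2:ℝ)
      ≤ ENNReal.ofReal (4 * v1 ^ (3/2:ℝ) * (4050 * M) ^ (3/2:ℝ)) * ENNReal.ofReal (μ/ρ) ^ (9/2:ℝ) *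
        ∫⁻ y in ball 0 ρ, ‖P y‖ₑ ^ (3/2:ℝ) := by
  have := jen (volume.restrict (ball (0:E3) ρ)) (f := fun y => ‖P y‖ₑ) mP.enorm.aemeasurable
  rw [Measure.restrict_apply_univ] at this
  have v0 := v1_pos
  rw [ENNReal.mul_rpow_of_nonneg _ _ (by norm_num)]
  refine (mul_le_mul' le_rfl (mul_le_mul' le_rfl this)).trans (le_of_eq ?_)
  rw [← mul_assoc, ← mul_assoc]
  congr 1
  rw [vol_ball hμ, vol_ball hρ, ENNReal.ofReal_rpow_of_pos (by positivity), ENNReal.ofReal_rpow_of_pos (by positivity),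
    ENNReal.ofReal_rpow_of_pos (by positivity), show (4:ℝ≥0∞) = ENNReal.ofReal 4 by simp,
    ← ENNReal.ofReal_mul (by positivity), ← ENNReal.ofReal_mul (by positivity), ← ENNReal.ofReal_mul (by positivity),
    ← ENNReal.ofReal_mul (by positivity)]
  congr 1
  rw [Real.div_rpow (by positivity) (by positivity), Real.div_rpow (by positivity) (by positivity),
    Real.mul_rpow (x := 4050 * M) (by positivity) (by positivity), Real.mul_rpow (x := v1) (by positivity) (by positivity),
    ← Real.rpow_natCast ρ 4, ← Real.rpow_natCast ρ 3, ← Real.rpow_mul hρ.le, ← Real.rpow_mul hρ.le]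
  have e1 : v1 * v1 ^ (1/2:ℝ) = v1 ^ (3/2:ℝ) := by
    nth_rewrite 1 [← Real.rpow_one v1]; rw [← Real.rpow_add v0]; norm_num
  have e2 : μ ^ 3 * μ ^ (3/2:ℝ) = μ ^ (9/2:ℝ) := by
    rw [← Real.rpow_natCast, ← Real.rpow_add hμ]; norm_num
  have e3 : ρ ^ (((3:ℕ):ℝ) * (1/2)) / ρ ^ (((4:ℕ):ℝ) * (3/2)) = 1 / ρ ^ (9/2:ℝ) := by
    rw [← Real.rpow_sub hρ, one_div (ρ ^ (9/2:ℝ)), ← Real.rpow_neg hρ.le]; norm_num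
  rw [← e1, ← e2]
  calc _ = 4 * (v1 * v1 ^ (1/2:ℝ)) * (4050 * M) ^ (3/2:ℝ) * (μ ^ 3 * μ ^ (3/2:ℝ)) * (ρ ^ (((3:ℕ):ℝ) * (1/2)) / ρ ^ (((4:ℕ):ℝ) * (3/2))) := by ring
    _ = _ := by rw [e3]; ring

variable {ρ : ℝ} {v : Fin 3 → E3 → ℝ} {g : Fin 3 → Fin 3 → E3 → ℝ} {P : E3 → ℝ}

lemma FT.press (h : FT ρ v g P) {M : ℝ} {φ φ1 : E3 → ℝ} (hM : 0 < M) (hφ : Cut M ρ (1/2) (3/4) φ) (s1 : Sm φ1)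
    (ts1 : tsupport φ1 ⊆ ball 0 ρ) (o1 : ∀ x, ‖x‖ < 3/4 * ρ → φ1 x = 1)
    {l μ : ℝ} (hl : 0 < l) (hlρ : l ≤ ρ) (hμ0 : 0 < μ) (hμ : μ ≤ ρ / 8) :
    ENNReal.ofReal (c0 ^ (3/2:ℝ)) * ∫⁻ x in ball 0 μ, ‖P x - ⨍ y in ball 0 μ, P y‖ₑ ^ (3/2:ℝ) ≤
      8 * (∫⁻ x, GG M l (fun y => ∑ i, ‖φ1 y * v i y‖ₑ) (fun y => ∑ i, ∑ j, ‖φ1 y * g i j y + pd j φ1 y * v i y‖ₑ) x ^ (3/2:ℝ))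
      + ENNReal.ofReal (4 * v1 ^ (3/2:ℝ) * (4050 * M) ^ (3/2:ℝ)) * ENNReal.ofReal (μ/ρ) ^ (9/2:ℝ) *
        ∫⁻ y in ball 0 ρ, ‖P y‖ₑ ^ (3/2:ℝ) := by
  have hρ : 0 < ρ := hl.trans_le hlρ
  have mG := meas_GG M l (W := fun y => ∑ i, ‖φ1 y * v i y‖ₑ) (Γ := fun y => ∑ i, ∑ j, ‖φ1 y * g i j y + pd j φ1 y * v i y‖ₑ)
    (Finset.measurable_sum _ fun i _ => (s1.continuous.measurable.mul (h.lwd i).mv).enorm)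
    (Finset.measurable_sum _ fun i _ => Finset.measurable_sum _ fun j _ =>
      ((s1.continuous.measurable.mul ((h.lwd i).mg j)).add ((s1.pd j).continuous.measurable.mul (h.lwd i).mv)).enorm)
  have iP : Integrable P (volume.restrict (ball 0 μ)) :=
    h.iP.mono_measure (Measure.restrict_mono (ball_subset_ball (by linarith)) le_rfl)
  refine (mean_osc (measure_ball_pos _ _ hμ0).ne' measure_ball_lt_top.ne iP mG (h.osc hM hφ s1 ts1 o1 hl hlρ hμ)).trans
    (add_le_add (mul_le_mul' le_rfl (setLIntegral_le_lintegral _ _)) (pterm hM hρ hμ0 h.mP))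

end NSD

end

section

namespace NSD

lemma GG_zero (M l : ℝ) {W Γ : E3 → ℝ≥0∞} (h : ∀ᵐ y, W y = 0) (x : E3) : GG M l W Γ x = 0 := by
  have h1 : cv (fun z => ENNReal.ofReal (kf l z)) (fun y => W y * W y) x = 0 := by
    unfold cv
    rw [lintegral_congr_ae (g := fun _ => 0) (h.mono fun y hy => by simp [hy])]; simp
  have h2 : cv (fun z => ENNReal.ofReal (kn l z)) (fun y => 2 * (W y * Γ y)) x = 0 := by
    unfold cv
    rw [lintegral_congr_ae (g := fun _ => 0) (h.mono fun y hy => by simp [hy])]; simp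
  simp [GG, h1, h2]

/-- Hölder for the near part -/
lemma near_holder {W Γ : E3 → ℝ≥0∞} (hW : Measurable W) (hΓ : Measurable Γ) :
    ∫⁻ y, (W y * Γ y) ^ (3/2:ℝ) ≤ (∫⁻ y, W y ^ (6:ℝ)) ^ (1/4:ℝ) * (∫⁻ y, Γ y ^ (2:ℝ)) ^ (3/4:ℝ) := by
  have hpq : Real.HolderConjugate 4 (4/3) := Real.holderConjugate_iff.2 ⟨by norm_num, by norm_num⟩
  have := ENNReal.lintegral_mul_le_Lp_mul_Lq volume hpq (hW.pow_const (3/2:ℝ)).aemeasurable (hΓ.pow_const (3/2:ℝ)).aemeasurable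
  simp only [Pi.mul_apply, ← ENNReal.rpow_mul] at this
  norm_num at this
  calc _ = ∫⁻ y, W y ^ (3/2:ℝ) * Γ y ^ (3/2:ℝ) := by
        refine lintegral_congr fun y => ENNReal.mul_rpow_of_nonneg _ _ (by norm_num)
    _ ≤ _ := by refine this.trans (le_of_eq ?_); norm_num

lemma GG_est {M θ r m : ℝ} (hM : 0 < M) (hθ : 0 < θ) (hθ2 : θ ≤ 1/2) (hr : r = 3 * (1 - θ)/(1 - θ/2)) (hm : m = θ/(1 - θ)) :
    ∃ C : ℝ, 0 < C ∧ ∀ l : ℝ, 0 < l → ∀ W Γ : E3 → ℝ≥0∞, Measurable W → Measurable Γ →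
      ∫⁻ x, GG M l W Γ x ^ (3/2:ℝ) ≤ ENNReal.ofReal C * (ENNReal.ofReal (l ^ (-(3/2 * m))) * (∫⁻ y, W y ^ r) ^ (3/r)
        + ENNReal.ofReal (l ^ (3/2:ℝ)) * ((∫⁻ y, W y ^ (6:ℝ)) ^ (1/4:ℝ) * (∫⁻ y, Γ y ^ (2:ℝ)) ^ (3/4:ℝ))) := by
  have t1 : 0 < 1 - θ := by linarith
  have t2 : 0 < 1 - θ/2 := by linarith
  have r0 : 0 < r := by rw [hr]; positivity
  have r3 : r ≤ 3 := by rw [hr, div_le_iff₀ t2]; linarith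
  have hri : 1 / r = (1 - θ/2)/(3 * (1 - θ)) := by rw [hr, one_div_div]
  set s : ℝ := (5/3 - 2/r)⁻¹ with hs
  have hsi : 1 / s = 5/3 - 2/r := by rw [hs, one_div, inv_inv]
  have hsi2 : 1 / s = 1 - θ/(3 * (1 - θ)) := by
    rw [hsi, show 2/r = 2 * (1/r) by ring, hri]; field_simp; ring
  have b1 : θ/(3 * (1 - θ)) ≤ 1/3 := by rw [div_le_iff₀ (by positivity)]; linarith
  have b2 : 0 < θ/(3 * (1 - θ)) := by positivity
  have s0 : 0 < s := by
    have : 0 < 1/s := by rw [hsi2]; linarith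
    exact one_div_pos.1 this
  have s1 : 1 < s := by
    have : 1/s < 1 := by rw [hsi2]; linarith
    rwa [div_lt_one s0] at this
  have s2 : s ≤ 3/2 := by
    have : 2/3 ≤ 1/s := by rw [hsi2]; linarith
    rw [le_div_iff₀ s0] at this; linarith
  obtain ⟨C1, C10, h1⟩ := kf_int s1
  obtain ⟨C2, C20, h2⟩ := kn_int
  set a1 := (9 * (4 + 15 * M)) ^ (3/2:ℝ) * C1 ^ (3/2/s) with ha1
  set a2 := (9 * (3 + 2 * M) * 2) ^ (3/2:ℝ) * C2 ^ (3/2:ℝ) with ha2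
  have a10 : 0 < a1 := by positivity
  have a20 : 0 < a2 := by positivity
  refine ⟨2 * (a1 + a2), by positivity, fun l hl W Γ hW hΓ => ?_⟩
  have mkf : Measurable fun z => ENNReal.ofReal (kf l z) := (meas_kf l).ennreal_ofReal
  have mkn : Measurable fun z => ENNReal.ofReal (kn l z) := (meas_kn l).ennreal_ofReal
  set X1 := cv (fun z => ENNReal.ofReal (kf l z)) (fun y => W y * W y) with hX1
  set X2 := cv (fun z => ENNReal.ofReal (kn l z)) (fun y => 2 * (W y * Γ y)) with hX2
  have mX1 : Measurable X1 := meas_cv mkf (hW.mul hW)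
  have mX2 : Measurable X2 := meas_cv mkn ((hW.mul hΓ).const_mul 2)
  have e1 : ∫⁻ x, X1 x ^ (3/2:ℝ) ≤ ENNReal.ofReal (C1 ^ (3/2/s) * l ^ (-(3/2*m))) * (∫⁻ y, W y ^ r) ^ (3/r) := by
    have hy := young (a := r/2) (s := s) (b := 3/2) (by positivity) s0 (by norm_num) (by linarith) s2
      (by rw [one_div_div, hsi]; ring) mkf (hW.mul hW)
    refine hy.trans (mul_le_mul' ?_ (le_of_eq ?_))
    · refine (ENNReal.rpow_le_rpow (h1 l hl) (by positivity)).trans (le_of_eq ?_)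
      rw [ENNReal.ofReal_rpow_of_pos (by positivity)]
      congr 1
      rw [Real.mul_rpow (by positivity) (by positivity), ← Real.rpow_mul hl.le]
      congr 2
      have : (3 - 3 * s) * (3/2/s) = 9/2 * (1/s - 1) := by field_simp; ring
      rw [this, hsi2, hm]; field_simp; ring
    · congr 1
      · refine lintegral_congr fun y => ?_
        simp only [Pi.mul_apply]
        rw [← sq, ← ENNReal.rpow_natCast, ← ENNReal.rpow_mul]; congr 1; push_cast; ring
      · field_simp
  have e2 : ∫⁻ x, X2 x ^ (3/2:ℝ) ≤ ENNReal.ofReal (2 ^ (3/2:ℝ) * C2 ^ (3/2:ℝ) * l ^ (3/2:ℝ)) *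
      ((∫⁻ y, W y ^ (6:ℝ)) ^ (1/4:ℝ) * (∫⁻ y, Γ y ^ (2:ℝ)) ^ (3/4:ℝ)) := by
    have hy := young (a := 3/2) (s := 1) (b := 3/2) (by norm_num) one_pos (by norm_num) le_rfl (by norm_num)
      (by norm_num) mkn ((hW.mul hΓ).const_mul 2)
    simp only [ENNReal.rpow_one, div_one] at hy
    have k2 : (∫⁻ x, ENNReal.ofReal (kn l x)) ^ (3/2:ℝ) ≤ ENNReal.ofReal (C2 ^ (3/2:ℝ) * l ^ (3/2:ℝ)) := by
      refine (ENNReal.rpow_le_rpow (h2 l hl) (by norm_num)).trans (le_of_eq ?_)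
      rw [ENNReal.ofReal_rpow_of_pos (by positivity), Real.mul_rpow C20.le hl.le]
    have k3 : (∫⁻ x, (2 * (W x * Γ x)) ^ (3/2:ℝ)) ≤ ENNReal.ofReal (2 ^ (3/2:ℝ)) *
      ((∫⁻ y, W y ^ (6:ℝ)) ^ (1/4:ℝ) * (∫⁻ y, Γ y ^ (2:ℝ)) ^ (3/4:ℝ)) := by
      refine le_trans (le_of_eq ?_) (mul_le_mul' le_rfl (near_holder hW hΓ))
      rw [← lintegral_const_mul' _ _ ENNReal.ofReal_ne_top]
      refine lintegral_congr fun y => ?_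
      rw [ENNReal.mul_rpow_of_nonneg _ _ (by norm_num), ← ENNReal.ofReal_rpow_of_pos (by norm_num)]
      simp
    have hy' : ∫⁻ x, X2 x ^ (3/2:ℝ) ≤ (∫⁻ x, ENNReal.ofReal (kn l x)) ^ (3/2:ℝ) * ∫⁻ x, (2 * (W x * Γ x)) ^ (3/2:ℝ) := by
      refine hy.trans (le_of_eq ?_)
      rw [div_self (by norm_num : (3/2:ℝ) ≠ 0), ENNReal.rpow_one]; rfl
    refine hy'.trans ((mul_le_mul' k2 k3).trans (le_of_eq ?_))
    rw [← mul_assoc, ← ENNReal.ofReal_mul (by positivity)]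
    congr 2; ring
  have pt : ∀ x, GG M l W Γ x ^ (3/2:ℝ) ≤ 2 * (ENNReal.ofReal ((9 * (4 + 15 * M)) ^ (3/2:ℝ)) * X1 x ^ (3/2:ℝ)
      + ENNReal.ofReal ((9 * (3 + 2 * M)) ^ (3/2:ℝ)) * X2 x ^ (3/2:ℝ)) := by
    intro x
    have e : GG M l W Γ x = ENNReal.ofReal (9 * (4 + 15 * M)) * X1 x + ENNReal.ofReal (9 * (3 + 2 * M)) * X2 x := by
      unfold GG
      rw [ENNReal.ofReal_mul (p := 9) (by norm_num), ENNReal.ofReal_mul (p := 9) (by norm_num), mul_add]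
      simp only [ENNReal.ofReal_ofNat, mul_assoc]; rfl
    rw [e]
    refine (p32_add _ _).trans (le_of_eq ?_)
    rw [ENNReal.mul_rpow_of_nonneg _ _ (by norm_num), ENNReal.mul_rpow_of_nonneg _ _ (by norm_num),
      ENNReal.ofReal_rpow_of_pos (by positivity), ENNReal.ofReal_rpow_of_pos (by positivity)]
  refine (lintegral_mono pt).trans ?_
  have mm : Measurable fun x => ENNReal.ofReal ((9 * (4 + 15 * M)) ^ (3/2:ℝ)) * X1 x ^ (3/2:ℝ) := (mX1.pow_const _).const_mul _
  rw [lintegral_const_mul' _ _ (by simp), lintegral_add_left mm, lintegral_const_mul' _ _ ENNReal.ofReal_ne_top,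
    lintegral_const_mul' _ _ ENNReal.ofReal_ne_top]
  set Y := (∫⁻ y, W y ^ r) ^ (3/r)
  set Z := (∫⁻ y, W y ^ (6:ℝ)) ^ (1/4:ℝ) * (∫⁻ y, Γ y ^ (2:ℝ)) ^ (3/4:ℝ)
  clear_value Y Z
  calc _ ≤ 2 * (ENNReal.ofReal ((9 * (4 + 15 * M)) ^ (3/2:ℝ)) * (ENNReal.ofReal (C1 ^ (3/2/s) * l ^ (-(3/2*m))) * Y)
        + ENNReal.ofReal ((9 * (3 + 2 * M)) ^ (3/2:ℝ)) * (ENNReal.ofReal (2 ^ (3/2:ℝ) * C2 ^ (3/2:ℝ) * l ^ (3/2:ℝ)) * Z)) :=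
        mul_le_mul' le_rfl (add_le_add (mul_le_mul' le_rfl e1) (mul_le_mul' le_rfl e2))
    _ = 2 * (ENNReal.ofReal a1 * (ENNReal.ofReal (l ^ (-(3/2*m))) * Y) + ENNReal.ofReal a2 * (ENNReal.ofReal (l ^ (3/2:ℝ)) * Z)) := by
        have R : ∀ (c d c' d' : ℝ) (X : ℝ≥0∞), 0 ≤ c → 0 ≤ c' → c * d = c' * d' →
            ENNReal.ofReal c * (ENNReal.ofReal d * X) = ENNReal.ofReal c' * (ENNReal.ofReal d' * X) := by
          intro c d c' d' X hc hc' h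
          rw [← mul_assoc, ← mul_assoc, ← ENNReal.ofReal_mul hc, ← ENNReal.ofReal_mul hc', h]
        congr 2
        · exact R _ _ _ _ _ (by positivity) (by positivity) (by rw [ha1]; ring)
        · refine R _ _ _ _ _ (by positivity) (by positivity) ?_
          rw [ha2, Real.mul_rpow (y := 2) (by positivity) (by norm_num)]; ring
    _ ≤ 2 * (ENNReal.ofReal (a1 + a2) * (ENNReal.ofReal (l ^ (-(3/2*m))) * Y) + ENNReal.ofReal (a1 + a2) * (ENNReal.ofReal (l ^ (3/2:ℝ)) * Z)) := by
        refine mul_le_mul' le_rfl (add_le_add (mul_le_mul' (ENNReal.ofReal_le_ofReal (by linarith)) le_rfl)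
          (mul_le_mul' (ENNReal.ofReal_le_ofReal (by linarith)) le_rfl))
    _ = _ := by
        rw [ENNReal.ofReal_mul (p := 2) (by norm_num)]; simp only [ENNReal.ofReal_ofNat]; ring

/-- optimisation in the splitting radius -/
lemma opt {θ m C D : ℝ} (hθ : 0 < θ) (hθ2 : θ ≤ 1/2) (hm : m = θ/(1 - θ)) (hC : 0 < C) (hD : 0 < D) :
    ∃ K : ℝ, 0 < K ∧ ∀ (ρ y b : ℝ), 0 < ρ → 0 < y → 0 < b → y ≤ D * (ρ ^ (3/2/(1-θ)) * b) → ∃ l, 0 < l ∧ l ≤ ρ ∧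
      C * (l ^ (-(3/2*m)) * y + l ^ (3/2:ℝ) * b) ≤ K * (y ^ (1 - θ) * b ^ θ) := by
  have t1 : 0 < 1 - θ := by linarith
  refine ⟨C * (D ^ θ + D ^ (-(1-θ))), by positivity, fun ρ y b hρ hy hb h => ?_⟩
  set q := y / (D * b) with hq
  have q0 : 0 < q := by positivity
  refine ⟨q ^ (2/3*(1-θ)), by positivity, ?_, ?_⟩
  · have : q ≤ ρ ^ (3/2/(1-θ)) := by rw [hq, div_le_iff₀ (by positivity)]; linarith
    calc q ^ (2/3*(1-θ)) ≤ (ρ ^ (3/2/(1-θ))) ^ (2/3*(1-θ)) := by gcongr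
      _ = ρ := by
        rw [← Real.rpow_mul hρ.le]
        have : 3/2/(1-θ) * (2/3*(1-θ)) = 1 := by field_simp
        rw [this, Real.rpow_one]
  · rw [← Real.rpow_mul q0.le, ← Real.rpow_mul q0.le]
    have e1 : 2/3*(1-θ) * -(3/2*m) = -θ := by rw [hm]; field_simp
    have e2 : 2/3*(1-θ) * (3/2) = 1 - θ := by ring
    rw [e1, e2]
    have f1 : q ^ (-θ) * y = D ^ θ * (y ^ (1-θ) * b ^ θ) := by
      rw [hq, Real.div_rpow hy.le (by positivity), Real.mul_rpow hD.le hb.le, Real.rpow_neg hy.le, Real.rpow_neg hD.le, Real.rpow_neg hb.le,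
        Real.rpow_sub hy, Real.rpow_one]
      field_simp
    have f2 : q ^ (1-θ) * b = D ^ (-(1-θ)) * (y ^ (1-θ) * b ^ θ) := by
      rw [hq, Real.div_rpow hy.le (by positivity), Real.mul_rpow hD.le hb.le, Real.rpow_neg hD.le]
      have : b = b ^ (1-θ) * b ^ θ := by rw [← Real.rpow_add hb]; simp
      nth_rewrite 2 [this]
      field_simp
    rw [f1, f2]
    apply le_of_eq; ring

end NSD

end

section

namespace NSD

lemma supp_holder {W : E3 → ℝ≥0∞} (hW : Measurable W) {ρ r : ℝ} (hρ : 0 < ρ) (hr : 0 < r) (hr6 : r < 6)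
    (hs : ∀ x, ρ ≤ ‖x‖ → W x = 0) :
    ∫⁻ y, W y ^ r ≤ (∫⁻ y, W y ^ (6:ℝ)) ^ (r/6) * ENNReal.ofReal (v1 * ρ ^ 3) ^ (1 - r/6) := by
  have hpq : Real.HolderConjugate (6/r) (1 - r/6)⁻¹ := by
    refine Real.holderConjugate_iff.2 ⟨by rw [lt_div_iff₀ hr]; linarith, ?_⟩
    rw [inv_inv, inv_div]; ring
  have h := ENNReal.lintegral_mul_le_Lp_mul_Lq volume hpq (hW.pow_const r).aemeasurable
    ((measurable_const (a := (1:ℝ≥0∞))).indicator (measurableSet_ball (x := (0:E3)) (ε := ρ))).aemeasurable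
  have p0 : 0 < (1 - r/6)⁻¹ := by apply inv_pos.2; linarith
  have e2 : ∫⁻ x, (ball (0:E3) ρ).indicator (fun _ => (1:ℝ≥0∞)) x ^ (1 - r/6)⁻¹ = ENNReal.ofReal (v1 * ρ ^ 3) := by
    rw [← vol_ball hρ, ← lintegral_indicator_one measurableSet_ball]
    refine lintegral_congr fun x => ?_
    by_cases hx : x ∈ ball (0:E3) ρ
    · simp [hx]
    · rw [indicator_of_notMem hx, indicator_of_notMem hx, ENNReal.zero_rpow_of_pos p0]
  rw [e2] at h
  calc ∫⁻ y, W y ^ r = ∫⁻ y, ((fun y => W y ^ r) * (ball (0:E3) ρ).indicator fun _ => (1:ℝ≥0∞)) y := by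
        refine lintegral_congr fun y => ?_
        simp only [Pi.mul_apply]
        by_cases hx : y ∈ ball (0:E3) ρ
        · simp [hx]
        · rw [hs y (by simpa using hx), ENNReal.zero_rpow_of_pos hr, zero_mul]
    _ ≤ _ := h
    _ = _ := by
        congr 1
        · congr 1
          · refine lintegral_congr fun y => ?_
            rw [← ENNReal.rpow_mul]; congr 1; field_simp
          · field_simp
        · congr 1; rw [one_div, inv_inv]

lemma core {M θ r D6 D2 : ℝ} (hM : 0 < M) (hθ : 0 < θ) (hθ2 : θ ≤ 1/2) (hr : r = 3 * (1 - θ)/(1 - θ/2))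
    (h6 : 0 < D6) (h2 : 0 < D2) :
    ∃ K : ℝ, 0 < K ∧ ∀ (ρ B : ℝ) (W Γ : E3 → ℝ≥0∞), 0 < ρ → 0 < B → Measurable W → Measurable Γ →
      (∀ x, ρ ≤ ‖x‖ → W x = 0) → ∫⁻ y, W y ^ (6:ℝ) ≤ ENNReal.ofReal (D6 * B ^ (6:ℝ)) →
      ∫⁻ y, Γ y ^ (2:ℝ) ≤ ENNReal.ofReal (D2 * B ^ (2:ℝ)) →
      ∃ l, 0 < l ∧ l ≤ ρ ∧ ∫⁻ x, GG M l W Γ x ^ (3/2:ℝ) ≤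
        ENNReal.ofReal K * ((∫⁻ y, W y ^ r) ^ (1 - θ/2) * ENNReal.ofReal (B ^ (3 * θ))) := by
  have t1 : 0 < 1 - θ := by linarith
  have t2 : 0 < 1 - θ/2 := by linarith
  have r0 : 0 < r := by rw [hr]; positivity
  have r3 : r ≤ 3 := by rw [hr, div_le_iff₀ t2]; linarith
  have hri : 1 / r = (1 - θ/2)/(3 * (1 - θ)) := by rw [hr, one_div_div]
  obtain ⟨C, C0, hG⟩ := GG_est hM hθ hθ2 hr rfl
  set d := D6 ^ (1/4:ℝ) * D2 ^ (3/4:ℝ) with hd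
  have d0 : 0 < d := by positivity
  set D := D6 ^ (1/2:ℝ) * v1 ^ (3/r - 1/2) / d with hD
  have v0 := v1_pos
  have D0 : 0 < D := by positivity
  obtain ⟨K, K0, hK⟩ := opt hθ hθ2 rfl C0 D0
  refine ⟨K * d ^ θ, by positivity, fun ρ B W Γ hρ hB hW hΓ hs w6 g2 => ?_⟩
  by_cases hz : ∫⁻ y, W y ^ r = 0
  · refine ⟨ρ, hρ, le_rfl, ?_⟩
    rw [lintegral_eq_zero_iff (hW.pow_const r)] at hz
    have : ∀ᵐ y, W y = 0 := hz.mono fun y hy => by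
      simp only [Pi.zero_apply] at hy
      rcases ENNReal.rpow_eq_zero_iff.1 hy with h | h
      · exact h.1
      · linarith [h.2]
    have z := GG_zero M ρ (Γ := Γ) this
    simp [z]
  have yle : (∫⁻ y, W y ^ r) ^ (3/r) ≤ ENNReal.ofReal (D * (ρ ^ (3/2/(1-θ)) * (d * B ^ (3:ℝ)))) := by
    refine (ENNReal.rpow_le_rpow (supp_holder hW hρ r0 (by linarith) hs) (by positivity)).trans ?_
    rw [ENNReal.mul_rpow_of_nonneg _ _ (by positivity), ← ENNReal.rpow_mul, ← ENNReal.rpow_mul]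
    have x1 : r/6*(3/r) = 1/2 := by field_simp; norm_num
    have x2 : (1 - r/6)*(3/r) = 3/r - 1/2 := by field_simp; ring
    have x3 : 3 * (3/r - 1/2) = 3/2/(1-θ) := by
      rw [show 3/r = 3 * (1/r) by ring, hri]; field_simp; ring
    rw [x1, x2]
    refine (mul_le_mul' (ENNReal.rpow_le_rpow w6 (by norm_num)) le_rfl).trans (le_of_eq ?_)
    rw [ENNReal.ofReal_rpow_of_pos (by positivity), ENNReal.ofReal_rpow_of_pos (by positivity), ← ENNReal.ofReal_mul (by positivity)]
    congr 1
    rw [Real.mul_rpow (by positivity) (by positivity), Real.mul_rpow (by positivity) (by positivity), ← Real.rpow_mul hB.le,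
      ← Real.rpow_natCast ρ, ← Real.rpow_mul hρ.le]
    push_cast
    rw [x3, hD]
    norm_num
    field_simp
  have ytop : (∫⁻ y, W y ^ r) ^ (3/r) ≠ ∞ := ne_top_of_le_ne_top ENNReal.ofReal_ne_top yle
  have yz : (∫⁻ y, W y ^ r) ^ (3/r) ≠ 0 := by
    intro h
    rcases ENNReal.rpow_eq_zero_iff.1 h with h | h
    · exact hz h.1
    · have : 0 < 3/r := by positivity
      linarith [h.2]
  set Y := (∫⁻ y, W y ^ r) ^ (3/r) with hY
  set y := Y.toReal with hy
  have y0 : 0 < y := ENNReal.toReal_pos yz ytop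
  have ey : Y = ENNReal.ofReal y := (ENNReal.ofReal_toReal ytop).symm
  have yle' : y ≤ D * (ρ ^ (3/2/(1-θ)) * (d * B ^ (3:ℝ))) := by
    rw [ey, ENNReal.ofReal_le_ofReal_iff (by positivity)] at yle; exact yle
  obtain ⟨l, l0, lρ, hl⟩ := hK ρ y (d * B ^ (3:ℝ)) hρ y0 (by positivity) yle'
  refine ⟨l, l0, lρ, (hG l l0 W Γ hW hΓ).trans ?_⟩
  have zz : (∫⁻ y, W y ^ (6:ℝ)) ^ (1/4:ℝ) * (∫⁻ y, Γ y ^ (2:ℝ)) ^ (3/4:ℝ) ≤ ENNReal.ofReal (d * B ^ (3:ℝ)) := by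
    refine (mul_le_mul' (ENNReal.rpow_le_rpow w6 (by norm_num)) (ENNReal.rpow_le_rpow g2 (by norm_num))).trans (le_of_eq ?_)
    rw [ENNReal.ofReal_rpow_of_pos (by positivity), ENNReal.ofReal_rpow_of_pos (by positivity), ← ENNReal.ofReal_mul (by positivity)]
    congr 1
    rw [Real.mul_rpow (by positivity) (by positivity), Real.mul_rpow (by positivity) (by positivity), ← Real.rpow_mul hB.le, ← Real.rpow_mul hB.le]
    have : B ^ (3:ℝ) = B ^ (6 * (1/4:ℝ)) * B ^ (2 * (3/4:ℝ)) := by rw [← Real.rpow_add hB]; norm_num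
    rw [this, hd]; ring
  have eY : (∫⁻ y, W y ^ r) ^ (1 - θ/2) = ENNReal.ofReal (y ^ (1 - θ)) := by
    rw [← ENNReal.ofReal_rpow_of_pos y0, ← ey, hY, ← ENNReal.rpow_mul]
    congr 1
    rw [show 3/r = 3 * (1/r) by ring, hri]; field_simp
  rw [eY, ← hY, ey]
  calc _ ≤ ENNReal.ofReal C * (ENNReal.ofReal (l ^ (-(3/2 * (θ/(1-θ))))) * ENNReal.ofReal y + ENNReal.ofReal (l ^ (3/2:ℝ)) * ENNReal.ofReal (d * B ^ (3:ℝ))) :=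
        mul_le_mul' le_rfl (add_le_add le_rfl (mul_le_mul' le_rfl zz))
    _ = ENNReal.ofReal (C * (l ^ (-(3/2 * (θ/(1-θ)))) * y + l ^ (3/2:ℝ) * (d * B ^ (3:ℝ)))) := by
        rw [← ENNReal.ofReal_mul (by positivity), ← ENNReal.ofReal_mul (by positivity), ← ENNReal.ofReal_add (by positivity) (by positivity),
          ← ENNReal.ofReal_mul (by positivity)]
    _ ≤ ENNReal.ofReal (K * (y ^ (1 - θ) * (d * B ^ (3:ℝ)) ^ θ)) := ENNReal.ofReal_le_ofReal hl
    _ = _ := by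
        rw [← ENNReal.ofReal_mul (by positivity), ← ENNReal.ofReal_mul (by positivity)]
        congr 1
        rw [Real.mul_rpow (by positivity) (by positivity), ← Real.rpow_mul hB.le]; ring

lemma pow_sum3 (f : Fin 3 → ℝ≥0∞) {r : ℝ} (hr : 0 ≤ r) : (∑ i, f i) ^ r ≤ 3 ^ r * ∑ i, f i ^ r := by
  obtain ⟨k, hk⟩ := Finite.exists_max f
  calc (∑ i, f i) ^ r ≤ (3 * f k) ^ r := by
        refine ENNReal.rpow_le_rpow ?_ hr
        refine (Finset.sum_le_sum fun i _ => hk i).trans (le_of_eq ?_)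
        simp
    _ = 3 ^ r * f k ^ r := ENNReal.mul_rpow_of_nonneg _ _ hr
    _ ≤ _ := mul_le_mul' le_rfl (Finset.single_le_sum (f := fun i => f i ^ r) (fun i _ => zero_le) (Finset.mem_univ k))

lemma lint_pow_sum3 {f : Fin 3 → E3 → ℝ≥0∞} (hf : ∀ i, Measurable (f i)) {r : ℝ} (hr : 0 ≤ r) :
    ∫⁻ x, (∑ i, f i x) ^ r ≤ 3 ^ r * ∑ i, ∫⁻ x, f i x ^ r := by
  refine (lintegral_mono fun x => pow_sum3 (fun i => f i x) hr).trans (le_of_eq ?_)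
  rw [lintegral_const_mul' _ _ (by simp), lintegral_finsetSum _ fun i _ => (hf i).pow_const r]

lemma aN_666 {F : E3 → ℝ≥0∞} (hF : Measurable F) : aN 6 6 6 F = (∫⁻ x, F x ^ (6:ℝ)) ^ (1/6:ℝ) := by
  rw [lint_E3 (hF.pow_const _)]
  unfold aN aC
  simp

end NSD

end

section

namespace NSD

variable {ρ : ℝ} {v : Fin 3 → E3 → ℝ} {g : Fin 3 → Fin 3 → E3 → ℝ} {P : E3 → ℝ}

lemma lint_le_ball {F H : E3 → ℝ≥0∞} {ρ : ℝ} (h0 : ∀ x, ρ ≤ ‖x‖ → F x = 0) (h : ∀ x, F x ≤ H x) :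
    ∫⁻ x, F x ≤ ∫⁻ x in ball (0:E3) ρ, H x := by
  rw [← lintegral_indicator measurableSet_ball]
  refine lintegral_mono fun x => ?_
  by_cases hx : x ∈ ball (0:E3) ρ
  · rw [indicator_of_mem hx]; exact h x
  · rw [h0 x (by simpa using hx)]; exact zero_le

lemma sq_add_le (a b : ℝ≥0∞) : (a + b) ^ 2 ≤ 2 * a ^ 2 + 2 * b ^ 2 := by
  have := ENNReal.rpow_add_le_mul_rpow_add_rpow a b (p := 2) (by norm_num)
  norm_num at this
  rw [← mul_add]; exact this

lemma cut_v {φ : E3 → ℝ} {M : ℝ} (hφ : Cut M ρ (3/4) (7/8) φ) (hρ : 0 < ρ) (f : E3 → ℝ) :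
    ∫⁻ x, ‖φ x * f x‖ₑ ^ 2 ≤ ∫⁻ x in ball (0:E3) ρ, ‖f x‖ₑ ^ 2 := by
  refine lint_le_ball (fun x hx => ?_) fun x => ?_
  · rw [off_ts hφ.ts (by linarith)]; simp
  · rw [enorm_mul]
    have : ‖φ x‖ₑ ≤ 1 := by
      rw [Real.enorm_eq_ofReal_abs]; exact ENNReal.ofReal_le_one.2 (hφ.le x)
    calc _ ≤ (1 * ‖f x‖ₑ) ^ 2 := by gcongr
      _ = _ := by rw [one_mul]

lemma FT.cut_g (h : FT ρ v g P) {φ : E3 → ℝ} {M : ℝ} (hM : 0 < M) (hφ : Cut M ρ (3/4) (7/8) φ) (hρ : 0 < ρ) (i : Fin 3) :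
    ∑ j, ∫⁻ x, ‖φ x * g i j x + pd j φ x * v i x‖ₑ ^ 2 ≤
      ENNReal.ofReal (2 + 1536 * M ^ 2) * ∑ j, ∫⁻ x in ball (0:E3) ρ, ‖g i j x‖ₑ ^ 2 := by
  have key : ∀ j, ∫⁻ x, ‖φ x * g i j x + pd j φ x * v i x‖ₑ ^ 2 ≤
      2 * (∫⁻ x in ball (0:E3) ρ, ‖g i j x‖ₑ ^ 2) + ENNReal.ofReal (2 * (M/ρ)^2) * ∫⁻ x in ball (0:E3) ρ, ‖v i x‖ₑ ^ 2 := by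
    intro j
    have m1 : Measurable fun x => 2 * ‖g i j x‖ₑ ^ 2 := (((h.lwd i).mg j).enorm.pow_const 2).const_mul 2
    rw [← lintegral_const_mul' _ _ (by simp), ← lintegral_const_mul' _ _ ENNReal.ofReal_ne_top, ← lintegral_add_left m1]
    refine lint_le_ball (fun x hx => ?_) fun x => ?_
    · rw [off_ts hφ.ts (by linarith), off_pd hφ.ts j (by linarith)]; simp
    · have a1 : ‖φ x‖ₑ ≤ 1 := by
        rw [Real.enorm_eq_ofReal_abs]; exact ENNReal.ofReal_le_one.2 (hφ.le x)
      have a2 : ‖pd j φ x‖ₑ ≤ ENNReal.ofReal (M/ρ) := by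
        rw [Real.enorm_eq_ofReal_abs]; exact ENNReal.ofReal_le_ofReal (hφ.d1 j x)
      calc ‖φ x * g i j x + pd j φ x * v i x‖ₑ ^ 2 ≤ (1 * ‖g i j x‖ₑ + ENNReal.ofReal (M/ρ) * ‖v i x‖ₑ) ^ 2 := by
            refine pow_le_pow_left' ((enorm_add_le _ _).trans ?_) 2
            rw [enorm_mul, enorm_mul]
            exact add_le_add (mul_le_mul' a1 le_rfl) (mul_le_mul' a2 le_rfl)
        _ ≤ _ := sq_add_le _ _
        _ = _ := by
            rw [one_mul, mul_pow, ENNReal.ofReal_mul (by norm_num), ENNReal.ofReal_pow (by positivity)]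
            simp only [ENNReal.ofReal_ofNat]; ring
  refine (Finset.sum_le_sum fun j _ => key j).trans ?_
  rw [Finset.sum_add_distrib, ← Finset.mul_sum, Finset.sum_const]
  have p0 := (h.lwd i).poin0 hρ (h.mean i)
  set S := ∑ j, ∫⁻ x in ball (0:E3) ρ, ‖g i j x‖ₑ ^ 2
  simp only [Finset.card_univ, Fintype.card_fin, nsmul_eq_mul]
  calc _ ≤ 2 * S + (3:ℕ) * (ENNReal.ofReal (2 * (M/ρ)^2) * (ENNReal.ofReal (256 * ρ^2) * S)) := by gcongr
    _ = ENNReal.ofReal 2 * S + ENNReal.ofReal (1536 * M ^ 2) * S := by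
        have : (1536 * M ^ 2) = 3 * (2 * (M/ρ)^2 * (256 * ρ^2)) := by field_simp; norm_num
        rw [this, ENNReal.ofReal_mul (p := 3) (by norm_num), ENNReal.ofReal_mul (p := 2 * (M/ρ)^2) (by positivity)]
        simp only [ENNReal.ofReal_ofNat]; push_cast; ring
    _ = _ := by rw [← add_mul, ← ENNReal.ofReal_add (by norm_num) (by positivity)]

lemma memLp_sq {f : E3 → ℝ} {μ : Measure E3} (h : MemLp f 2 μ) : ∫⁻ x, ‖f x‖ₑ ^ 2 ∂μ ≠ ∞ := by
  have := h.eLpNorm_lt_top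
  rw [eLpNorm_lt_top_iff_lintegral_rpow_enorm_lt_top (by norm_num) (by norm_num)] at this
  simpa using this.ne

end NSD

end

section

namespace NSD

lemma exists_theta {a b c τ : ℝ} (ha : 0 < a) (hb : 0 < b) (hc : 0 < c) (ha1 : a < 1) (hb1 : b < 1) (hc1 : c < 1) (hτ : τ < 1) :
    ∃ θ : ℝ, 0 < θ ∧ θ ≤ 1/2 ∧ θ < a ∧ θ < b ∧ θ < c ∧ θ/2 < 1 - a ∧ θ/2 < 1 - b ∧ θ/2 < 1 - c ∧ 3*θ < 2 - 2*τ := by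
  have h : ∀ x : ℝ, 0 < x → ∀ᶠ θ in 𝓝[>] (0:ℝ), θ < x := fun x hx =>
    mem_nhdsWithin_of_mem_nhds (Iio_mem_nhds hx)
  have := (h (1/2) (by norm_num)).and ((h a ha).and ((h b hb).and ((h c hc).and ((h (1-a) (by linarith)).and
    ((h (1-b) (by linarith)).and ((h (1-c) (by linarith)).and (((h ((2-2*τ)/3) (by linarith))).and self_mem_nhdsWithin)))))))
  obtain ⟨θ, h1, h2, h3, h4, h5, h6, h7, h8, h9⟩ := this.exists
  have h9 : 0 < θ := h9
  exact ⟨θ, h9, h1.le, h2, h3, h4, by linarith, by linarith, by linarith, by linarith⟩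

variable {ρ : ℝ} {v : Fin 3 → E3 → ℝ} {g : Fin 3 → Fin 3 → E3 → ℝ} {P : E3 → ℝ}

lemma near_final {τ q1 q2 q3 M : ℝ} (hM : 0 < M) (hτ0 : 0 ≤ τ) (hτ1 : τ < 1) (hq1 : 1 < q1) (hq2 : 1 < q2) (hq3 : 1 < q3)
    (hpq : 2 * τ + (1/q1 + 1/q2 + 1/q3) = 2) {M1 : ℝ} (hM1 : 0 < M1) :
    ∃ K : ℝ, 0 < K ∧ ∀ (ρ : ℝ) (v : Fin 3 → E3 → ℝ) (g : Fin 3 → Fin 3 → E3 → ℝ) (P : E3 → ℝ) (φ1 : E3 → ℝ) (A B : ℝ),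
      0 < ρ → 0 < A → 0 < B → FT ρ v g P → Cut M1 ρ (3/4) (7/8) φ1 →
      (∀ i, ∫⁻ x in ball (0:E3) ρ, ‖v i x‖ₑ ^ 2 ≤ ENNReal.ofReal (A ^ 2)) →
      (∀ i, ∑ j, ∫⁻ x in ball (0:E3) ρ, ‖g i j x‖ₑ ^ 2 ≤ ENNReal.ofReal (B ^ 2)) →
      ∃ l, 0 < l ∧ l ≤ ρ ∧
        ∫⁻ x, GG M l (fun y => ∑ i, ‖φ1 y * v i y‖ₑ) (fun y => ∑ i, ∑ j, ‖φ1 y * g i j y + pd j φ1 y * v i y‖ₑ) x ^ (3/2:ℝ)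
        ≤ ENNReal.ofReal K * (aN q1 q2 q3 ((ball (0:E3) ρ).indicator fun x => ∑ i, ‖v i x‖ₑ)
            * ENNReal.ofReal (A ^ (2 * τ) * B ^ (2 - 2 * τ))) := by
  have r1 : 0 < 1/q1 := by positivity
  have r2 : 0 < 1/q2 := by positivity
  have r3 : 0 < 1/q3 := by positivity
  have r1' : 1/q1 < 1 := by rw [div_lt_one (by linarith)]; exact hq1
  have r2' : 1/q2 < 1 := by rw [div_lt_one (by linarith)]; exact hq2
  have r3' : 1/q3 < 1 := by rw [div_lt_one (by linarith)]; exact hq3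
  obtain ⟨θ, hθ, hθ2, t1, t2, t3, u1, u2, u3, hθτ⟩ := exists_theta r1 r2 r3 r1' r2' r3' hτ1
  have e0 : 0 < 2 - 3*θ := by linarith
  have w0 : 0 < 1 - θ/2 := by linarith
  -- exponents
  have sp : ∀ q : ℝ, θ/2 < 1 - 1/q → θ < 1/q → 1 < q → ∃ s : ℝ, 2 < s ∧ 1/s = (1 - θ/2 - 1/q)/(2-3*θ) ∧
      1/(1-θ/2)/q + (2-3*θ)/(1-θ/2)/s = 1 := by
    intro q h1 h2 hq
    have n0 : 0 < 1 - θ/2 - 1/q := by linarith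
    have ee : 1/((1 - θ/2 - 1/q)/(2-3*θ))⁻¹ = (1 - θ/2 - 1/q)/(2-3*θ) := by rw [one_div, inv_inv]
    refine ⟨((1 - θ/2 - 1/q)/(2-3*θ))⁻¹, ?_, ee, ?_⟩
    · rw [inv_div, lt_div_iff₀ n0]; linarith
    · rw [show (2-3*θ)/(1-θ/2)/((1 - θ/2 - 1/q)/(2-3*θ))⁻¹ = (2-3*θ)/(1-θ/2)*((1 - θ/2 - 1/q)/(2-3*θ)) by rw [div_inv_eq_mul]]
      rw [show 1/(1-θ/2)/q = 1/(1-θ/2) * (1/q) by ring]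
      generalize 1/q = x
      have z : (2-3*θ)/(1-θ/2)*((1 - θ/2 - x)/(2-3*θ)) = (1 - θ/2 - x)/(1-θ/2) := by
        rw [div_mul_div_comm, mul_comm (1-θ/2) (2-3*θ), mul_div_mul_left _ _ e0.ne']
      rw [z, one_div_mul_eq_div, ← add_div]
      rw [show x + (1 - θ/2 - x) = 1 - θ/2 by ring, div_self w0.ne']
  obtain ⟨s1, hs1, es1, f1⟩ := sp q1 u1 t1 hq1
  obtain ⟨s2, hs2, es2, f2⟩ := sp q2 u2 t2 hq2
  obtain ⟨s3, hs3, es3, f3⟩ := sp q3 u3 t3 hq3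
  set γ := 1 - 2*τ/(2-3*θ) with hγ
  have hγ' : γ = 3/2 - (1/s1 + 1/s2 + 1/s3) := by
    rw [es1, es2, es3, ← add_div, ← add_div]
    have : 1 - θ/2 - 1/q1 + (1 - θ/2 - 1/q2) + (1 - θ/2 - 1/q3) = 1 - 3*θ/2 + 2*τ := by linarith
    rw [this, hγ]; field_simp; ring
  have g0 : 0 ≤ γ := by rw [hγ, sub_nonneg, div_le_one e0]; linarith
  have g1 : γ ≤ 1 := by
    have : 0 ≤ 2*τ/(2-3*θ) := by positivity
    rw [hγ]; linarith
  obtain ⟨Cs, Cs0, hS⟩ := sobolev hs1 hs2 hs3 hγ' g0 g1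
  obtain ⟨C6, C60, hS6⟩ := sobolev (s1 := 6) (s2 := 6) (s3 := 6) (γ := 1) (by norm_num) (by norm_num) (by norm_num) (by norm_num) (by norm_num) le_rfl
  set C1 := 2 + 1536 * M1 ^ 2 with hC1
  have C10 : 0 < C1 := by positivity
  set c := Real.sqrt C1 with hc
  have c0' : 0 < c := Real.sqrt_pos.2 C10
  have c2 : c ^ 2 = C1 := Real.sq_sqrt C10.le
  obtain ⟨K, K0, hK⟩ := core (M := M) (θ := θ) (r := 3 * (1 - θ)/(1 - θ/2)) (D6 := 3 ^ (7:ℝ) * (C6 * c) ^ (6:ℝ)) (D2 := 243 * C1)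
    hM hθ hθ2 rfl (by positivity) (by positivity)
  set r := 3 * (1 - θ)/(1 - θ/2) with hr
  have r0 : 0 < r := by
    have : 0 < 1 - θ := by linarith
    positivity
  set k := ((3:ℝ) ^ (r + 1)) ^ (1 - θ/2) * (Cs * c ^ γ) ^ (2 - 3*θ) with hk
  have k0 : 0 < k := by positivity
  refine ⟨K * k, by positivity, fun ρ v g P φ1 A B hρ hA hB h hφ hvA hgB => ?_⟩
  set w : Fin 3 → E3 → ℝ := fun i y => φ1 y * v i y with hw
  set G : Fin 3 → Fin 3 → E3 → ℝ := fun i j y => φ1 y * g i j y + pd j φ1 y * v i y with hG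
  have wd : ∀ i, WD (7/8*ρ) (w i) (G i) := fun i => (h.lwd i).cut (by linarith) hφ.sm hφ.ts
  have mw : ∀ i, Measurable fun y => ‖w i y‖ₑ := fun i => (wd i).mw.enorm
  have mG : ∀ i j, Measurable fun y => ‖G i j y‖ₑ := fun i j => ((wd i).mG j).enorm
  have wA : ∀ i, ∫⁻ x, ‖w i x‖ₑ ^ 2 ≤ ENNReal.ofReal (A ^ 2) := fun i => (cut_v hφ hρ _).trans (hvA i)
  have GB : ∀ i, ∑ j, ∫⁻ x, ‖G i j x‖ₑ ^ 2 ≤ ENNReal.ofReal ((c * B) ^ 2) := by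
    intro i
    refine (h.cut_g hM1 hφ hρ i).trans ?_
    rw [mul_pow, c2, ENNReal.ofReal_mul C10.le]
    exact mul_le_mul' le_rfl (hgB i)
  have mW : Measurable fun y => ∑ i, ‖w i y‖ₑ := Finset.measurable_sum _ fun i _ => mw i
  have mΓ : Measurable fun y => ∑ i, ∑ j, ‖G i j y‖ₑ := Finset.measurable_sum _ fun i _ => Finset.measurable_sum _ fun j _ => mG i j
  have hW6 : ∫⁻ y, (∑ i, ‖w i y‖ₑ) ^ (6:ℝ) ≤ ENNReal.ofReal (3 ^ (7:ℝ) * (C6 * c) ^ (6:ℝ) * B ^ (6:ℝ)) := by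
    refine (lint_pow_sum3 mw (by norm_num)).trans ?_
    have one : ∀ i, ∫⁻ x, ‖w i x‖ₑ ^ (6:ℝ) ≤ ENNReal.ofReal ((C6 * c * B) ^ (6:ℝ)) := by
      intro i
      have := hS6 _ _ _ (wd i) A (c * B) hA (by positivity) (wA i) (GB i)
      rw [aN_666 (mw i)] at this
      have := ENNReal.rpow_le_rpow this (z := 6) (by norm_num)
      rw [← ENNReal.rpow_mul, ENNReal.ofReal_rpow_of_pos (by positivity)] at this
      norm_num at this
      refine le_trans (le_of_eq ?_) (this.trans (le_of_eq ?_))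
      · norm_num
      · congr 1; norm_num; ring
    refine (mul_le_mul' le_rfl (Finset.sum_le_sum fun i _ => one i)).trans (le_of_eq ?_)
    simp only [Finset.sum_const, Finset.card_univ, Fintype.card_fin, nsmul_eq_mul]
    rw [show (3:ℝ≥0∞) ^ (6:ℝ) = ENNReal.ofReal (3 ^ (6:ℝ)) by rw [← ENNReal.ofReal_rpow_of_pos (by norm_num)]; simp,
      show (((3:ℕ)):ℝ≥0∞) = ENNReal.ofReal 3 by simp, ← ENNReal.ofReal_mul (by norm_num), ← ENNReal.ofReal_mul (by positivity)]
    congr 1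
    rw [Real.mul_rpow (x := C6 * c) (by positivity) hB.le]
    norm_num; ring
  have hΓ2 : ∫⁻ y, (∑ i, ∑ j, ‖G i j y‖ₑ) ^ (2:ℝ) ≤ ENNReal.ofReal (243 * C1 * B ^ (2:ℝ)) := by
    refine (lint_pow_sum3 (f := fun i y => ∑ j, ‖G i j y‖ₑ) (fun i => Finset.measurable_sum _ fun j _ => mG i j) (by norm_num)).trans ?_
    have one : ∀ i, ∫⁻ x, (∑ j, ‖G i j x‖ₑ) ^ (2:ℝ) ≤ 9 * ENNReal.ofReal (C1 * B ^ 2) := by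
      intro i
      refine (lint_pow_sum3 (mG i) (by norm_num)).trans ?_
      refine mul_le_mul' (by norm_num) ?_
      have := GB i
      rw [mul_pow, c2] at this
      simpa only [ENNReal.rpow_two] using this
    refine (mul_le_mul' le_rfl (Finset.sum_le_sum fun i _ => one i)).trans (le_of_eq ?_)
    simp only [Finset.sum_const, Finset.card_univ, Fintype.card_fin, nsmul_eq_mul]
    rw [mul_assoc 243 C1, ENNReal.ofReal_mul (p := 243) (by norm_num), Real.rpow_two, ENNReal.rpow_two]
    simp only [ENNReal.ofReal_ofNat]
    rw [← mul_assoc, ← mul_assoc]; norm_num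
  have hsw : ∀ x, ρ ≤ ‖x‖ → ∑ i, ‖w i x‖ₑ = 0 := fun x hx => by
    simp [hw, off_ts hφ.ts (x := x) (by linarith)]
  obtain ⟨l, l0, lρ, hl⟩ := hK ρ B (fun y => ∑ i, ‖w i y‖ₑ) (fun y => ∑ i, ∑ j, ‖G i j y‖ₑ) hρ hB mW mΓ hsw hW6 hΓ2
  refine ⟨l, l0, lρ, hl.trans ?_⟩
  rw [ENNReal.ofReal_mul K0.le, mul_assoc]
  refine mul_le_mul' le_rfl ?_
  set N := aN q1 q2 q3 ((ball (0:E3) ρ).indicator fun x => ∑ i, ‖v i x‖ₑ) with hN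
  set S := Cs * A ^ (1 - γ) * (c * B) ^ γ with hSdef
  have S0 : 0 < S := by positivity
  have wr : ∀ i, ∫⁻ y, ‖w i y‖ₑ ^ r ≤ N ^ (1/(1-θ/2)) * ENNReal.ofReal S ^ ((2-3*θ)/(1-θ/2)) := by
    intro i
    have hh := aN_holder (by linarith) (by linarith) (by linarith) (by linarith) (by linarith) (by linarith)
      (show 0 ≤ 1/(1-θ/2) by positivity) (show 0 ≤ (2-3*θ)/(1-θ/2) by positivity) f1 f2 f3 (mw i) (mw i)
    have er : r = 1/(1-θ/2) + (2-3*θ)/(1-θ/2) := by rw [hr]; field_simp; ring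
    calc _ = ∫⁻ y, ‖w i y‖ₑ ^ (1/(1-θ/2)) * ‖w i y‖ₑ ^ ((2-3*θ)/(1-θ/2)) := by
          refine lintegral_congr fun y => ?_
          rw [er, ENNReal.rpow_add_of_nonneg _ _ (by positivity) (by positivity)]
      _ ≤ _ := hh
      _ ≤ _ := by
          refine mul_le_mul' (ENNReal.rpow_le_rpow ?_ (by positivity))
            (ENNReal.rpow_le_rpow (hS _ _ _ (wd i) A (c * B) hA (by positivity) (wA i) (GB i)) (by positivity))
          refine aN_mono (by linarith) (by linarith) (by linarith) (Eventually.of_forall fun x => ?_)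
          by_cases hx : x ∈ ball (0:E3) ρ
          · rw [indicator_of_mem hx]
            refine le_trans ?_ (Finset.single_le_sum (f := fun i => ‖v i x‖ₑ) (fun i _ => zero_le) (Finset.mem_univ i))
            simp only [hw]
            rw [enorm_mul]
            have : ‖φ1 x‖ₑ ≤ 1 := by
              rw [Real.enorm_eq_ofReal_abs]; exact ENNReal.ofReal_le_one.2 (hφ.le x)
            calc _ ≤ 1 * ‖v i x‖ₑ := mul_le_mul' this le_rfl
              _ = _ := one_mul _
          · simp only [hw]
            rw [off_ts hφ.ts (x := x) (by have : ρ ≤ ‖x‖ := by simpa using hx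
                                          linarith)]
            simp
  have wr2 : ∫⁻ y, (∑ i, ‖w i y‖ₑ) ^ r ≤ ENNReal.ofReal (3 ^ (r + 1)) * (N ^ (1/(1-θ/2)) * ENNReal.ofReal S ^ ((2-3*θ)/(1-θ/2))) := by
    refine (lint_pow_sum3 mw r0.le).trans ((mul_le_mul' le_rfl (Finset.sum_le_sum fun i _ => wr i)).trans (le_of_eq ?_))
    simp only [Finset.sum_const, Finset.card_univ, Fintype.card_fin, nsmul_eq_mul]
    rw [← mul_assoc, ← ENNReal.ofReal_rpow_of_pos (by norm_num), ENNReal.rpow_add _ _ (by simp) (by simp)]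
    simp
  refine (mul_le_mul' (ENNReal.rpow_le_rpow wr2 w0.le) le_rfl).trans (le_of_eq ?_)
  rw [ENNReal.mul_rpow_of_nonneg _ _ w0.le, ENNReal.mul_rpow_of_nonneg _ _ w0.le, ← ENNReal.rpow_mul, ← ENNReal.rpow_mul,
    div_mul_cancel₀ _ w0.ne', div_mul_cancel₀ _ w0.ne', ENNReal.rpow_one, ENNReal.ofReal_rpow_of_pos (by positivity),
    ENNReal.ofReal_rpow_of_pos S0]
  have fin : ((3:ℝ) ^ (r + 1)) ^ (1 - θ/2) * (S ^ (2 - 3*θ) * B ^ (3*θ)) = k * (A ^ (2*τ) * B ^ (2 - 2*τ)) := by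
    have s1 : S ^ (2-3*θ) = (Cs * c ^ γ) ^ (2-3*θ) * (A ^ (2*τ) * B ^ (2 - 3*θ - 2*τ)) := by
      have : S = Cs * c ^ γ * (A ^ (1-γ) * B ^ γ) := by
        rw [hSdef, Real.mul_rpow c0'.le hB.le]; ring
      rw [this, Real.mul_rpow (by positivity) (by positivity), Real.mul_rpow (x := A ^ (1-γ)) (by positivity) (by positivity),
        ← Real.rpow_mul hA.le, ← Real.rpow_mul hB.le]
      have x1 : (1-γ)*(2-3*θ) = 2*τ := by rw [hγ]; field_simp; ring
      have x2 : γ*(2-3*θ) = 2 - 3*θ - 2*τ := by rw [hγ]; field_simp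
      rw [x1, x2]
    have s2 : B ^ (2 - 2*τ) = B ^ (2 - 3*θ - 2*τ) * B ^ (3*θ) := by rw [← Real.rpow_add hB]; congr 1; ring
    rw [s1, s2, hk]; ring
  calc _ = N * ENNReal.ofReal (((3:ℝ) ^ (r + 1)) ^ (1 - θ/2) * (S ^ (2 - 3*θ) * B ^ (3*θ))) := by
        rw [ENNReal.ofReal_mul (p := ((3:ℝ) ^ (r + 1)) ^ (1 - θ/2)) (by positivity), ENNReal.ofReal_mul (p := S ^ (2 - 3*θ)) (by positivity)]; ring
    _ = _ := by rw [fin, ENNReal.ofReal_mul k0.le]; ring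

end NSD

end

section

namespace NSD

lemma FT_final {τ q1 q2 q3 : ℝ} (hτ0 : 0 ≤ τ) (hτ1 : τ < 1) (hq1 : 1 < q1) (hq2 : 1 < q2) (hq3 : 1 < q3)
    (hpq : 2 * τ + (1/q1 + 1/q2 + 1/q3) = 2) :
    ∃ C : ℝ, 0 < C ∧ ∀ (ρ μ : ℝ) (v : Fin 3 → E3 → ℝ) (g : Fin 3 → Fin 3 → E3 → ℝ) (P : E3 → ℝ),
      FT ρ v g P → 0 < μ → μ ≤ ρ/8 →
      ∫⁻ x in ball 0 μ, ‖P x - ⨍ y in ball 0 μ, P y‖ₑ ^ (3/2:ℝ) ≤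
        ENNReal.ofReal C * (aN q1 q2 q3 ((ball (0:E3) ρ).indicator fun x => ∑ i, ‖v i x‖ₑ)
          * ((∑ i, ∫⁻ x in ball (0:E3) ρ, ‖v i x‖ₑ ^ 2) ^ τ * (∑ i, ∑ j, ∫⁻ x in ball (0:E3) ρ, ‖g i j x‖ₑ ^ 2) ^ (1 - τ)))
        + ENNReal.ofReal C * (ENNReal.ofReal (μ/ρ) ^ (9/2:ℝ) * ∫⁻ y in ball 0 ρ, ‖P y‖ₑ ^ (3/2:ℝ)) := by
  obtain ⟨M, M0, hcut⟩ := exists_Cut (a := 1/2) (b := 3/4) (by norm_num) (by norm_num)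
  obtain ⟨M1, M10, hcut1⟩ := exists_Cut (a := 3/4) (b := 7/8) (by norm_num) (by norm_num)
  obtain ⟨K, K0, hK⟩ := near_final M0 hτ0 hτ1 hq1 hq2 hq3 hpq M10
  have c00 := c0_pos
  have v0 := v1_pos
  set e := c0 ^ (3/2:ℝ) with he
  have e0 : 0 < e := by positivity
  set L := 4 * v1 ^ (3/2:ℝ) * (4050 * M) ^ (3/2:ℝ) with hL
  have L0 : 0 < L := by positivity
  refine ⟨e⁻¹ * (8 * K + L), by positivity, fun ρ μ v g P h hμ0 hμ => ?_⟩
  have hρ : 0 < ρ := by linarith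
  obtain ⟨φ, hφ⟩ := hcut ρ hρ
  obtain ⟨φ1, hφ1⟩ := hcut1 ρ hρ
  have ts1 : tsupport φ1 ⊆ ball 0 ρ := hφ1.ts.trans (ball_subset_ball (by linarith))
  set a2 := ∑ i, ∫⁻ x in ball (0:E3) ρ, ‖v i x‖ₑ ^ 2 with ha2
  set b2 := ∑ i, ∑ j, ∫⁻ x in ball (0:E3) ρ, ‖g i j x‖ₑ ^ 2 with hb2
  set N := aN q1 q2 q3 ((ball (0:E3) ρ).indicator fun x => ∑ i, ‖v i x‖ₑ) with hN
  set Z := ∫⁻ y in ball 0 ρ, ‖P y‖ₑ ^ (3/2:ℝ) with hZ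
  set X := ∫⁻ x in ball 0 μ, ‖P x - ⨍ y in ball 0 μ, P y‖ₑ ^ (3/2:ℝ) with hX
  have a2t : a2 ≠ ∞ := ENNReal.sum_ne_top.2 fun i _ => memLp_sq (h.lwd i).lv
  have b2t : b2 ≠ ∞ := ENNReal.sum_ne_top.2 fun i _ => ENNReal.sum_ne_top.2 fun j _ => memLp_sq ((h.lwd i).lg j)
  have near : ∃ l, 0 < l ∧ l ≤ ρ ∧
        ∫⁻ x, GG M l (fun y => ∑ i, ‖φ1 y * v i y‖ₑ) (fun y => ∑ i, ∑ j, ‖φ1 y * g i j y + pd j φ1 y * v i y‖ₑ) x ^ (3/2:ℝ)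
        ≤ ENNReal.ofReal K * (N * (a2 ^ τ * b2 ^ (1 - τ))) := by
    by_cases ha : a2 = 0
    · refine ⟨ρ, hρ, le_rfl, ?_⟩
      have hv : ∀ i, ∀ᵐ x, x ∈ ball (0:E3) ρ → v i x = 0 := by
        intro i
        have : ∫⁻ x in ball (0:E3) ρ, ‖v i x‖ₑ ^ 2 = 0 := by
          have := (Finset.sum_eq_zero_iff.1 (ha2.symm.trans ha)) i (Finset.mem_univ i)
          exact this
        rw [lintegral_eq_zero_iff ((h.lwd i).mv.enorm.pow_const 2)] at this
        have := (ae_restrict_iff' measurableSet_ball).1 this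
        filter_upwards [this] with x hx hxb
        simpa using hx hxb
      have hw : ∀ᵐ y, ∑ i, ‖φ1 y * v i y‖ₑ = 0 := by
        filter_upwards [ae_all_iff.2 hv] with y hy
        refine Finset.sum_eq_zero fun i _ => ?_
        by_cases hb : y ∈ ball (0:E3) ρ
        · rw [hy i hb]; simp
        · rw [off_ts ts1 (by simpa using hb)]; simp
      have z := GG_zero M ρ (W := fun y => ∑ i, ‖φ1 y * v i y‖ₑ) (Γ := fun y => ∑ i, ∑ j, ‖φ1 y * g i j y + pd j φ1 y * v i y‖ₑ) hw
      refine le_trans (le_of_eq ?_) zero_le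
      rw [lintegral_congr (g := fun _ => 0) fun x => by rw [z x, ENNReal.zero_rpow_of_pos (by norm_num)], lintegral_zero]
    · have hb : b2 ≠ 0 := by
        intro hb
        apply ha
        refine Finset.sum_eq_zero fun i _ => ?_
        have p0 := (h.lwd i).poin0 hρ (h.mean i)
        have z := (Finset.sum_eq_zero_iff.1 (hb2.symm.trans hb)) i (Finset.mem_univ i)
        rw [z, mul_zero] at p0
        exact le_antisymm p0 zero_le
      set A := Real.sqrt a2.toReal with hA
      set B := Real.sqrt b2.toReal with hB
      have a0 : 0 < a2.toReal := ENNReal.toReal_pos ha a2t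
      have b0 : 0 < b2.toReal := ENNReal.toReal_pos hb b2t
      have A0 : 0 < A := Real.sqrt_pos.2 a0
      have B0 : 0 < B := Real.sqrt_pos.2 b0
      have A2 : ENNReal.ofReal (A ^ 2) = a2 := by rw [hA, Real.sq_sqrt a0.le, ENNReal.ofReal_toReal a2t]
      have B2 : ENNReal.ofReal (B ^ 2) = b2 := by rw [hB, Real.sq_sqrt b0.le, ENNReal.ofReal_toReal b2t]
      obtain ⟨l, l0, lρ, hl⟩ := hK ρ v g P φ1 A B hρ A0 B0 h hφ1
        (fun i => by rw [A2]; exact Finset.single_le_sum (f := fun i => ∫⁻ x in ball (0:E3) ρ, ‖v i x‖ₑ ^ 2) (fun _ _ => zero_le) (Finset.mem_univ i))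
        (fun i => by rw [B2]; exact Finset.single_le_sum (f := fun i => ∑ j, ∫⁻ x in ball (0:E3) ρ, ‖g i j x‖ₑ ^ 2) (fun _ _ => zero_le) (Finset.mem_univ i))
      refine ⟨l, l0, lρ, hl.trans (le_of_eq ?_)⟩
      congr 2
      rw [← A2, ← B2, ENNReal.ofReal_rpow_of_pos (by positivity), ENNReal.ofReal_rpow_of_pos (by positivity),
        ← ENNReal.ofReal_mul (by positivity), ← Real.rpow_natCast, ← Real.rpow_natCast, ← Real.rpow_mul A0.le, ← Real.rpow_mul B0.le]
      congr 3; push_cast; ring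
  obtain ⟨l, l0, lρ, hl⟩ := near
  have hp := h.press M0 hφ hφ1.sm ts1 hφ1.one l0 lρ hμ0 hμ
  rw [← he, ← hL, ← hX, ← hZ] at hp
  set Q := N * (a2 ^ τ * b2 ^ (1 - τ))
  set H := ENNReal.ofReal (μ/ρ) ^ (9/2:ℝ) * Z with hH
  have hp2 : ENNReal.ofReal e * X ≤ ENNReal.ofReal (8 * K + L) * Q + ENNReal.ofReal (8 * K + L) * H := by
    refine hp.trans ?_
    rw [mul_assoc (ENNReal.ofReal L), ← hH]
    refine add_le_add ?_ (mul_le_mul' (ENNReal.ofReal_le_ofReal (by linarith)) le_rfl)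
    calc _ ≤ 8 * (ENNReal.ofReal K * Q) := mul_le_mul' le_rfl hl
      _ = ENNReal.ofReal (8 * K) * Q := by
        rw [ENNReal.ofReal_mul (by norm_num), mul_assoc]; simp
      _ ≤ _ := mul_le_mul' (ENNReal.ofReal_le_ofReal (by linarith)) le_rfl
  calc X = ENNReal.ofReal e⁻¹ * (ENNReal.ofReal e * X) := by
        rw [← mul_assoc, ← ENNReal.ofReal_mul (by positivity), inv_mul_cancel₀ e0.ne']; simp
    _ ≤ ENNReal.ofReal e⁻¹ * (ENNReal.ofReal (8 * K + L) * Q + ENNReal.ofReal (8 * K + L) * H) := mul_le_mul' le_rfl hp2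
    _ = _ := by rw [ENNReal.ofReal_mul (by positivity)]; ring

end NSD

end

section

namespace NSD

/-- smooth test functions on the ball -/
structure Tst (ρ : ℝ) (χ : E3 → ℝ) : Prop where
  sm : Sm χ
  hcs : HasCompactSupport χ
  ts : tsupport χ ⊆ ball 0 ρ

/-- smooth test functions in time -/
structure TTst (ρ : ℝ) (τ : ℝ → ℝ) : Prop where
  sm : ContDiff ℝ (⊤ : ℕ∞) τ
  hcs : HasCompactSupport τ
  ts : tsupport τ ⊆ Ioo (-(ρ^2)) 0

lemma functional_cont {ι : Type*} [Fintype ι] {ρ : ℝ} {a : ι → E3 → ℝ} (ha : ∀ k, Integrable (a k) (volume.restrict (ball 0 ρ))) :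
    Continuous fun f : C(E3, ι → ℝ) => ∫ x in ball (0:E3) ρ, ∑ k, a k x * f x k := by
  rw [continuous_iff_continuousAt]
  intro f0
  have hu : TendstoUniformlyOn (fun (f : C(E3, ι → ℝ)) x => f x) f0 (𝓝 f0) (closedBall 0 ρ) :=
    ContinuousMap.tendsto_iff_forall_isCompact_tendstoUniformlyOn.1 (tendsto_id (x := 𝓝 f0)) _ (isCompact_closedBall _ _)
  obtain ⟨K, hK⟩ := (isCompact_closedBall (0:E3) ρ).exists_bound_of_continuousOn f0.continuous.continuousOn
  refine tendsto_integral_filter_of_dominated_convergence (fun x => ∑ k, ‖a k x‖ * (K + 1)) ?_ ?_ ?_ ?_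
  · refine Eventually.of_forall fun f => ?_
    refine Finset.aestronglyMeasurable_fun_sum _ fun k _ => (ha k).aestronglyMeasurable.mul ?_
    exact ((continuous_apply k).comp f.continuous).aestronglyMeasurable
  · filter_upwards [Metric.tendstoUniformlyOn_iff.1 hu 1 one_pos] with f hf
    refine (ae_restrict_iff' measurableSet_ball).2 (Eventually.of_forall fun x hx => ?_)
    refine (norm_sum_le _ _).trans (Finset.sum_le_sum fun k _ => ?_)
    rw [norm_mul]
    refine mul_le_mul_of_nonneg_left ?_ (norm_nonneg _)
    have h1 := hf x (ball_subset_closedBall hx)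
    have h2 := hK x (ball_subset_closedBall hx)
    rw [dist_eq_norm] at h1
    have h3 : ‖f x‖ ≤ ‖f0 x‖ + ‖f0 x - f x‖ := by
      have := norm_sub_norm_le (f x) (f0 x)
      rw [norm_sub_rev] at this; linarith
    have := norm_le_pi_norm (f x) k
    linarith
  · exact integrable_finsetSum _ fun k _ => (ha k).norm.mul_const _
  · refine Eventually.of_forall fun x => ?_
    refine tendsto_finsetSum _ fun k _ => Tendsto.const_mul _ ?_
    exact ((continuous_apply k).comp (continuous_eval_const x)).tendsto f0

lemma dens {ι : Type*} [Fintype ι] {ρ : ℝ} {ν : Measure ℝ} {a : ι → E3 → ℝ → ℝ} {D : ι → (E3 → ℝ) → E3 → ℝ}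
    (ha : ∀ k, ∀ᵐ t ∂ν, Integrable (fun x => a k x t) (volume.restrict (ball 0 ρ)))
    (hD : ∀ k χ, Tst ρ χ → Continuous (D k χ))
    (h : ∀ χ, Tst ρ χ → ∀ᵐ t ∂ν, ∫ x in ball (0:E3) ρ, ∑ k, a k x t * D k χ x = 0) :
    ∀ᵐ t ∂ν, ∀ χ, Tst ρ χ → ∫ x in ball (0:E3) ρ, ∑ k, a k x t * D k χ x = 0 := by
  set T : Set C(E3, ι → ℝ) := {f | ∃ χ, Tst ρ χ ∧ ∀ x k, f x k = D k χ x} with hT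
  obtain ⟨S, Sc, Sd⟩ := TopologicalSpace.exists_countable_dense T
  have hS : ∀ᵐ t ∂ν, ∀ f ∈ S, ∫ x in ball (0:E3) ρ, ∑ k, a k x t * (f : C(E3, ι → ℝ)) x k = 0 := by
    rw [ae_ball_iff Sc]
    intro f hf
    obtain ⟨χ, hχ, he⟩ := f.2
    filter_upwards [h χ hχ] with t ht
    simp only [he]; exact ht
  filter_upwards [hS, ae_all_iff.2 ha] with t h1 h2 χ hχ
  have hc := functional_cont h2
  let f : C(E3, ι → ℝ) := ⟨fun x k => D k χ x, continuous_pi fun k => hD k χ hχ⟩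
  have fT : f ∈ T := ⟨χ, hχ, fun x k => rfl⟩
  have cl : IsClosed {g : T | ∫ x in ball (0:E3) ρ, ∑ k, a k x t * (g : C(E3, ι → ℝ)) x k = 0} :=
    isClosed_eq (hc.comp continuous_subtype_val) continuous_const
  have := cl.closure_subset_iff.2 (show S ⊆ _ from fun g hg => h1 g hg) (Sd ⟨f, fT⟩)
  exact this

lemma prod_int {ρ : ℝ} {a : E3 → ℝ → ℝ} (hm : Measurable (Function.uncurry a))
    (hf : ∫⁻ t in Ioo (-(ρ^2)) 0, ∫⁻ x in ball (0:E3) ρ, ‖a x t‖ₑ < ∞) :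
    Integrable (fun z : ℝ × E3 => a z.2 z.1) ((volume.restrict (Ioo (-(ρ^2)) 0)).prod (volume.restrict (ball (0:E3) ρ))) := by
  have m : Measurable fun z : ℝ × E3 => a z.2 z.1 := hm.comp measurable_swap
  refine ⟨m.aestronglyMeasurable, ?_⟩
  rw [hasFiniteIntegral_iff_enorm, lintegral_prod _ m.enorm.aemeasurable]
  exact hf

lemma ae_test {ι : Type*} [Fintype ι] {ρ : ℝ} {a : ι → E3 → ℝ → ℝ} {D : ι → (E3 → ℝ) → E3 → ℝ}
    (hm : ∀ k, Measurable (Function.uncurry (a k)))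
    (hf : ∀ k, ∫⁻ t in Ioo (-(ρ^2)) 0, ∫⁻ x in ball (0:E3) ρ, ‖a k x t‖ₑ < ∞)
    (hD : ∀ k χ, Tst ρ χ → Continuous (D k χ))
    (hDc : ∀ k χ, Tst ρ χ → ∃ C, ∀ x, ‖D k χ x‖ ≤ C)
    (h : ∀ χ, Tst ρ χ → ∀ τ, TTst ρ τ → ∫ t in Ioo (-(ρ^2)) 0, τ t * ∫ x in ball (0:E3) ρ, ∑ k, a k x t * D k χ x = 0) :
    ∀ᵐ t ∂(volume.restrict (Ioo (-(ρ^2)) 0)), ∀ χ, Tst ρ χ → ∫ x in ball (0:E3) ρ, ∑ k, a k x t * D k χ x = 0 := by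
  refine dens (fun k => (prod_int (hm k) (hf k)).prod_right_ae) hD fun χ hχ => ?_
  have hi : Integrable (fun t => ∫ x in ball (0:E3) ρ, ∑ k, a k x t * D k χ x) (volume.restrict (Ioo (-(ρ^2)) 0)) := by
    have : Integrable (fun z : ℝ × E3 => ∑ k, a k z.2 z.1 * D k χ z.2)
        ((volume.restrict (Ioo (-(ρ^2)) 0)).prod (volume.restrict (ball (0:E3) ρ))) := by
      refine integrable_finsetSum _ fun k _ => ?_
      obtain ⟨C, hC⟩ := hDc k χ hχ
      refine (prod_int (hm k) (hf k)).mul_bdd (c := C) ?_ (Eventually.of_forall fun z => hC z.2)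
      exact ((hD k χ hχ).comp continuous_snd).aestronglyMeasurable
    exact this.integral_prod_left
  rw [ae_restrict_iff' measurableSet_Ioo]
  refine isOpen_Ioo.ae_eq_zero_of_integral_contDiff_smul_eq_zero (IntegrableOn.locallyIntegrableOn hi) fun τ h1 h2 h3 => ?_
  rw [← h χ hχ τ ⟨h1, h2, h3⟩]
  rw [setIntegral_eq_integral_of_forall_compl_eq_zero]
  · rfl
  · intro t ht
    rw [image_eq_zero_of_notMem_tsupport fun h => ht (h3 h), zero_mul]

end NSD

end

section

namespace NSD

lemma supp_prod {V : Type*} [Zero V] [TopologicalSpace V] {ρ : ℝ} {χ : E3 → ℝ} {τ : ℝ → ℝ} (hχ : Tst ρ χ) (hτ : TTst ρ τ)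
    {F : E3 × ℝ → V} (h : ∀ z, F z ≠ 0 → z.1 ∈ tsupport χ ∧ z.2 ∈ tsupport τ) :
    HasCompactSupport F ∧ tsupport F ⊆ (ball (0 : E3) ρ) ×ˢ (Ioo (-(ρ^2)) 0) := by
  have hK : IsCompact (tsupport χ ×ˢ tsupport τ) := hχ.hcs.isCompact.prod hτ.hcs.isCompact
  have hs : tsupport F ⊆ tsupport χ ×ˢ tsupport τ :=
    closure_minimal (fun z hz => mk_mem_prod (h z hz).1 (h z hz).2) hK.isClosed
  exact ⟨HasCompactSupport.of_support_subset_isCompact hK (subset_closure.trans hs), hs.trans (prod_mono hχ.ts hτ.ts)⟩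

lemma istest {ρ : ℝ} {χ : E3 → ℝ} {τ : ℝ → ℝ} (hχ : Tst ρ χ) (hτ : TTst ρ τ) : IsTest ρ fun x t => τ t * χ x := by
  have := supp_prod hχ hτ (F := fun z : E3 × ℝ => τ z.2 * χ z.1) fun z hz =>
    ⟨subset_closure (right_ne_zero_of_mul hz), subset_closure (left_ne_zero_of_mul hz)⟩
  refine ⟨?_, this.1, this.2⟩
  have h1 : ContDiff ℝ (⊤ : ℕ∞) χ := hχ.sm
  exact (hτ.sm.comp contDiff_snd).mul (h1.comp contDiff_fst)

lemma istestV {ρ : ℝ} {χ : E3 → ℝ} {τ : ℝ → ℝ} (hχ : Tst ρ χ) (hτ : TTst ρ τ) :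
    IsTestV ρ fun x t => WithLp.toLp 2 fun i => τ t * pd i χ x := by
  have := supp_prod hχ hτ (F := fun z : E3 × ℝ => (WithLp.toLp 2 fun i => τ z.2 * pd i χ z.1 : E3)) fun z hz => by
    have : ∃ i, τ z.2 * pd i χ z.1 ≠ 0 := by
      by_contra hc
      push Not at hc
      apply hz
      ext i
      simp [hc i]
    obtain ⟨i, hi⟩ := this
    exact ⟨tsupport_pd i (subset_closure (right_ne_zero_of_mul hi)), subset_closure (left_ne_zero_of_mul hi)⟩
  refine ⟨?_, this.1, this.2⟩
  rw [contDiff_euclidean]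
  intro i
  have h1 : ContDiff ℝ (⊤ : ℕ∞) (pd i χ) := hχ.sm.pd i
  exact (hτ.sm.comp contDiff_snd).mul (h1.comp contDiff_fst)

lemma Tst.pd {ρ : ℝ} {χ : E3 → ℝ} (h : Tst ρ χ) (i : Fin 3) : Tst ρ (pd i χ) :=
  ⟨h.sm.pd i, hcs_pd h.hcs i, (tsupport_pd i).trans h.ts⟩

lemma Tst.add {ρ : ℝ} {χ ψ : E3 → ℝ} (h : Tst ρ χ) (h' : Tst ρ ψ) : Tst ρ (fun x => χ x + ψ x) :=
  ⟨ContDiff.add h.sm h'.sm, HasCompactSupport.add h.hcs h'.hcs,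
    (closure_mono (Function.support_add χ ψ)).trans (by rw [closure_union]; exact union_subset h.ts h'.ts)⟩

lemma Tst.bdd {ρ : ℝ} {χ : E3 → ℝ} (h : Tst ρ χ) : ∃ C, ∀ x, ‖χ x‖ ≤ C := by
  obtain ⟨C, _, hC⟩ := bdd_of_hcs h.sm.continuous h.hcs
  exact ⟨C, hC⟩

lemma Tst.lap {ρ : ℝ} {χ : E3 → ℝ} (h : Tst ρ χ) : Tst ρ (lap χ) := by
  have e : _root_.lap χ = fun x => (_root_.pd 0 (_root_.pd 0 χ) x + _root_.pd 1 (_root_.pd 1 χ) x) + _root_.pd 2 (_root_.pd 2 χ) x := by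
    funext x; simp only [_root_.lap, Fin.sum_univ_three]
  rw [e]
  exact (((h.pd 0).pd 0).add ((h.pd 1).pd 1)).add ((h.pd 2).pd 2)

lemma lap_pd {χ : E3 → ℝ} (h : Sm χ) (i : Fin 3) (x : E3) : lap (pd i χ) x = pd i (lap χ) x := by
  have e : lap χ = fun x => (pd 0 (pd 0 χ) x + pd 1 (pd 1 χ) x) + pd 2 (pd 2 χ) x := by
    funext x; simp only [lap, Fin.sum_univ_three]
  have c : ∀ j, pd j (pd j (pd i χ)) x = pd i (pd j (pd j χ)) x := by
    intro j
    have : pd j (pd i χ) = pd i (pd j χ) := funext fun y => pd_comm h j i y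
    rw [this]
    exact pd_comm (h.pd j) j i x
  have s01 : Sm fun x => pd 0 (pd 0 χ) x + pd 1 (pd 1 χ) x := ContDiff.add ((h.pd 0).pd 0) ((h.pd 1).pd 1)
  rw [e, pd_add s01 ((h.pd 2).pd 2), pd_add ((h.pd 0).pd 0) ((h.pd 1).pd 1), ← c, ← c, ← c]
  simp only [lap, Fin.sum_univ_three]

lemma fin_of_le {ρ : ℝ} {a H : E3 → ℝ → ℝ≥0∞} (h : ∀ x t, a x t ≤ 1 + H x t)
    (hf : ∫⁻ t in Ioo (-(ρ^2)) 0, ∫⁻ x in ball (0:E3) ρ, H x t < ∞) :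
    ∫⁻ t in Ioo (-(ρ^2)) 0, ∫⁻ x in ball (0:E3) ρ, a x t < ∞ := by
  calc _ ≤ ∫⁻ t in Ioo (-(ρ^2)) 0, ∫⁻ x in ball (0:E3) ρ, (1 + H x t) :=
        lintegral_mono fun t => lintegral_mono fun x => h x t
    _ = (∫⁻ t in Ioo (-(ρ^2)) 0, volume (ball (0:E3) ρ)) + ∫⁻ t in Ioo (-(ρ^2)) 0, ∫⁻ x in ball (0:E3) ρ, H x t := by
        rw [← lintegral_add_left measurable_const]
        refine lintegral_congr fun t => ?_
        rw [lintegral_add_left measurable_const]; simp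
    _ < ∞ := by
        refine ENNReal.add_lt_top.2 ⟨?_, hf⟩
        rw [setLIntegral_const]
        exact ENNReal.mul_lt_top measure_ball_lt_top (by simp)

lemma one_add_pow (x : ℝ≥0∞) {p : ℝ} (hp : 1 ≤ p) : x ≤ 1 + x ^ p := by
  rcases le_total x 1 with h | h
  · exact h.trans le_self_add
  · refine le_trans ?_ le_add_self
    calc x = x ^ (1:ℝ) := (ENNReal.rpow_one x).symm
      _ ≤ x ^ p := ENNReal.rpow_le_rpow_of_exponent_le h hp

section sol
variable {ρ : ℝ} {u : E3 → ℝ → E3} {P : E3 → ℝ → ℝ}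

lemma fin_uu (sol : SuitableWeakSolution ρ u P) : ∫⁻ t in Ioo (-(ρ^2)) 0, ∫⁻ x in ball (0:E3) ρ, ‖u x t‖ₑ ^ 2 < ∞ := by
  have hb := sol.bdd_L2
  have hl := ENNReal.ae_le_essSup (μ := volume.restrict (Ioo (-(ρ^2)) 0))
    (fun t => ∫⁻ x in ball (0 : E3) ρ, ((‖u x t‖₊ : ℝ≥0∞)) ^ 2)
  set S := essSup (fun t => ∫⁻ x in ball (0 : E3) ρ, ((‖u x t‖₊ : ℝ≥0∞)) ^ 2) (volume.restrict (Ioo (-(ρ^2)) 0))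
  calc _ ≤ ∫⁻ t in Ioo (-(ρ^2)) 0, S := lintegral_mono_ae hl
    _ < ∞ := by
        rw [setLIntegral_const]
        exact ENNReal.mul_lt_top hb (by simp)

lemma meas_ui (sol : SuitableWeakSolution ρ u P) (i : Fin 3) : Measurable (Function.uncurry fun x t => u x t i) :=
  (by fun_prop : Measurable fun z : E3 => z i).comp sol.meas_u

lemma meas_gij (sol : SuitableWeakSolution ρ u P) (i j : Fin 3) : Measurable (Function.uncurry fun x t => sol.gu x t i j) :=
  (by fun_prop : Measurable fun z : Fin 3 → Fin 3 → ℝ => z i j).comp sol.meas_gu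

lemma meas_uij (sol : SuitableWeakSolution ρ u P) (i j : Fin 3) : Measurable (Function.uncurry fun x t => u x t i * u x t j) :=
  (meas_ui sol i).mul (meas_ui sol j)

lemma enorm_coord (z : E3) (i : Fin 3) : ‖z i‖ₑ ≤ ‖z‖ₑ := by
  rw [← ofReal_norm, ← ofReal_norm]
  exact ENNReal.ofReal_le_ofReal (PiLp.norm_apply_le z i)

lemma fin_ui (sol : SuitableWeakSolution ρ u P) (i : Fin 3) : ∫⁻ t in Ioo (-(ρ^2)) 0, ∫⁻ x in ball (0:E3) ρ, ‖u x t i‖ₑ < ∞ := by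
  refine fin_of_le (fun x t => ?_) (fin_uu sol)
  refine (enorm_coord _ i).trans ((one_add_pow _ (p := 2) (by norm_num)).trans (le_of_eq ?_))
  rw [ENNReal.rpow_two]

lemma fin_uij (sol : SuitableWeakSolution ρ u P) (i j : Fin 3) : ∫⁻ t in Ioo (-(ρ^2)) 0, ∫⁻ x in ball (0:E3) ρ, ‖u x t i * u x t j‖ₑ < ∞ := by
  refine fin_of_le (fun x t => ?_) (fin_uu sol)
  rw [enorm_mul, sq]
  exact (mul_le_mul' (enorm_coord _ i) (enorm_coord _ j)).trans le_add_self

lemma gu_sq_le (g : Fin 3 → Fin 3 → ℝ) (i j : Fin 3) : ‖g i j‖ₑ ^ 2 ≤ ENNReal.ofReal (∑ i : Fin 3, ∑ j : Fin 3, (g i j) ^ 2) := by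
  rw [Real.enorm_eq_ofReal_abs, ← ENNReal.ofReal_pow (abs_nonneg _), sq_abs]
  refine ENNReal.ofReal_le_ofReal ?_
  refine (Finset.single_le_sum (f := fun j => g i j ^ 2) (fun _ _ => sq_nonneg _) (Finset.mem_univ j)).trans ?_
  exact Finset.single_le_sum (f := fun i => ∑ j, g i j ^ 2) (fun _ _ => Finset.sum_nonneg fun _ _ => sq_nonneg _) (Finset.mem_univ i)

lemma fin_gij (sol : SuitableWeakSolution ρ u P) (i j : Fin 3) : ∫⁻ t in Ioo (-(ρ^2)) 0, ∫⁻ x in ball (0:E3) ρ, ‖sol.gu x t i j‖ₑ < ∞ := by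
  refine fin_of_le (fun x t => ?_) sol.grad_L2
  refine (one_add_pow _ (p := 2) (by norm_num)).trans (add_le_add le_rfl ?_)
  rw [ENNReal.rpow_two]
  exact gu_sq_le _ i j

lemma fin_P (sol : SuitableWeakSolution ρ u P) : ∫⁻ t in Ioo (-(ρ^2)) 0, ∫⁻ x in ball (0:E3) ρ, ‖P x t‖ₑ < ∞ := by
  refine fin_of_le (fun x t => ?_) sol.press_L32
  rw [Real.enorm_eq_ofReal_abs]
  exact one_add_pow _ (by norm_num)

end sol

end NSD

end

section

namespace NSD

lemma slice_int {ρ : ℝ} {a : E3 → ℝ → ℝ} (hm : Measurable (Function.uncurry a))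
    (hf : ∫⁻ t in Ioo (-(ρ^2)) 0, ∫⁻ x in ball (0:E3) ρ, ‖a x t‖ₑ < ∞) :
    ∀ᵐ t ∂(volume.restrict (Ioo (-(ρ^2)) 0)), Integrable (fun x => a x t) (volume.restrict (ball 0 ρ)) :=
  (prod_int hm hf).prod_right_ae

lemma mul_tst {ρ : ℝ} {a D : E3 → ℝ} (ha : Integrable a (volume.restrict (ball 0 ρ))) (h : Tst ρ D) :
    Integrable (fun x => a x * D x) (volume.restrict (ball 0 ρ)) := by
  obtain ⟨C, hC⟩ := h.bdd
  exact ha.mul_bdd (c := C) h.sm.continuous.aestronglyMeasurable (Eventually.of_forall hC)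

lemma time_int {ρ : ℝ} {a : E3 → ℝ → ℝ} (hm : Measurable (Function.uncurry a))
    (hf : ∫⁻ t in Ioo (-(ρ^2)) 0, ∫⁻ x in ball (0:E3) ρ, ‖a x t‖ₑ < ∞) {D : E3 → ℝ} (h : Tst ρ D) {τ : ℝ → ℝ} (hτ : TTst ρ τ) :
    Integrable (fun t => τ t * ∫ x in ball (0:E3) ρ, a x t * D x) (volume.restrict (Ioo (-(ρ^2)) 0)) := by
  obtain ⟨C, hC⟩ := h.bdd
  have : Integrable (fun z : ℝ × E3 => a z.2 z.1 * D z.2)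
        ((volume.restrict (Ioo (-(ρ^2)) 0)).prod (volume.restrict (ball (0:E3) ρ))) :=
    (prod_int hm hf).mul_bdd (c := C) (h.sm.continuous.comp continuous_snd).aestronglyMeasurable
      (Eventually.of_forall fun z => hC z.2)
  obtain ⟨K, hK⟩ := hτ.hcs.exists_bound_of_continuous hτ.sm.continuous
  exact this.integral_prod_left.bdd_mul (c := K) hτ.sm.continuous.aestronglyMeasurable (Eventually.of_forall hK)

lemma pd_cm {χ : E3 → ℝ} (h : Sm χ) (c : ℝ) (i : Fin 3) : pd i (fun y => c * χ y) = fun x => c * pd i χ x :=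
  funext fun x => pd_const_mul h c i x

lemma lap_cm {χ : E3 → ℝ} (h : Sm χ) (c : ℝ) (x : E3) : lap (fun y => c * χ y) x = c * lap χ x := by
  simp only [lap, Finset.mul_sum]
  refine Finset.sum_congr rfl fun i _ => ?_
  have : (fun y => pd i (fun y => c * χ y) y) = fun x => c * pd i χ x := pd_cm h c i
  rw [this, pd_const_mul (h.pd i)]

section sol
variable {ρ : ℝ} {u : E3 → ℝ → E3} {P : E3 → ℝ → ℝ}

lemma ae_div (sol : SuitableWeakSolution ρ u P) : ∀ᵐ t ∂(volume.restrict (Ioo (-(ρ^2)) 0)), ∀ χ, Tst ρ χ →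
    ∫ x in ball (0:E3) ρ, ∑ i, u x t i * pd i χ x = 0 := by
  refine ae_test (a := fun i x t => u x t i) (D := fun i χ => pd i χ) (fun i => meas_ui sol i) (fun i => fin_ui sol i)
    (fun i χ h => (h.pd i).sm.continuous) (fun i χ h => (h.pd i).bdd) fun χ hχ τ hτ => ?_
  refine Eq.trans ?_ (sol.weak_div _ (istest hχ hτ))
  refine integral_congr_ae (Eventually.of_forall fun t => ?_)
  beta_reduce
  rw [← integral_const_mul]
  refine integral_congr_ae (Eventually.of_forall fun x => ?_)
  beta_reduce
  rw [Finset.mul_sum]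
  refine Finset.sum_congr rfl fun i _ => ?_
  rw [pd_const_mul hχ.sm]; ring

lemma ae_grad (sol : SuitableWeakSolution ρ u P) (i j : Fin 3) : ∀ᵐ t ∂(volume.restrict (Ioo (-(ρ^2)) 0)), ∀ χ, Tst ρ χ →
    ∫ x in ball (0:E3) ρ, u x t i * pd j χ x = - ∫ x in ball (0:E3) ρ, sol.gu x t i j * χ x := by
  have key := ae_test (ρ := ρ) (ι := Bool) (a := fun k x t => if k then u x t i else sol.gu x t i j)
    (D := fun k χ => if k then pd j χ else χ)
    (fun k => by cases k; exacts [meas_gij sol i j, meas_ui sol i])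
    (fun k => by cases k; exacts [fin_gij sol i j, fin_ui sol i])
    (fun k χ h => by cases k; exacts [h.sm.continuous, (h.pd j).sm.continuous])
    (fun k χ h => by cases k; exacts [h.bdd, (h.pd j).bdd]) ?_
  · filter_upwards [key, slice_int (meas_ui sol i) (fin_ui sol i), slice_int (meas_gij sol i j) (fin_gij sol i j)]
      with t h1 h2 h3 χ hχ
    have := h1 χ hχ
    simp only [Fintype.sum_bool, if_true, Bool.false_eq_true, if_false] at this
    rw [integral_add (mul_tst h2 (hχ.pd j)) (mul_tst h3 hχ)] at this
    linarith
  · intro χ hχ τ hτ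
    have hg := sol.is_grad _ (istest hχ hτ) i j
    have e1 : ∫ t in Ioo (-(ρ^2)) 0, ∫ x in ball (0:E3) ρ, u x t i * pd j (fun y => τ t * χ y) x =
        ∫ t in Ioo (-(ρ^2)) 0, τ t * ∫ x in ball (0:E3) ρ, u x t i * pd j χ x := by
      refine integral_congr_ae (Eventually.of_forall fun t => ?_)
      beta_reduce
      rw [← integral_const_mul]
      refine integral_congr_ae (Eventually.of_forall fun x => ?_)
      beta_reduce
      rw [pd_const_mul hχ.sm]; ring
    have e2 : ∫ t in Ioo (-(ρ^2)) 0, ∫ x in ball (0:E3) ρ, sol.gu x t i j * (τ t * χ x) =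
        ∫ t in Ioo (-(ρ^2)) 0, τ t * ∫ x in ball (0:E3) ρ, sol.gu x t i j * χ x := by
      refine integral_congr_ae (Eventually.of_forall fun t => ?_)
      beta_reduce
      rw [← integral_const_mul]
      refine integral_congr_ae (Eventually.of_forall fun x => ?_)
      beta_reduce
      ring
    rw [e1, e2] at hg
    have i1 := time_int (meas_ui sol i) (fin_ui sol i) (hχ.pd j) hτ
    have i2 := time_int (meas_gij sol i j) (fin_gij sol i j) hχ hτ
    have hs := integral_add i1 i2
    rw [hg, neg_add_cancel] at hs
    refine Eq.trans ?_ hs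
    refine integral_congr_ae ?_
    filter_upwards [slice_int (meas_ui sol i) (fin_ui sol i), slice_int (meas_gij sol i j) (fin_gij sol i j)] with t h2 h3
    simp only [Fintype.sum_bool, if_true, Bool.false_eq_true, if_false]
    rw [integral_add (mul_tst h2 (hχ.pd j)) (mul_tst h3 hχ), mul_add]

lemma ae_NS (sol : SuitableWeakSolution ρ u P) : ∀ᵐ t ∂(volume.restrict (Ioo (-(ρ^2)) 0)), ∀ χ, Tst ρ χ →
    ∫ x in ball (0:E3) ρ, P x t * (∑ i, pd i (pd i χ) x) =
      - ∑ i, ∑ j, ∫ x in ball (0:E3) ρ, (u x t i * u x t j) * pd i (pd j χ) x := by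
  have i1 : ∀ᵐ t ∂(volume.restrict (Ioo (-(ρ^2)) 0)), ∀ i, Integrable (fun x => u x t i) (volume.restrict (ball 0 ρ)) :=
    ae_all_iff.2 fun i => slice_int (meas_ui sol i) (fin_ui sol i)
  have i2 : ∀ᵐ t ∂(volume.restrict (Ioo (-(ρ^2)) 0)), ∀ i j, Integrable (fun x => u x t i * u x t j) (volume.restrict (ball 0 ρ)) :=
    ae_all_iff.2 fun i => ae_all_iff.2 fun j => slice_int (meas_uij sol i j) (fin_uij sol i j)
  have i3 : ∀ᵐ t ∂(volume.restrict (Ioo (-(ρ^2)) 0)), Integrable (fun x => P x t) (volume.restrict (ball 0 ρ)) :=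
    slice_int sol.meas_press (fin_P sol)
  have tl : ∀ χ, Tst ρ χ → Tst ρ fun x => ∑ j, pd j (pd j χ) x := fun χ h => h.lap
  have key := ae_test (ρ := ρ) (ι := Option (Fin 3 × Fin 3))
    (a := fun k x t => k.elim (P x t) fun ij => u x t ij.1 * u x t ij.2)
    (D := fun k χ x => k.elim (∑ j, pd j (pd j χ) x) fun ij => pd ij.1 (pd ij.2 χ) x)
    (fun k => by cases k with
      | none => exact sol.meas_press
      | some ij => exact meas_uij sol ij.1 ij.2)
    (fun k => by cases k with
      | none => exact fin_P sol
      | some ij => exact fin_uij sol ij.1 ij.2)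
    (fun k χ h => by cases k with
      | none => exact (tl χ h).sm.continuous
      | some ij => exact ((h.pd ij.2).pd ij.1).sm.continuous)
    (fun k χ h => by cases k with
      | none => exact (tl χ h).bdd
      | some ij => exact ((h.pd ij.2).pd ij.1).bdd) ?_
  · filter_upwards [key, i2, i3] with t h1 h2 h3 χ hχ
    have := h1 χ hχ
    simp only [Fintype.sum_option, Option.elim_none, Option.elim_some, Fintype.sum_prod_type] at this
    have ii : ∀ i j, Integrable (fun x => (u x t i * u x t j) * pd i (pd j χ) x) (volume.restrict (ball 0 ρ)) :=
      fun i j => mul_tst (h2 i j) ((hχ.pd j).pd i)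
    rw [integral_add (mul_tst h3 (tl χ hχ)) (integrable_finsetSum _ fun i _ => integrable_finsetSum _ fun j _ => ii i j),
      integral_finsetSum _ fun i _ => integrable_finsetSum _ fun j _ => ii i j] at this
    rw [Finset.sum_congr rfl fun i _ => integral_finsetSum _ fun j _ => ii i j] at this
    linarith
  · intro χ hχ τ hτ
    have hg := sol.weak_NS _ (istestV hχ hτ)
    rw [← neg_eq_zero, ← integral_neg]
    refine Eq.trans ?_ hg
    refine integral_congr_ae ?_
    filter_upwards [i1, i2, i3, ae_div sol] with t h1 h2 h3 h4
    have f1 : ∀ ψ, Tst ρ ψ → Integrable (fun x => ∑ i, u x t i * pd i ψ x) (volume.restrict (ball 0 ρ)) :=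
      fun ψ hψ => integrable_finsetSum _ fun i _ => mul_tst (h1 i) (hψ.pd i)
    simp only [Fintype.sum_option, Option.elim_none, Option.elim_some, Fintype.sum_prod_type]
    set F := fun x => P x t * (∑ i, pd i (pd i χ) x) + ∑ i, ∑ j, (u x t i * u x t j) * pd i (pd j χ) x with hF
    have f3 : Integrable F (volume.restrict (ball 0 ρ)) :=
      (mul_tst h3 (tl χ hχ)).add (integrable_finsetSum _ fun i _ => integrable_finsetSum _ fun j _ =>
        mul_tst (h2 i j) ((hχ.pd j).pd i))
    have e : ∀ x, (-(∑ i : Fin 3, u x t i * deriv (fun s => τ s * pd i χ x) t)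
          - (∑ i : Fin 3, u x t i * lap (fun y => τ t * pd i χ y) x)
          - (∑ i : Fin 3, ∑ j : Fin 3, u x t i * u x t j * pd i (fun y => τ t * pd j χ y) x)
          - P x t * (∑ j : Fin 3, pd j (fun y => τ t * pd j χ y) x)) =
        (-(deriv τ t) * (∑ i, u x t i * pd i χ x) + (-(τ t)) * (∑ i, u x t i * pd i (lap χ) x)) + (-(τ t)) * F x := by
      intro x
      have a1 : ∀ i, deriv (fun s => τ s * pd i χ x) t = deriv τ t * pd i χ x := fun i => deriv_mul_const_field _
      have a2 : ∀ i, lap (fun y => τ t * pd i χ y) x = τ t * pd i (lap χ) x := fun i => by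
        rw [lap_cm (hχ.pd i).sm, lap_pd hχ.sm]
      have a3 : ∀ i j, pd i (fun y => τ t * pd j χ y) x = τ t * pd i (pd j χ) x := fun i j => pd_const_mul (hχ.pd j).sm _ _ _
      simp only [a1, a2, a3, hF, Fin.sum_univ_three]
      ring
    have e' := integral_congr_ae (μ := volume.restrict (ball 0 ρ)) (Eventually.of_forall e)
    refine Eq.trans ?_ e'.symm
    have g1 : Integrable (fun x => -(deriv τ t) * (∑ i, u x t i * pd i χ x)) (volume.restrict (ball 0 ρ)) := (f1 χ hχ).const_mul _
    have g2 : Integrable (fun x => (-(τ t)) * (∑ i, u x t i * pd i (lap χ) x)) (volume.restrict (ball 0 ρ)) := (f1 _ hχ.lap).const_mul _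
    have g3 : Integrable (fun x => (-(τ t)) * F x) (volume.restrict (ball 0 ρ)) := f3.const_mul _
    have g12 : Integrable (fun x => -(deriv τ t) * (∑ i, u x t i * pd i χ x) + (-(τ t)) * (∑ i, u x t i * pd i (lap χ) x)) (volume.restrict (ball 0 ρ)) := g1.add g2
    rw [integral_add g12 g3, integral_add g1 g2, integral_const_mul, integral_const_mul, integral_const_mul, h4 χ hχ, h4 _ hχ.lap]
    ring

end sol
end NSD

end

section

namespace NSD

lemma int_pd {ρ : ℝ} {χ : E3 → ℝ} (h : Tst ρ χ) (i : Fin 3) : ∫ x in ball (0:E3) ρ, pd i χ x = 0 := by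
  rw [setIntegral_eq_integral_of_forall_compl_eq_zero]
  · have i1 : Integrable χ := h.sm.continuous.integrable_of_hasCompactSupport h.hcs
    have i2 : Integrable (pd i χ) := (h.pd i).sm.continuous.integrable_of_hasCompactSupport (h.pd i).hcs
    have i2' : Integrable (fun x => fderiv ℝ χ x (EuclideanSpace.single i 1)) (volume : Measure E3) := i2
    have := integral_mul_fderiv_eq_neg_fderiv_mul_of_integrable (μ := (volume : Measure E3)) (𝕜 := ℝ) (f := fun _ => (1:ℝ)) (g := χ)
      (v := EuclideanSpace.single i 1) (by simp) (by simpa using i2') (by simpa using i1)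
      (fun x _ => by fun_prop) (fun x _ => h.sm.diff x)
    simpa [pd] using this
  · intro x hx
    exact image_eq_zero_of_notMem_tsupport fun hh => hx ((h.pd i).ts hh)

lemma mk_FT {ρ : ℝ} {w : E3 → E3} {g : E3 → Fin 3 → Fin 3 → ℝ} {p : E3 → ℝ}
    (mw : Measurable w) (mg : Measurable g) (mp : Measurable p)
    (lw : ∀ i, MemLp (fun x => w x i) 2 (volume.restrict (ball (0:E3) ρ)))
    (lg : ∀ i j, MemLp (fun x => g x i j) 2 (volume.restrict (ball (0:E3) ρ)))
    (ip : Integrable p (volume.restrict (ball (0:E3) ρ)))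
    (div : ∀ χ, Tst ρ χ → ∫ x in ball (0:E3) ρ, ∑ i, w x i * pd i χ x = 0)
    (grad : ∀ i j χ, Tst ρ χ → ∫ x in ball (0:E3) ρ, w x i * pd j χ x = - ∫ x in ball (0:E3) ρ, g x i j * χ x)
    (ns : ∀ χ, Tst ρ χ → ∫ x in ball (0:E3) ρ, p x * (∑ i, pd i (pd i χ) x) =
      - ∑ i, ∑ j, ∫ x in ball (0:E3) ρ, (w x i * w x j) * pd i (pd j χ) x) (c : ℝ) :
    FT ρ (fun i x => w x i - ⨍ y in ball (0:E3) ρ, w y i) (fun i j x => g x i j) (fun x => p x - c) := by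
  have fm : IsFiniteMeasure (volume.restrict (ball (0:E3) ρ)) := ⟨by rw [Measure.restrict_apply_univ]; exact measure_ball_lt_top⟩
  have iw : ∀ i, Integrable (fun x => w x i) (volume.restrict (ball (0:E3) ρ)) := fun i => (lw i).integrable (by norm_num)
  have iww : ∀ i j, Integrable (fun x => w x i * w x j) (volume.restrict (ball (0:E3) ρ)) := fun i j => (lw i).integrable_mul (lw j)
  have mwi : ∀ i, Measurable fun x => w x i := fun i => (by fun_prop : Measurable fun z : E3 => z i).comp mw
  have ic : ∀ c : ℝ, Integrable (fun _ : E3 => c) (volume.restrict (ball (0:E3) ρ)) := fun c =>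
    integrable_const c
  have mean : ∀ i, ∫ x in ball (0:E3) ρ, (w x i - ⨍ y in ball (0:E3) ρ, w y i) = 0 := by
    intro i
    exact integral_sub_average _ _
  set m : Fin 3 → ℝ := fun i => ⨍ y in ball (0:E3) ρ, w y i with hm
  have cst : ∀ (a : ℝ) ψ, Tst ρ ψ → ∀ i, ∫ x in ball (0:E3) ρ, a * pd i ψ x = 0 := fun a ψ h i => by
    rw [integral_const_mul, int_pd h, mul_zero]
  refine ⟨fun i => ⟨(mwi i).sub_const _, fun j => (by fun_prop : Measurable fun z : Fin 3 → Fin 3 → ℝ => z i j).comp mg, ?_, lg i, ?_⟩,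
    mean, mp.sub_const _, ip.sub (ic c), ?_⟩
  · exact (lw i).sub (memLp_const _)
  · intro χ h1 h2 h3 j
    have hχ : Tst ρ χ := ⟨h1, h2, h3⟩
    rw [← grad i j χ hχ]
    have e : ∀ x, (w x i - m i) * pd j χ x = w x i * pd j χ x - m i * pd j χ x := fun x => by ring
    rw [integral_congr_ae (Eventually.of_forall e), integral_sub (mul_tst (iw i) (hχ.pd j)) (mul_tst (ic _) (hχ.pd j)), cst _ _ hχ, sub_zero]
  · intro χ h1 h2 h3
    have hχ : Tst ρ χ := ⟨h1, h2, h3⟩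
    have tl : Tst ρ fun x => ∑ j, pd j (pd j χ) x := hχ.lap
    have l0 : ∫ x in ball (0:E3) ρ, c * ∑ j, pd j (pd j χ) x = 0 := by
      have e : ∀ x, c * ∑ j, pd j (pd j χ) x = ∑ j, c * pd j (pd j χ) x := fun x => Finset.mul_sum _ _ _
      rw [integral_congr_ae (Eventually.of_forall e), integral_finsetSum _ fun j _ => mul_tst (ic c) ((hχ.pd j).pd j)]
      exact Finset.sum_eq_zero fun j _ => cst _ _ (hχ.pd j) j
    have el : ∀ x, (p x - c) * ∑ j, pd j (pd j χ) x = p x * (∑ j, pd j (pd j χ) x) - c * ∑ j, pd j (pd j χ) x := fun x => by ring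
    rw [integral_congr_ae (Eventually.of_forall el), integral_sub (mul_tst ip tl) (mul_tst (ic c) tl), l0, sub_zero, ns χ hχ]
    congr 1
    have d1 : ∀ ψ, Tst ρ ψ → ∑ i, ∫ x in ball (0:E3) ρ, w x i * pd i ψ x = 0 := fun ψ h => by
      rw [← integral_finsetSum _ fun i _ => mul_tst (iw i) (h.pd i)]; exact div ψ h
    have sp : ∀ i j, ∫ x in ball (0:E3) ρ, (w x i - m i) * (w x j - m j) * pd i (pd j χ) x =
        (∫ x in ball (0:E3) ρ, (w x i * w x j) * pd i (pd j χ) x)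
        - (m j * (∫ x in ball (0:E3) ρ, w x i * pd i (pd j χ) x) + m i * (∫ x in ball (0:E3) ρ, w x j * pd j (pd i χ) x)) := by
      intro i j
      have T := (hχ.pd j).pd i
      have c' : ∀ x, pd j (pd i χ) x = pd i (pd j χ) x := fun x => pd_comm h1 j i x
      simp only [c']
      have e : ∀ x, (w x i - m i) * (w x j - m j) * pd i (pd j χ) x =
          ((w x i * w x j) * pd i (pd j χ) x - m j * (w x i * pd i (pd j χ) x)) - m i * (w x j * pd i (pd j χ) x)
           + (m i * m j) * pd i (pd j χ) x := fun x => by ring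
      have j1 := mul_tst (iww i j) T
      have j2 : Integrable (fun x => m j * (w x i * pd i (pd j χ) x)) (volume.restrict (ball (0:E3) ρ)) := (mul_tst (iw i) T).const_mul _
      have j3 : Integrable (fun x => m i * (w x j * pd i (pd j χ) x)) (volume.restrict (ball (0:E3) ρ)) := (mul_tst (iw j) T).const_mul _
      have j12 : Integrable (fun x => (w x i * w x j) * pd i (pd j χ) x - m j * (w x i * pd i (pd j χ) x)) (volume.restrict (ball (0:E3) ρ)) := j1.sub j2
      have j123 : Integrable (fun x => ((w x i * w x j) * pd i (pd j χ) x - m j * (w x i * pd i (pd j χ) x)) - m i * (w x j * pd i (pd j χ) x)) (volume.restrict (ball (0:E3) ρ)) := j12.sub j3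
      rw [integral_congr_ae (Eventually.of_forall e), integral_add j123 (mul_tst (ic _) T), integral_sub j12 j3, integral_sub j1 j2,
        cst _ _ (hχ.pd j), integral_const_mul, integral_const_mul]
      ring
    change _ = ∑ i, ∑ j, ∫ x in ball (0:E3) ρ, (w x i - m i) * (w x j - m j) * pd i (pd j χ) x
    simp only [sp, Finset.sum_sub_distrib, Finset.sum_add_distrib]
    have z1 : ∑ i, ∑ j, m j * (∫ x in ball (0:E3) ρ, w x i * pd i (pd j χ) x) = 0 := by
      rw [Finset.sum_comm]
      refine Finset.sum_eq_zero fun j _ => ?_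
      rw [← Finset.mul_sum, d1 _ (hχ.pd j), mul_zero]
    have z2 : ∑ i, ∑ j, m i * (∫ x in ball (0:E3) ρ, w x j * pd j (pd i χ) x) = 0 := by
      refine Finset.sum_eq_zero fun i _ => ?_
      rw [← Finset.mul_sum, d1 _ (hχ.pd i), mul_zero]
    rw [z1, z2]; ring

section sol
variable {ρ : ℝ} {u : E3 → ℝ → E3} {P : E3 → ℝ → ℝ}

lemma meas_slice {α : Type*} [MeasurableSpace α] {a : E3 → ℝ → α} (h : Measurable (Function.uncurry a)) (t : ℝ) : Measurable fun x => a x t :=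
  h.comp (measurable_id.prodMk measurable_const)

lemma memLp2 {f : E3 → ℝ} (hm : Measurable f) (h : ∫⁻ x in ball (0:E3) ρ, ‖f x‖ₑ ^ 2 < ∞) : MemLp f 2 (volume.restrict (ball (0:E3) ρ)) := by
  refine ⟨hm.aestronglyMeasurable, ?_⟩
  rw [eLpNorm_lt_top_iff_lintegral_rpow_enorm_lt_top (by norm_num) (by norm_num)]
  simpa using h

lemma ae_FT (sol : SuitableWeakSolution ρ u P) : ∀ᵐ t ∂(volume.restrict (Ioo (-(ρ^2)) 0)),
    (∀ i, MemLp (fun x => u x t i) 2 (volume.restrict (ball (0:E3) ρ))) ∧ Integrable (fun x => P x t) (volume.restrict (ball (0:E3) ρ)) ∧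
    ∀ c, FT ρ (fun i x => u x t i - ⨍ y in ball (0:E3) ρ, u y t i) (fun i j x => sol.gu x t i j) (fun x => P x t - c) := by
  have m1 : Measurable fun t => ∫⁻ x in ball (0:E3) ρ, ‖u x t‖ₑ ^ 2 := by
    have : Measurable fun z : E3 × ℝ => ‖Function.uncurry u z‖ₑ ^ 2 := sol.meas_u.enorm.pow_const 2
    exact this.lintegral_prod_left'
  have m2 : Measurable fun t => ∫⁻ x in ball (0:E3) ρ, ENNReal.ofReal (∑ i : Fin 3, ∑ j : Fin 3, (sol.gu x t i j) ^ 2) := by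
    have : Measurable fun z : E3 × ℝ => ENNReal.ofReal (∑ i : Fin 3, ∑ j : Fin 3, (sol.gu z.1 z.2 i j) ^ 2) := by
      refine ENNReal.measurable_ofReal.comp (Finset.measurable_fun_sum _ fun i _ => Finset.measurable_fun_sum _ fun j _ => ?_)
      exact (meas_gij sol i j).pow_const 2
    exact this.lintegral_prod_left'
  filter_upwards [ae_lt_top m1 (fin_uu sol).ne, ae_lt_top m2 sol.grad_L2.ne, slice_int sol.meas_press (fin_P sol),
    ae_div sol, ae_all_iff.2 fun i => ae_all_iff.2 fun j => ae_grad sol i j, ae_NS sol] with t h1 h2 h3 h4 h5 h6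
  have l1 : ∀ i, MemLp (fun x => u x t i) 2 (volume.restrict (ball (0:E3) ρ)) := fun i =>
    memLp2 (meas_slice (meas_ui sol i) t) ((lintegral_mono fun x => pow_le_pow_left' (enorm_coord _ i) 2).trans_lt h1)
  refine ⟨l1, h3, mk_FT (w := fun x => u x t) (g := fun x => sol.gu x t) (p := fun x => P x t)
    (meas_slice sol.meas_u t) (meas_slice sol.meas_gu t) (meas_slice sol.meas_press t) l1 (fun i j => ?_) h3 h4 h5 h6⟩
  exact memLp2 (meas_slice (meas_gij sol i j) t) ((lintegral_mono fun x => gu_sq_le _ i j).trans_lt h2)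

end sol
end NSD

end

section

namespace NSD

lemma var_le {ρ : ℝ} {f : E3 → ℝ} (lf : MemLp f 2 (volume.restrict (ball (0:E3) ρ))) :
    ∫⁻ x in ball (0:E3) ρ, ‖f x - ⨍ y in ball (0:E3) ρ, f y‖ₑ ^ 2 ≤ ∫⁻ x in ball (0:E3) ρ, ‖f x‖ₑ ^ 2 := by
  have fm : IsFiniteMeasure (volume.restrict (ball (0:E3) ρ)) := ⟨by rw [Measure.restrict_apply_univ]; exact measure_ball_lt_top⟩
  have i1 : Integrable f (volume.restrict (ball (0:E3) ρ)) := lf.integrable (by norm_num)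
  have i2 : Integrable (fun x => f x ^ 2) (volume.restrict (ball (0:E3) ρ)) := lf.integrable_sq
  have hz : ∫ x in ball (0:E3) ρ, (f x - ⨍ y in ball (0:E3) ρ, f y) = 0 := integral_sub_average _ _
  set m := ⨍ y in ball (0:E3) ρ, f y
  clear_value m
  have ic : Integrable (fun _ : E3 => m) (volume.restrict (ball (0:E3) ρ)) := integrable_const m
  have i3 : Integrable (fun x => (f x - m) ^ 2) (volume.restrict (ball (0:E3) ρ)) := (lf.sub (memLp_const m)).integrable_sq
  have c : ∀ h : E3 → ℝ, ∀ x, ‖h x‖ₑ ^ 2 = ENNReal.ofReal (h x ^ 2) := fun h x => by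
    rw [Real.enorm_eq_ofReal_abs, ← ENNReal.ofReal_pow (abs_nonneg _), sq_abs]
  simp only [c (fun x => f x - m), c f]
  rw [← ofReal_integral_eq_lintegral_ofReal i3 (Eventually.of_forall fun x => sq_nonneg _),
    ← ofReal_integral_eq_lintegral_ofReal i2 (Eventually.of_forall fun x => sq_nonneg _)]
  refine ENNReal.ofReal_le_ofReal ?_
  have e : ∀ x, f x ^ 2 = (f x - m) ^ 2 + 2 * m * (f x - m) + m ^ 2 := fun x => by ring
  have j2 : Integrable (fun x => 2 * m * (f x - m)) (volume.restrict (ball (0:E3) ρ)) := (i1.sub ic).const_mul _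
  have j12 : Integrable (fun x => (f x - m) ^ 2 + 2 * m * (f x - m)) (volume.restrict (ball (0:E3) ρ)) := i3.add j2
  rw [integral_congr_ae (Eventually.of_forall e), integral_add j12 (integrable_const _), integral_add i3 j2, integral_const_mul, hz]
  have : 0 ≤ ∫ x in ball (0:E3) ρ, m ^ 2 := integral_nonneg fun _ => sq_nonneg _
  linarith

lemma avg_sub {μ : ℝ} (hμ : 0 < μ) {p : E3 → ℝ} (ip : Integrable p (volume.restrict (ball (0:E3) μ))) (c : ℝ) :
    ⨍ y in ball (0:E3) μ, (p y - c) = (⨍ y in ball (0:E3) μ, p y) - c := by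
  have fm : IsFiniteMeasure (volume.restrict (ball (0:E3) μ)) := ⟨by rw [Measure.restrict_apply_univ]; exact measure_ball_lt_top⟩
  have pos : 0 < volume.real (ball (0:E3) μ) := by
    rw [measureReal_def]; exact ENNReal.toReal_pos (measure_ball_pos _ _ hμ).ne' measure_ball_lt_top.ne
  rw [setAverage_eq, setAverage_eq, integral_sub ip (integrable_const c), setIntegral_const]
  simp only [smul_eq_mul]
  field_simp

lemma slice {τ q1 q2 q3 C : ℝ} (hτ0 : 0 ≤ τ) (hτ1 : τ < 1) (hq1 : 1 < q1) (hq2 : 1 < q2) (hq3 : 1 < q3) (hC : 0 < C)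
    (h : ∀ (ρ μ : ℝ) (v : Fin 3 → E3 → ℝ) (g : Fin 3 → Fin 3 → E3 → ℝ) (P : E3 → ℝ),
      FT ρ v g P → 0 < μ → μ ≤ ρ/8 →
      ∫⁻ x in ball 0 μ, ‖P x - ⨍ y in ball 0 μ, P y‖ₑ ^ (3/2:ℝ) ≤
        ENNReal.ofReal C * (aN q1 q2 q3 ((ball (0:E3) ρ).indicator fun x => ∑ i, ‖v i x‖ₑ)
          * ((∑ i, ∫⁻ x in ball (0:E3) ρ, ‖v i x‖ₑ ^ 2) ^ τ * (∑ i, ∑ j, ∫⁻ x in ball (0:E3) ρ, ‖g i j x‖ₑ ^ 2) ^ (1 - τ)))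
        + ENNReal.ofReal C * (ENNReal.ofReal (μ/ρ) ^ (9/2:ℝ) * ∫⁻ y in ball 0 ρ, ‖P y‖ₑ ^ (3/2:ℝ)))
    {ρ μ : ℝ} (hμ : 0 < μ) (hμρ : μ ≤ ρ/8) {w : E3 → E3} {g : E3 → Fin 3 → Fin 3 → ℝ} {p : E3 → ℝ}
    (mg : Measurable g)
    (lw : ∀ i, MemLp (fun x => w x i) 2 (volume.restrict (ball (0:E3) ρ)))
    (ip : Integrable p (volume.restrict (ball (0:E3) ρ)))
    (ft : ∀ c, FT ρ (fun i x => w x i - ⨍ y in ball (0:E3) ρ, w y i) (fun i j x => g x i j) (fun x => p x - c)) :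
    ∫⁻ x in ball (0:E3) μ, ENNReal.ofReal |p x - ⨍ y in ball (0:E3) μ, p y| ^ (3/2:ℝ) ≤
      ENNReal.ofReal (9 * C) * (anisoNorm q1 q2 q3 (ball (0:E3) ρ) (fun x => ‖w x - ⨍ y in ball (0:E3) ρ, w y‖) *
        ((∫⁻ x in ball (0:E3) ρ, ‖w x‖ₑ ^ 2) ^ τ *
          (∫⁻ x in ball (0:E3) ρ, ENNReal.ofReal (∑ i : Fin 3, ∑ j : Fin 3, (g x i j) ^ 2)) ^ (1 - τ)))
      + ENNReal.ofReal (9 * C) * (ENNReal.ofReal (μ/ρ) ^ (9/2:ℝ) *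
        ∫⁻ x in ball (0:E3) ρ, ENNReal.ofReal |p x - ⨍ y in ball (0:E3) ρ, p y| ^ (3/2:ℝ)) := by
  have iw : ∀ i, Integrable (fun x => w x i) (volume.restrict (ball (0:E3) ρ)) := fun i => by
    have fm : IsFiniteMeasure (volume.restrict (ball (0:E3) ρ)) := ⟨by rw [Measure.restrict_apply_univ]; exact measure_ball_lt_top⟩
    exact (lw i).integrable (by norm_num)
  have ip' : Integrable p (volume.restrict (ball (0:E3) μ)) :=
    ip.mono_measure (Measure.restrict_mono (ball_subset_ball (by linarith)) le_rfl)
  have key := h ρ μ _ _ _ (ft (⨍ y in ball (0:E3) ρ, p y)) hμ hμρ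
  simp only [avg_sub hμ ip', sub_sub_sub_cancel_right, Real.enorm_eq_ofReal_abs] at key
  simp only [← Real.enorm_eq_ofReal_abs] at key
  simp only [← Real.enorm_eq_ofReal_abs]
  refine key.trans ?_
  have C9 : ENNReal.ofReal (9 * C) = ENNReal.ofReal C * (3 * 3) := by
    rw [mul_comm, ENNReal.ofReal_mul hC.le]; norm_num
  have b1 : aN q1 q2 q3 ((ball (0:E3) ρ).indicator fun x => ∑ i, ‖w x i - ⨍ y in ball (0:E3) ρ, w y i‖ₑ) ≤
      3 * anisoNorm q1 q2 q3 (ball (0:E3) ρ) (fun x => ‖w x - ⨍ y in ball (0:E3) ρ, w y‖) := by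
    have e : anisoNorm q1 q2 q3 (ball (0:E3) ρ) (fun x => ‖w x - ⨍ y in ball (0:E3) ρ, w y‖) =
      aN q1 q2 q3 (fun x => ENNReal.ofReal |(ball (0:E3) ρ).indicator (fun x => ‖w x - ⨍ y in ball (0:E3) ρ, w y‖) x|) := rfl
    rw [e, ← aN_const_mul (by linarith) (by linarith) (by linarith) 3 (by simp)]
    refine aN_mono (by linarith) (by linarith) (by linarith) (Eventually.of_forall fun x => ?_)
    beta_reduce
    by_cases hx : x ∈ ball (0:E3) ρ
    · rw [indicator_of_mem hx, indicator_of_mem hx, abs_of_nonneg (norm_nonneg _), ofReal_norm]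
      have : ∀ i, ‖w x i - ⨍ y in ball (0:E3) ρ, w y i‖ₑ ≤ ‖w x - ⨍ y in ball (0:E3) ρ, w y‖ₑ := by
        intro i
        have e2 : w x i - ⨍ y in ball (0:E3) ρ, w y i = (w x - ⨍ y in ball (0:E3) ρ, w y) i := by
          rw [setAverage_eq, setAverage_eq]
          simp only [PiLp.sub_apply, PiLp.smul_apply, eval_integral_piLp iw]
        rw [e2]; exact enorm_coord _ i
      calc _ ≤ ∑ _i : Fin 3, ‖w x - ⨍ y in ball (0:E3) ρ, w y‖ₑ := Finset.sum_le_sum fun i _ => this i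
        _ = _ := by simp
    · rw [indicator_of_notMem hx]; exact zero_le
  have b2 : (∑ i, ∫⁻ x in ball (0:E3) ρ, ‖w x i - ⨍ y in ball (0:E3) ρ, w y i‖ₑ ^ 2) ^ τ ≤ 3 * (∫⁻ x in ball (0:E3) ρ, ‖w x‖ₑ ^ 2) ^ τ := by
    calc _ ≤ (3 * ∫⁻ x in ball (0:E3) ρ, ‖w x‖ₑ ^ 2) ^ τ := by
          refine ENNReal.rpow_le_rpow ?_ hτ0
          calc _ ≤ ∑ _i : Fin 3, ∫⁻ x in ball (0:E3) ρ, ‖w x‖ₑ ^ 2 := Finset.sum_le_sum fun i _ =>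
                (var_le (lw i)).trans (lintegral_mono fun x => pow_le_pow_left' (enorm_coord _ i) 2)
            _ = _ := by simp
      _ ≤ _ := by
          rw [ENNReal.mul_rpow_of_nonneg _ _ hτ0]
          refine mul_le_mul' ?_ le_rfl
          calc (3:ℝ≥0∞) ^ τ ≤ 3 ^ (1:ℝ) := ENNReal.rpow_le_rpow_of_exponent_le (by norm_num) hτ1.le
            _ = 3 := ENNReal.rpow_one _
  have b3 : ∑ i, ∑ j, ∫⁻ x in ball (0:E3) ρ, ‖g x i j‖ₑ ^ 2 =
      ∫⁻ x in ball (0:E3) ρ, ENNReal.ofReal (∑ i : Fin 3, ∑ j : Fin 3, (g x i j) ^ 2) := by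
    have mij : ∀ i j, Measurable fun x => ‖g x i j‖ₑ ^ 2 := fun i j =>
      ((by fun_prop : Measurable fun z : Fin 3 → Fin 3 → ℝ => z i j).comp mg).enorm.pow_const 2
    rw [Finset.sum_congr rfl fun i _ => (lintegral_finsetSum _ fun j _ => mij i j).symm,
      ← lintegral_finsetSum _ fun i _ => Finset.measurable_fun_sum _ fun j _ => mij i j]
    refine lintegral_congr fun x => ?_
    rw [ENNReal.ofReal_sum_of_nonneg fun i _ => Finset.sum_nonneg fun j _ => sq_nonneg _]
    refine Finset.sum_congr rfl fun i _ => ?_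
    rw [ENNReal.ofReal_sum_of_nonneg fun j _ => sq_nonneg _]
    refine Finset.sum_congr rfl fun j _ => ?_
    rw [Real.enorm_eq_ofReal_abs, ← ENNReal.ofReal_pow (abs_nonneg _), sq_abs]
  rw [b3]
  refine add_le_add ?_ (mul_le_mul' (ENNReal.ofReal_le_ofReal (by linarith)) le_rfl)
  rw [C9, mul_assoc]
  refine mul_le_mul' le_rfl ?_
  calc _ ≤ (3 * anisoNorm q1 q2 q3 (ball (0:E3) ρ) (fun x => ‖w x - ⨍ y in ball (0:E3) ρ, w y‖)) *
        ((3 * (∫⁻ x in ball (0:E3) ρ, ‖w x‖ₑ ^ 2) ^ τ) *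
          (∫⁻ x in ball (0:E3) ρ, ENNReal.ofReal (∑ i : Fin 3, ∑ j : Fin 3, (g x i j) ^ 2)) ^ (1 - τ)) :=
        mul_le_mul' b1 (mul_le_mul' b2 le_rfl)
    _ = _ := by ring

end NSD

end

section

namespace NSD

lemma meas_avg {V : Type*} [NormedAddCommGroup V] [NormedSpace ℝ V] [MeasurableSpace V] [BorelSpace V] [SecondCountableTopology V]
    {u : E3 → ℝ → V} (hu : Measurable (Function.uncurry u)) (r : ℝ) :
    Measurable fun t => ⨍ y in ball (0:E3) r, u y t := by
  simp only [setAverage_eq]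
  have : StronglyMeasurable fun t => ∫ y in ball (0:E3) r, u y t :=
    StronglyMeasurable.integral_prod_left (f := u) hu.stronglyMeasurable
  exact (this.measurable).const_smul _

lemma meas_dev {V : Type*} [NormedAddCommGroup V] [NormedSpace ℝ V] [MeasurableSpace V] [BorelSpace V] [SecondCountableTopology V]
    {u : E3 → ℝ → V} (hu : Measurable (Function.uncurry u)) (r : ℝ) :
    Measurable fun z : E3 × ℝ => u z.1 z.2 - ⨍ y in ball (0:E3) r, u y z.2 :=
  hu.sub ((meas_avg hu r).comp measurable_snd)

lemma meas_pt3 : Measurable fun z : ℝ × ℝ × ℝ => pt3 z.1 z.2.1 z.2.2 := by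
  have : Measurable fun z : ℝ × ℝ × ℝ => (![z.1, z.2.1, z.2.2] : Fin 3 → ℝ) := by
    rw [measurable_pi_iff]
    intro i
    fin_cases i
    · exact measurable_fst
    · exact measurable_fst.comp measurable_snd
    · exact measurable_snd.comp measurable_snd
  exact (MeasurableEquiv.toLp 2 (Fin 3 → ℝ)).measurable.comp this

lemma meas_aniso {q1 q2 q3 r : ℝ} {f : E3 → ℝ → ℝ} (hf : Measurable (Function.uncurry f)) :
    Measurable fun t => anisoNorm q1 q2 q3 (ball (0:E3) r) (fun x => f x t) := by
  unfold anisoNorm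
  have m0 : Measurable fun z : E3 × ℝ => (ball (0:E3) r).indicator (fun x => f x z.2) z.1 := by
    have : (fun z : E3 × ℝ => (ball (0:E3) r).indicator (fun x => f x z.2) z.1) =
        (Prod.fst ⁻¹' (ball (0:E3) r)).indicator (Function.uncurry f) := by
      funext z
      by_cases h : z.1 ∈ ball (0:E3) r
      · rw [indicator_of_mem h, indicator_of_mem (show z ∈ Prod.fst ⁻¹' (ball (0:E3) r) from h)]; rfl
      · rw [indicator_of_notMem h, indicator_of_notMem (show z ∉ Prod.fst ⁻¹' (ball (0:E3) r) from h)]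
    rw [this]
    exact hf.indicator (measurable_fst measurableSet_ball)
  have m1 : Measurable fun z : ((ℝ × ℝ) × ℝ) × ℝ => (ENNReal.ofReal |(ball (0:E3) r).indicator (fun x => f x z.1.1.1) (pt3 z.2 z.1.2 z.1.1.2)|) ^ q1 := by
    have : Measurable fun z : ((ℝ × ℝ) × ℝ) × ℝ => (pt3 z.2 z.1.2 z.1.1.2, z.1.1.1) :=
      (meas_pt3.comp (by fun_prop : Measurable fun z : ((ℝ × ℝ) × ℝ) × ℝ => (z.2, z.1.2, z.1.1.2))).prodMk (by fun_prop)
    exact (ENNReal.measurable_ofReal.comp (continuous_abs.measurable.comp (m0.comp this))).pow_const _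
  have m2 := (m1.lintegral_prod_right' (ν := volume)).pow_const (q2/q1)
  have m3 := (m2.lintegral_prod_right' (ν := volume)).pow_const (q3/q2)
  exact (m3.lintegral_prod_right' (ν := volume)).pow_const (1/q3)

lemma time_holder {ν : Measure ℝ} {p : ℝ≥0∞} (hp : 1 ≤ p) {A X Y : ℝ → ℝ≥0∞} {M S : ℝ≥0∞} (hτ : 1/p.toReal < 1)
    (hM : M = if p = ∞ then essSup A ν else (∫⁻ t, A t ^ p.toReal ∂ν) ^ (1/p.toReal))
    (mA : Measurable A) (mY : Measurable Y) (hX : ∀ᵐ t ∂ν, X t ≤ S) :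
    ∫⁻ t, A t * (X t ^ (1/p.toReal) * Y t ^ (1 - 1/p.toReal)) ∂ν ≤ M * (S ^ (1/p.toReal) * (∫⁻ t, Y t ∂ν) ^ (1 - 1/p.toReal)) := by
  by_cases h : p = ∞
  · subst h
    simp only [if_true] at hM
    simp only [ENNReal.toReal_top, _root_.div_zero, ENNReal.rpow_zero, one_mul, sub_zero, ENNReal.rpow_one]
    rw [← lintegral_const_mul _ mY]
    refine lintegral_mono_ae ?_
    filter_upwards [ENNReal.ae_le_essSup A] with t ht
    rw [hM]; exact mul_le_mul' ht le_rfl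
  · rw [if_neg h] at hM
    have p1 : 1 ≤ p.toReal := by
      have := ENNReal.toReal_mono h hp; simpa using this
    set P := p.toReal
    have p2 : 1 < P := by
      rcases p1.eq_or_lt with e | e
      · rw [← e] at hτ; norm_num at hτ
      · exact e
    have t0 : 0 < 1 - 1/P := by linarith
    have hc : P.HolderConjugate (1/(1-1/P)) := by
      refine Real.holderConjugate_iff.2 ⟨p2, ?_⟩
      rw [one_div (1 - 1/P), inv_inv]; rw [one_div]; ring
    calc _ ≤ ∫⁻ t, S ^ (1/P) * (A t * Y t ^ (1 - 1/P)) ∂ν := by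
          refine lintegral_mono_ae ?_
          filter_upwards [hX] with t ht
          calc _ ≤ A t * (S ^ (1/P) * Y t ^ (1 - 1/P)) :=
                mul_le_mul' le_rfl (mul_le_mul' (ENNReal.rpow_le_rpow ht (by positivity)) le_rfl)
            _ = _ := by ring
      _ = S ^ (1/P) * ∫⁻ t, A t * Y t ^ (1 - 1/P) ∂ν := by
          have mm : Measurable fun t => A t * Y t ^ (1 - 1/P) := mA.mul (mY.pow_const _)
          rw [lintegral_const_mul _ mm]
      _ ≤ S ^ (1/P) * ((∫⁻ t, A t ^ P ∂ν) ^ (1/P) * (∫⁻ t, (Y t ^ (1 - 1/P)) ^ (1/(1-1/P)) ∂ν) ^ (1/(1/(1-1/P)))) :=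
          mul_le_mul' le_rfl (ENNReal.lintegral_mul_le_Lp_mul_Lq ν hc mA.aemeasurable (mY.pow_const _).aemeasurable)
      _ = _ := by
          have e : ∀ t, (Y t ^ (1 - 1/P)) ^ (1/(1-1/P)) = Y t := fun t => by
            rw [← ENNReal.rpow_mul, mul_one_div_cancel t0.ne', ENNReal.rpow_one]
          simp only [e, one_div_one_div]
          rw [hM]; ring

end NSD

end

section

namespace NSD

lemma final_scale {ρ μ : ℝ} (hρ : 0 < ρ) (hμ : 0 < μ) {τ : ℝ} {K D M S Y A' B' E Es Dρ : ℝ≥0∞} (hτ0 : 0 ≤ τ) (hτ1 : τ < 1)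
    (hM : A' = (ENNReal.ofReal ρ)⁻¹ * M) (hS : S = ENNReal.ofReal ρ * E) (hY : Es = (ENNReal.ofReal ρ)⁻¹ * Y)
    (hB : Dρ = (ENNReal.ofReal ρ ^ 2)⁻¹ * B')
    (h : D ≤ K * (M * (S ^ τ * Y ^ (1 - τ))) + K * (ENNReal.ofReal (μ/ρ) ^ (9/2:ℝ) * B')) :
    (ENNReal.ofReal μ ^ 2)⁻¹ * D ≤ K * ENNReal.ofReal (ρ/μ) ^ 2 * A' * Es ^ (1 - τ) * E ^ τ
      + K * ENNReal.ofReal (μ/ρ) ^ ((5:ℝ)/2) * Dρ := by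
  have r0 : ENNReal.ofReal ρ ≠ 0 := by simpa using hρ
  have rt : ENNReal.ofReal ρ ≠ ∞ := ENNReal.ofReal_ne_top
  have m0 : ENNReal.ofReal μ ≠ 0 := by simpa using hμ
  have mt : ENNReal.ofReal μ ≠ ∞ := ENNReal.ofReal_ne_top
  have q1 : ENNReal.ofReal (ρ/μ) = ENNReal.ofReal ρ * (ENNReal.ofReal μ)⁻¹ := by
    rw [ENNReal.ofReal_div_of_pos hμ, div_eq_mul_inv]
  have eM : M = ENNReal.ofReal ρ * A' := by rw [hM, ← mul_assoc, ENNReal.mul_inv_cancel r0 rt, one_mul]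
  have eY : Y = ENNReal.ofReal ρ * Es := by rw [hY, ← mul_assoc, ENNReal.mul_inv_cancel r0 rt, one_mul]
  have eB : B' = ENNReal.ofReal ρ ^ 2 * Dρ := by
    rw [hB, ← mul_assoc, ENNReal.mul_inv_cancel (pow_ne_zero 2 r0) (ENNReal.pow_ne_top rt), one_mul]
  have q2 : ENNReal.ofReal (μ/ρ) ^ ((5:ℝ)/2) = ENNReal.ofReal (ρ/μ) ^ 2 * ENNReal.ofReal (μ/ρ) ^ (9/2:ℝ) := by
    rw [ENNReal.ofReal_rpow_of_nonneg (by positivity) (by norm_num), ENNReal.ofReal_rpow_of_nonneg (by positivity) (by norm_num),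
      ← ENNReal.ofReal_pow (by positivity), ← ENNReal.ofReal_mul (by positivity)]
    congr 1
    have : (9/2:ℝ) = 5/2 + 2 := by norm_num
    rw [this, Real.rpow_add (by positivity), Real.rpow_two]
    field_simp
  have q3 : ENNReal.ofReal ρ ^ τ * ENNReal.ofReal ρ ^ (1 - τ) = ENNReal.ofReal ρ := by
    rw [← ENNReal.rpow_add _ _ r0 rt, add_sub_cancel, ENNReal.rpow_one]
  have q4 : (ENNReal.ofReal μ ^ 2)⁻¹ = ((ENNReal.ofReal μ)⁻¹) ^ 2 := ENNReal.inv_pow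
  refine (mul_le_mul' le_rfl h).trans (le_of_eq ?_)
  rw [eM, eY, eB, hS, q2, ENNReal.mul_rpow_of_nonneg _ _ hτ0, ENNReal.mul_rpow_of_nonneg _ _ (by linarith : 0 ≤ 1 - τ), q1, q4, mul_add]
  congr 1
  · calc _ = K * (ENNReal.ofReal ρ * ((ENNReal.ofReal ρ ^ τ * ENNReal.ofReal ρ ^ (1 - τ)))) * ((ENNReal.ofReal μ)⁻¹) ^ 2 * A' * Es ^ (1 - τ) * E ^ τ := by ring
      _ = _ := by rw [q3]; ring
  · ring

end NSD

end

/-- Lemma 3.2: for `0 < 4√6 μ ≤ ρ`,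
`D_{3/2}(μ) ≤ C (ρ/μ)² E_{p,q⃗}(ρ) E_*(ρ)^{1−1/p} E(ρ)^{1/p} + C (μ/ρ)^{5/2} D_{3/2}(ρ)`,
with `C` depending only on `p`, `q⃗` satisfying `2/p + 1/q̄ = 2`, `q_j > 1`. -/
theorem lemma_D32_decay
    (p : ℝ≥0∞) (q1 q2 q3 : ℝ) (hp : 1 ≤ p)
    (hq1 : 1 < q1) (hq2 : 1 < q2) (hq3 : 1 < q3)
    (hpq : 2 / p.toReal + (1/q1 + 1/q2 + 1/q3) = 2) :
    ∃ C : ℝ, 0 < C ∧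
      ∀ (ρ μ : ℝ) (u : E3 → ℝ → E3) (P : E3 → ℝ → ℝ)
        (sol : SuitableWeakSolution ρ u P), 0 < μ → 4 * Real.sqrt 6 * μ ≤ ρ →
        energyD32 μ P
          ≤ ENNReal.ofReal C * (ENNReal.ofReal (ρ/μ)) ^ 2
              * energyEpq p q1 q2 q3 ρ u
              * (energyEstar ρ sol.gu) ^ ((1 : ℝ) - 1/p.toReal)
              * (energyE ρ u) ^ ((1 : ℝ)/p.toReal)
            + ENNReal.ofReal C * (ENNReal.ofReal (μ/ρ)) ^ ((5 : ℝ)/2)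
              * energyD32 ρ P := by
  have hτ0 : 0 ≤ 1/p.toReal := by positivity
  have hsum : 0 < 1/q1 + 1/q2 + 1/q3 := by positivity
  have e2 : 2 / p.toReal = 2 * (1/p.toReal) := by ring
  have hτ1 : 1/p.toReal < 1 := by rw [e2] at hpq; linarith
  obtain ⟨C, C0, hC⟩ := NSD.FT_final hτ0 hτ1 hq1 hq2 hq3 (by rw [← e2]; exact hpq)
  refine ⟨9 * C, by positivity, fun ρ μ u P sol hμ hμρ => ?_⟩
  have s6 : 2 ≤ Real.sqrt 6 := Real.le_sqrt_of_sq_le (by norm_num)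
  have h8 : μ ≤ ρ/8 := by nlinarith
  have hρ : 0 < ρ := by linarith
  have r0 : ENNReal.ofReal ρ ≠ 0 := by simpa using hρ
  refine NSD.final_scale hρ hμ hτ0 hτ1 (S := ENNReal.ofReal ρ * energyE ρ u) rfl rfl rfl rfl ?_
  have mA : Measurable fun t => anisoNorm q1 q2 q3 (ball (0:E3) ρ) (fun x => ‖u x t - ⨍ y in ball (0:E3) ρ, u y t‖) :=
    NSD.meas_aniso (f := fun x t => ‖u x t - ⨍ y in ball (0:E3) ρ, u y t‖) (NSD.meas_dev sol.meas_u ρ).norm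
  have mY : Measurable fun t => ∫⁻ x in ball (0:E3) ρ, ENNReal.ofReal (∑ i : Fin 3, ∑ j : Fin 3, (sol.gu x t i j) ^ 2) := by
    have : Measurable fun z : E3 × ℝ => ENNReal.ofReal (∑ i : Fin 3, ∑ j : Fin 3, (sol.gu z.1 z.2 i j) ^ 2) := by
      refine ENNReal.measurable_ofReal.comp (Finset.measurable_fun_sum _ fun i _ => Finset.measurable_fun_sum _ fun j _ => ?_)
      exact (NSD.meas_gij sol i j).pow_const 2
    exact this.lintegral_prod_left'
  have mB : Measurable fun t => ∫⁻ x in ball (0:E3) ρ, ENNReal.ofReal |P x t - ⨍ y in ball (0:E3) ρ, P y t| ^ (3/2:ℝ) := by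
    have : Measurable fun z : E3 × ℝ => ENNReal.ofReal |P z.1 z.2 - ⨍ y in ball (0:E3) ρ, P y z.2| ^ (3/2:ℝ) :=
      (ENNReal.measurable_ofReal.comp (continuous_abs.measurable.comp (NSD.meas_dev sol.meas_press ρ))).pow_const _
    exact this.lintegral_prod_left'
  have hX : ∀ᵐ t ∂(volume.restrict (Ioo (-(ρ^2)) 0)), ∫⁻ x in ball (0:E3) ρ, ‖u x t‖ₑ ^ 2 ≤ ENNReal.ofReal ρ * energyE ρ u := by
    filter_upwards [ENNReal.ae_le_essSup (μ := volume.restrict (Ioo (-(ρ^2)) 0)) fun t => (ENNReal.ofReal ρ)⁻¹ *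
      ∫⁻ x in ball (0 : E3) ρ, ((‖u x t‖₊ : ℝ≥0∞)) ^ 2] with t ht
    have := mul_le_mul' (le_refl (ENNReal.ofReal ρ)) ht
    rw [← mul_assoc, ENNReal.mul_inv_cancel r0 ENNReal.ofReal_ne_top, one_mul] at this
    exact this
  have sub : Ioo (-(μ^2)) 0 ⊆ Ioo (-(ρ^2)) 0 := Ioo_subset_Ioo (by nlinarith) le_rfl
  have hH := NSD.time_holder (ν := volume.restrict (Ioo (-(ρ^2)) 0)) hp hτ1 rfl mA mY hX
  calc _ ≤ ∫⁻ t in Ioo (-(ρ^2)) 0, ∫⁻ x in ball (0:E3) μ, ENNReal.ofReal |P x t - ⨍ y in ball (0:E3) μ, P y t| ^ (3/2:ℝ) :=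
        lintegral_mono_set sub
    _ ≤ ∫⁻ t in Ioo (-(ρ^2)) 0, (ENNReal.ofReal (9 * C) * (anisoNorm q1 q2 q3 (ball (0:E3) ρ) (fun x => ‖u x t - ⨍ y in ball (0:E3) ρ, u y t‖) *
        ((∫⁻ x in ball (0:E3) ρ, ‖u x t‖ₑ ^ 2) ^ (1/p.toReal) *
          (∫⁻ x in ball (0:E3) ρ, ENNReal.ofReal (∑ i : Fin 3, ∑ j : Fin 3, (sol.gu x t i j) ^ 2)) ^ (1 - 1/p.toReal)))
      + ENNReal.ofReal (9 * C) * (ENNReal.ofReal (μ/ρ) ^ (9/2:ℝ) *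
        ∫⁻ x in ball (0:E3) ρ, ENNReal.ofReal |P x t - ⨍ y in ball (0:E3) ρ, P y t| ^ (3/2:ℝ))) := by
        refine lintegral_mono_ae ?_
        filter_upwards [NSD.ae_FT sol] with t ht
        exact NSD.slice hτ0 hτ1 hq1 hq2 hq3 C0 hC hμ h8 (w := fun x => u x t) (g := fun x => sol.gu x t) (p := fun x => P x t)
          (NSD.meas_slice sol.meas_gu t) ht.1 ht.2.1 ht.2.2
    _ = ENNReal.ofReal (9 * C) * (∫⁻ t in Ioo (-(ρ^2)) 0, anisoNorm q1 q2 q3 (ball (0:E3) ρ) (fun x => ‖u x t - ⨍ y in ball (0:E3) ρ, u y t‖) *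
        ((∫⁻ x in ball (0:E3) ρ, ‖u x t‖ₑ ^ 2) ^ (1/p.toReal) *
          (∫⁻ x in ball (0:E3) ρ, ENNReal.ofReal (∑ i : Fin 3, ∑ j : Fin 3, (sol.gu x t i j) ^ 2)) ^ (1 - 1/p.toReal)))
      + ENNReal.ofReal (9 * C) * (ENNReal.ofReal (μ/ρ) ^ (9/2:ℝ) *
        ∫⁻ t in Ioo (-(ρ^2)) 0, ∫⁻ x in ball (0:E3) ρ, ENNReal.ofReal |P x t - ⨍ y in ball (0:E3) ρ, P y t| ^ (3/2:ℝ)) := by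
        rw [lintegral_add_right _ ((mB.const_mul _).const_mul _), lintegral_const_mul' _ _ ENNReal.ofReal_ne_top,
          lintegral_const_mul' _ _ ENNReal.ofReal_ne_top, lintegral_const_mul _ mB]
    _ ≤ _ := add_le_add (mul_le_mul' le_rfl hH) le_rfl
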